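/- Beurling–Ahlfors extension theorem: Let η be an orientation-preserving homeomorphism of the unit circle S¹. Then η is quasisymmetric if and only if η extends to the closed unit disc as a homeomorphism F of the closed disc onto itself whose restriction to the open unit disc 𝔻 is a quasiconformal homeomorphism of 𝔻 onto 𝔻, with F restricted to S¹ equal to η. -/

import Mathlib

open Complex MeasureTheory Metric Set Real

/-- The open unit disc in `ℂ`. -/
def unitDisc : Set ℂ := Metric.ball (0 : ℂ) 1

/-- The Wirtinger derivative `∂_z f = (∂_x f − i ∂_y f)/2` of `f : ℂ → ℂ`. -/
noncomputable def wirtingerZ (f : ℂ → ℂ) (z : ℂ) : ℂ :=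
  (fderiv ℝ f z 1 - Complex.I * fderiv ℝ f z Complex.I) / 2

/-- The Wirtinger derivative `∂_z̄ f = (∂_x f + i ∂_y f)/2` of `f : ℂ → ℂ`. -/
noncomputable def wirtingerZBar (f : ℂ → ℂ) (z : ℂ) : ℂ :=
  (fderiv ℝ f z 1 + Complex.I * fderiv ℝ f z Complex.I) / 2

/-- `g` and `h` are the distributional derivatives `∂_z f` and `∂_z̄ f` of `f` on the open
set `A ⊆ ℂ`. -/
def HasDistribWirtingerDerivs (A : Set ℂ) (f g h : ℂ → ℂ) : Prop :=
  MeasureTheory.LocallyIntegrableOn g A ∧ MeasureTheory.LocallyIntegrableOn h A ∧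
  ∀ φ : ℂ → ℂ, ContDiff ℝ (⊤ : ℕ∞) φ → HasCompactSupport φ → tsupport φ ⊆ A →
    (∫ z in A, f z * wirtingerZ φ z) = -∫ z in A, g z * φ z ∧
    (∫ z in A, f z * wirtingerZBar φ z) = -∫ z in A, h z * φ z

/-- `f` is a `k`-quasiconformal map on the open set `A` for some `0 ≤ k < 1`: it admits
locally integrable distributional derivatives `∂_z f = g`, `∂_z̄ f = h` on `A` with
`‖h‖ ≤ k ‖g‖` almost everywhere on `A`. -/
def QuasiconformalOn (A : Set ℂ) (f : ℂ → ℂ) : Prop :=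
  ∃ k : ℝ, 0 ≤ k ∧ k < 1 ∧ ∃ g h : ℂ → ℂ,
    HasDistribWirtingerDerivs A f g h ∧
    ∀ᵐ z ∂(volume.restrict A), ‖h z‖ ≤ k * ‖g z‖

/-- `f : ℝ → ℝ` is the lift of an orientation-preserving homeomorphism of the circle:
an increasing homeomorphism of `ℝ` commuting with `x ↦ x + 1`. -/
def IsCircleLift (f : ℝ → ℝ) : Prop :=
  StrictMono f ∧ Function.Surjective f ∧ ∀ x, f (x + 1) = f x + 1

/-- Quasisymmetry of the circle homeomorphism with lift `f`, with constant `M`. -/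
def QSConst (f : ℝ → ℝ) (M : ℝ) : Prop :=
  0 < M ∧ ∀ x t : ℝ, 0 < t → t ≤ 1 / 2 →
    1 / M ≤ (f (x + t) - f x) / (f x - f (x - t)) ∧
      (f (x + t) - f x) / (f x - f (x - t)) ≤ M

open scoped Topology ComplexConjugate

lemma wirtingerZ_of_hasFDerivAt {f : ℂ → ℂ} {L : ℂ →L[ℝ] ℂ} {z : ℂ} (h : HasFDerivAt f L z) :
    wirtingerZ f z = (L 1 - Complex.I * L Complex.I) / 2 := by
  rw [wirtingerZ, h.fderiv]

lemma wirtingerZBar_of_hasFDerivAt {f : ℂ → ℂ} {L : ℂ →L[ℝ] ℂ} {z : ℂ} (h : HasFDerivAt f L z) :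
    wirtingerZBar f z = (L 1 + Complex.I * L Complex.I) / 2 := by
  rw [wirtingerZBar, h.fderiv]

/-- the scaled kernel -/
noncomputable def kerT (Φ : ℂ → ℂ) (p : ℂ) (t : ℝ) (z : ℂ) : ℂ :=
  ((t ^ 2)⁻¹ : ℝ) • Φ (p + t⁻¹ • (z - p))

lemma kerT_contDiff {Φ : ℂ → ℂ} (hΦ : ContDiff ℝ (⊤ : ℕ∞) Φ) (p : ℂ) (t : ℝ) :
    ContDiff ℝ (⊤ : ℕ∞) (kerT Φ p t) := by
  unfold kerT
  fun_prop

lemma kerT_tsupport {Φ : ℂ → ℂ} {p : ℂ} {ρ : ℝ} (hs : tsupport Φ ⊆ closedBall p ρ) {t : ℝ}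
    (ht : 0 < t) : tsupport (kerT Φ p t) ⊆ closedBall p (t * ρ) := by
  apply closure_minimal _ isClosed_closedBall
  intro z hz
  by_contra hn
  apply hz
  unfold kerT
  have : p + t⁻¹ • (z - p) ∉ tsupport Φ := by
    intro h
    apply hn
    have := hs h
    rw [mem_closedBall, dist_eq_norm] at this ⊢
    simp only [add_sub_cancel_left, norm_smul, norm_inv, Real.norm_eq_abs, abs_of_pos ht] at this
    rwa [inv_mul_le_iff₀ ht] at this
  rw [image_eq_zero_of_notMem_tsupport this, smul_zero]

lemma kerT_hasFDerivAt {Φ : ℂ → ℂ} (hΦ : ContDiff ℝ (⊤ : ℕ∞) Φ) (p : ℂ) (t : ℝ) (z : ℂ) :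
    HasFDerivAt (kerT Φ p t)
      (((t ^ 2)⁻¹ * t⁻¹ : ℝ) • fderiv ℝ Φ (p + t⁻¹ • (z - p))) z := by
  unfold kerT
  have h1 : HasFDerivAt Φ (fderiv ℝ Φ (p + t⁻¹ • (z - p))) (p + t⁻¹ • (z - p)) :=
    (hΦ.differentiable (by simp)).differentiableAt.hasFDerivAt
  have h2 : HasFDerivAt (fun z : ℂ => p + t⁻¹ • (z - p)) (t⁻¹ • ContinuousLinearMap.id ℝ ℂ) z :=
    (((hasFDerivAt_id z).sub_const p).const_smul t⁻¹).const_add p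
  have h3 := (h1.comp z h2).const_smul ((t ^ 2)⁻¹ : ℝ)
  refine HasFDerivAt.congr_fderiv (f := fun z => ((t ^ 2)⁻¹ : ℝ) • Φ (p + t⁻¹ • (z - p))) h3 ?_
  apply ContinuousLinearMap.ext
  intro v
  simp [mul_assoc]

lemma kerT_hasDerivAt {Φ : ℂ → ℂ} (hΦ : ContDiff ℝ (⊤ : ℕ∞) Φ) (p : ℂ) (z : ℂ) {t : ℝ}
    (ht : 0 < t) :
    HasDerivAt (fun t => kerT Φ p t z)
      (-(t⁻¹ : ℝ) • (wirtingerZ (fun z => (z - p) * kerT Φ p t z) z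
        + wirtingerZBar (fun z => conj (z - p) * kerT Φ p t z) z)) t := by
  have hk := kerT_hasFDerivAt hΦ p t z
  have e1 : HasFDerivAt (fun z : ℂ => z - p) (ContinuousLinearMap.id ℝ ℂ) z :=
    (hasFDerivAt_id z).sub_const p
  have e2 : HasFDerivAt (fun z : ℂ => conj (z - p)) (Complex.conjCLE : ℂ →L[ℝ] ℂ) z := by
    exact HasFDerivAt.congr_fderiv (f := fun z : ℂ => conj (z - p))
      ((Complex.conjCLE.hasFDerivAt).comp z e1) (by ext <;> simp)
  rw [wirtingerZ_of_hasFDerivAt (e1.fun_mul hk), wirtingerZBar_of_hasFDerivAt (e2.fun_mul hk)]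
  have h1 : HasFDerivAt Φ (fderiv ℝ Φ (p + t⁻¹ • (z - p))) (p + t⁻¹ • (z - p)) :=
    (hΦ.differentiable (by simp)).differentiableAt.hasFDerivAt
  have h2 : HasDerivAt (fun t : ℝ => p + t⁻¹ • (z - p)) ((-(t ^ 2)⁻¹ : ℝ) • (z - p)) t :=
    ((hasDerivAt_inv ht.ne').smul_const (z - p)).const_add p
  have h3 := h1.comp_hasDerivAt t h2
  have h4 : HasDerivAt (fun t : ℝ => (t ^ 2)⁻¹) (-(2 * t) / (t ^ 2) ^ 2) t := by
    have := (hasDerivAt_pow 2 t).fun_inv (by positivity)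
    simpa using this
  have h5 := h4.smul h3
  have hD : ∀ w : ℂ, fderiv ℝ Φ (p + t⁻¹ • (z - p)) w
      = w.re • fderiv ℝ Φ (p + t⁻¹ • (z - p)) 1 + w.im • fderiv ℝ Φ (p + t⁻¹ • (z - p)) I := by
    intro w
    rw [← map_smul, ← map_smul, ← map_add]
    congr 1
    apply Complex.ext <;> simp
  have hk' : kerT Φ p t z = ((t ^ 2)⁻¹ : ℝ) • Φ (p + t⁻¹ • (z - p)) := rfl
  refine h5.congr_deriv ?_
  simp only [map_smul]
  rw [hD (z - p)]
  simp only [hk', _root_.add_apply, _root_.smul_apply,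
    ContinuousLinearMap.id_apply, Function.comp_apply]
  set D1 := fderiv ℝ Φ (p + t⁻¹ • (z - p)) 1
  set D2 := fderiv ℝ Φ (p + t⁻¹ • (z - p)) I
  set P := Φ (p + t⁻¹ • (z - p))
  have ht' : (t : ℂ) ≠ 0 := by exact_mod_cast ht.ne'
  have hz : z - p = ((z - p).re : ℂ) + ((z - p).im : ℂ) * I := (Complex.re_add_im _).symm
  have hz' : conj (z - p) = ((z - p).re : ℂ) - ((z - p).im : ℂ) * I := by
    apply Complex.ext
    · simp
    · simp; ring
  rw [hz']
  generalize (z - p).re = a at *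
  generalize (z - p).im = b at *
  rw [hz]
  simp only [Complex.real_smul, smul_eq_mul, Complex.ofReal_neg, Complex.ofReal_inv, Complex.ofReal_mul, Complex.ofReal_pow, ContinuousLinearEquiv.coe_coe, Complex.conjCLE_apply, map_one, Complex.conj_I, Complex.ofReal_div, Complex.ofReal_ofNat]
  field_simp
  ring_nf
  simp only [Complex.I_sq]
  ring

noncomputable def kerT' (Φ : ℂ → ℂ) (p : ℂ) (t : ℝ) (z : ℂ) : ℂ :=
  ((t ^ 2)⁻¹ : ℝ) • fderiv ℝ Φ (p + t⁻¹ • (z - p)) ((-(t ^ 2)⁻¹ : ℝ) • (z - p))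
    + (-(2 * t) / (t ^ 2) ^ 2 : ℝ) • Φ (p + t⁻¹ • (z - p))

lemma kerT_hasDerivAt' {Φ : ℂ → ℂ} (hΦ : ContDiff ℝ (⊤ : ℕ∞) Φ) (p : ℂ) (z : ℂ) {t : ℝ}
    (ht : 0 < t) : HasDerivAt (fun t => kerT Φ p t z) (kerT' Φ p t z) t := by
  have h1 : HasFDerivAt Φ (fderiv ℝ Φ (p + t⁻¹ • (z - p))) (p + t⁻¹ • (z - p)) :=
    (hΦ.differentiable (by simp)).differentiableAt.hasFDerivAt
  have h2 : HasDerivAt (fun t : ℝ => p + t⁻¹ • (z - p)) ((-(t ^ 2)⁻¹ : ℝ) • (z - p)) t :=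
    ((hasDerivAt_inv ht.ne').smul_const (z - p)).const_add p
  have h3 := h1.comp_hasDerivAt t h2
  have h4 : HasDerivAt (fun t : ℝ => (t ^ 2)⁻¹) (-(2 * t) / (t ^ 2) ^ 2) t := by
    have := (hasDerivAt_pow 2 t).fun_inv (by positivity)
    simpa using this
  exact h4.smul h3

lemma kerT'_eq {Φ : ℂ → ℂ} (hΦ : ContDiff ℝ (⊤ : ℕ∞) Φ) (p : ℂ) (z : ℂ) {t : ℝ}
    (ht : 0 < t) : kerT' Φ p t z = (-(t⁻¹ : ℝ) • (wirtingerZ (fun z => (z - p) * kerT Φ p t z) z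
        + wirtingerZBar (fun z => conj (z - p) * kerT Φ p t z) z)) :=
  (kerT_hasDerivAt' hΦ p z ht).unique (kerT_hasDerivAt hΦ p z ht)

lemma kerT'_continuousOn {Φ : ℂ → ℂ} (hΦ : ContDiff ℝ (⊤ : ℕ∞) Φ) (p : ℂ) :
    ContinuousOn (fun q : ℝ × ℂ => kerT' Φ p q.1 q.2) (Ioi 0 ×ˢ univ) := by
  unfold kerT'
  have hD : Continuous (fderiv ℝ Φ) := hΦ.continuous_fderiv (by simp)
  have hc := hΦ.continuous
  have hi : ContinuousOn (fun q : ℝ × ℂ => p + q.1⁻¹ • (q.2 - p)) (Ioi 0 ×ˢ univ) := by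
    refine continuousOn_const.add (ContinuousOn.smul (continuousOn_fst.inv₀ ?_) (by fun_prop))
    rintro ⟨t, z⟩ ⟨ht, -⟩
    exact ne_of_gt ht
  have h2 : ContinuousOn (fun q : ℝ × ℂ => (q.1 ^ 2)⁻¹) (Ioi 0 ×ˢ univ) := by
    refine (continuousOn_fst.pow 2).inv₀ ?_
    rintro ⟨t, z⟩ ⟨ht, -⟩
    have : (0:ℝ) < t := ht
    exact pow_ne_zero _ this.ne'
  have h3 : ContinuousOn (fun q : ℝ × ℂ => -(2 * q.1) / (q.1 ^ 2) ^ 2) (Ioi 0 ×ˢ univ) := by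
    refine ContinuousOn.div (by fun_prop) (by fun_prop) ?_
    rintro ⟨t, z⟩ ⟨ht, -⟩
    have : (0:ℝ) < t := ht
    positivity
  refine (h2.smul (ContinuousOn.clm_apply (hD.comp_continuousOn hi) (h2.neg.smul (by fun_prop)))).add
    (h3.smul (hc.comp_continuousOn hi))

lemma kerT_integral (Φ : ℂ → ℂ) (p : ℂ) {t : ℝ} (ht : 0 < t) :
    ∫ z, kerT Φ p t z = ∫ z, Φ z := by
  unfold kerT
  rw [integral_smul]
  have h1 : ∫ z, Φ (p + t⁻¹ • (z - p)) = ∫ z, Φ (p + t⁻¹ • z) :=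
    integral_sub_right_eq_self (fun z => Φ (p + t⁻¹ • z)) p
  rw [h1]
  have h2 := Measure.integral_comp_smul (volume : Measure ℂ) (fun z => Φ (p + z)) t⁻¹
  rw [h2, integral_add_left_eq_self]
  simp only [Complex.finrank_real_complex]
  rw [smul_smul]
  have : ((t ^ 2)⁻¹ * |((t⁻¹) ^ 2)⁻¹|) = 1 := by
    rw [abs_of_pos (by positivity)]
    field_simp
  rw [this, one_smul]

/-- Integral over a big set of a function vanishing off a smaller set. -/
lemma setIntegral_shrink {A B : Set ℂ} (hA : MeasurableSet A) (hBA : B ⊆ A) {f : ℂ → ℂ}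
    (hf : ∀ z ∉ B, f z = 0) : ∫ z in A, f z = ∫ z in B, f z :=
  setIntegral_eq_of_subset_of_forall_sdiff_eq_zero hA hBA (fun z hz => hf z hz.2)

lemma weak_base {A : Set ℂ} {u g h : ℂ → ℂ} (hA : IsOpen A) (hu : ContinuousOn u A)
    (hw : HasDistribWirtingerDerivs A u g h) {p : ℂ} {ρ ε M : ℝ} (hρ : 0 < ρ)
    (hball : closedBall p (2 * ρ) ⊆ A) {Φ : ℂ → ℂ} (hΦ : ContDiff ℝ (⊤ : ℕ∞) Φ)
    (hs : tsupport Φ ⊆ closedBall p ρ) (hM : ∀ z, ‖Φ z‖ ≤ M)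
    (hε : ∀ s, 0 < s → s ≤ ρ → ∫ z in closedBall p s, (‖g z‖ + ‖h z‖) ≤ ε * s ^ 2) :
    ‖(∫ z in A, u z * Φ z) - u p * ∫ z, Φ z‖ ≤ M * ε * ρ ^ 3 := by
  have hM0 : 0 ≤ M := (norm_nonneg _).trans (hM 0)
  set B := closedBall p (2 * ρ) with hB
  have hBc : IsCompact B := isCompact_closedBall _ _
  have huB : ContinuousOn u B := hu.mono hball
  have hAm := hA.measurableSet
  have hBm : MeasurableSet B := isClosed_closedBall.measurableSet
  have hgB : IntegrableOn g B := hw.1.integrableOn_compact_subset hball hBc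
  have hhB : IntegrableOn h B := hw.2.1.integrableOn_compact_subset hball hBc
  set U : ℝ → ℂ := fun t => ∫ z in B, u z * kerT Φ p t z with hU
  have hkz : ∀ t, 0 < t → ∀ z ∉ closedBall p (t * ρ), kerT Φ p t z = 0 := by
    intro t ht z hz
    exact image_eq_zero_of_notMem_tsupport (fun h => hz (kerT_tsupport hs ht h))
  have hsub : ∀ t, t ≤ 2 → closedBall p (t * ρ) ⊆ B := fun t ht =>
    closedBall_subset_closedBall (by nlinarith)
  -- derivative
  have hder : ∀ t, 0 < t → HasDerivAt U (∫ z in B, u z * kerT' Φ p t z) t := by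
    intro t ht
    obtain ⟨C1, hC1⟩ := hBc.exists_bound_of_continuousOn huB
    have hcomp : IsCompact (Icc (t / 2) (2 * t) ×ˢ B) := isCompact_Icc.prod hBc
    obtain ⟨C2, hC2⟩ := hcomp.exists_bound_of_continuousOn
      ((kerT'_continuousOn hΦ p).mono (by
        rintro ⟨s, z⟩ ⟨hs1, -⟩
        exact ⟨lt_of_lt_of_le (by positivity) hs1.1, mem_univ _⟩))
    have hnh : Icc (t / 2) (2 * t) ∈ 𝓝 t := Icc_mem_nhds (by linarith) (by linarith)
    refine (hasDerivAt_integral_of_dominated_loc_of_deriv_le (μ := volume.restrict B)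
      (F := fun t z => u z * kerT Φ p t z) (F' := fun t z => u z * kerT' Φ p t z)
      (bound := fun _ => C1 * C2) hnh ?_ ?_ ?_ ?_ ?_ ?_).2
    · filter_upwards with s
      exact (huB.mul (kerT_contDiff hΦ p s).continuous.continuousOn).aestronglyMeasurable hBm
    · exact (huB.mul (kerT_contDiff hΦ p t).continuous.continuousOn).integrableOn_compact hBc
    · refine (huB.mul ?_).aestronglyMeasurable hBm
      exact (kerT'_continuousOn hΦ p).comp (f := fun z : ℂ => (t, z)) (by fun_prop)
        (fun z _ => ⟨ht, mem_univ _⟩)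
    · refine (ae_restrict_iff' hBm).2 (Filter.Eventually.of_forall fun z hz s hs' => ?_)
      rw [norm_mul]
      exact mul_le_mul (hC1 z hz) (hC2 (s, z) ⟨hs', hz⟩) (norm_nonneg _)
        ((norm_nonneg _).trans (hC1 z hz))
    · exact integrableOn_const hBc.measure_lt_top.ne
    · refine Filter.Eventually.of_forall fun z s hs' => ?_
      exact (kerT_hasDerivAt' hΦ p z (lt_of_lt_of_le (by positivity) hs'.1)).const_mul (u z)
  -- bound on the derivative
  have hbd : ∀ t, 0 < t → t ≤ 1 → ‖∫ z in B, u z * kerT' Φ p t z‖ ≤ M * ε * ρ ^ 3 := by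
    intro t ht ht1
    have hk := kerT_contDiff hΦ p t
    have hψ1 : ContDiff ℝ (⊤ : ℕ∞) (fun z => (z - p) * kerT Φ p t z) :=
      (contDiff_id.sub contDiff_const).mul hk
    have hψ2 : ContDiff ℝ (⊤ : ℕ∞) (fun z => conj (z - p) * kerT Φ p t z) :=
      (Complex.conjCLE.contDiff.comp (contDiff_id.sub contDiff_const)).mul hk
    have hs1 : tsupport (fun z => (z - p) * kerT Φ p t z) ⊆ B :=
      (tsupport_mul_subset_right (f := fun z => z - p) (g := kerT Φ p t)).trans
        ((kerT_tsupport hs ht).trans (hsub t (by linarith)))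
    have hs2 : tsupport (fun z => conj (z - p) * kerT Φ p t z) ⊆ B :=
      (tsupport_mul_subset_right (f := fun z => conj (z - p)) (g := kerT Φ p t)).trans
        ((kerT_tsupport hs ht).trans (hsub t (by linarith)))
    have e1 := (hw.2.2 _ hψ1 (hBc.of_isClosed_subset (isClosed_tsupport _) hs1)
      (hs1.trans hball)).1
    have e2 := (hw.2.2 _ hψ2 (hBc.of_isClosed_subset (isClosed_tsupport _) hs2)
      (hs2.trans hball)).2
    have hzW1 : ∀ z ∉ B, wirtingerZ (fun z => (z - p) * kerT Φ p t z) z = 0 := by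
      intro z hz
      have : fderiv ℝ (fun z => (z - p) * kerT Φ p t z) z = 0 :=
        image_eq_zero_of_notMem_tsupport (fun h => hz (hs1 (tsupport_fderiv_subset ℝ h)))
      simp [wirtingerZ, this]
    have hzW2 : ∀ z ∉ B, wirtingerZBar (fun z => conj (z - p) * kerT Φ p t z) z = 0 := by
      intro z hz
      have : fderiv ℝ (fun z => conj (z - p) * kerT Φ p t z) z = 0 :=
        image_eq_zero_of_notMem_tsupport (fun h => hz (hs2 (tsupport_fderiv_subset ℝ h)))
      rw [wirtingerZBar, this]
      simp
    have hz0 : ∀ z ∉ B, kerT Φ p t z = 0 := fun z hz =>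
      hkz t ht z (fun h => hz (hsub t (by linarith) h))
    rw [setIntegral_shrink hAm hball (fun z hz => by rw [hzW1 z hz, mul_zero]),
      setIntegral_shrink hAm hball (fun z hz => by rw [hz0 z hz, mul_zero, mul_zero])] at e1
    rw [setIntegral_shrink hAm hball (fun z hz => by rw [hzW2 z hz, mul_zero]),
      setIntegral_shrink hAm hball (fun z hz => by rw [hz0 z hz, mul_zero, mul_zero])] at e2
    have hcW1 : Continuous (wirtingerZ (fun z => (z - p) * kerT Φ p t z)) := by
      have := hψ1.continuous_fderiv (by simp)
      unfold wirtingerZ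
      fun_prop
    have hcW2 : Continuous (wirtingerZBar (fun z => conj (z - p) * kerT Φ p t z)) := by
      have := hψ2.continuous_fderiv (by simp)
      unfold wirtingerZBar
      fun_prop
    have e3 : ∫ z in B, u z * kerT' Φ p t z
        = (t⁻¹ : ℝ) • ((∫ z in B, g z * ((z - p) * kerT Φ p t z))
          + ∫ z in B, h z * (conj (z - p) * kerT Φ p t z)) := by
      have : ∀ z, u z * kerT' Φ p t z = (-(t⁻¹ : ℝ)) • (u z * wirtingerZ (fun z => (z - p) * kerT Φ p t z) z
          + u z * wirtingerZBar (fun z => conj (z - p) * kerT Φ p t z) z) := by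
        intro z
        rw [kerT'_eq hΦ p z ht, mul_smul_comm, mul_add]
      simp_rw [this]
      rw [integral_smul, integral_add, e1, e2, neg_smul, ← smul_neg]
      · congr 1; ring
      · exact (huB.mul hcW1.continuousOn).integrableOn_compact hBc
      · exact (huB.mul hcW2.continuousOn).integrableOn_compact hBc
    have hck : Continuous (kerT Φ p t) := hk.continuous
    have i1 : IntegrableOn (fun z => g z * ((z - p) * kerT Φ p t z)) B :=
      hgB.mul_continuousOn (by fun_prop) hBc
    have i2 : IntegrableOn (fun z => h z * (conj (z - p) * kerT Φ p t z)) B :=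
      hhB.mul_continuousOn hψ2.continuous.continuousOn hBc
    rw [e3, ← integral_add i1 i2]
    rw [setIntegral_shrink hBm (hsub t (by linarith)) (fun z hz => by
      rw [hkz t ht z hz]; simp)]
    rw [norm_smul, norm_inv, Real.norm_of_nonneg ht.le]
    have hsubB := hsub t (by linarith)
    have i3 : IntegrableOn (fun z => (‖g z‖ + ‖h z‖) * (t * ρ * ((t ^ 2)⁻¹ * M)))
        (closedBall p (t * ρ)) :=
      ((hgB.mono_set hsubB).norm.add (hhB.mono_set hsubB).norm).mul_const _
    have hle : ‖∫ z in closedBall p (t * ρ), (g z * ((z - p) * kerT Φ p t z)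
        + h z * (conj (z - p) * kerT Φ p t z))‖
        ≤ ∫ z in closedBall p (t * ρ), (‖g z‖ + ‖h z‖) * (t * ρ * ((t ^ 2)⁻¹ * M)) := by
      refine norm_integral_le_of_norm_le i3 ?_
      refine (ae_restrict_iff' isClosed_closedBall.measurableSet).2
        (Filter.Eventually.of_forall fun z hz => ?_)
      have hz' : ‖z - p‖ ≤ t * ρ := by simpa [dist_eq_norm] using hz
      have hkM : ‖kerT Φ p t z‖ ≤ (t ^ 2)⁻¹ * M := by
        unfold kerT
        rw [norm_smul, Real.norm_of_nonneg (by positivity)]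
        exact mul_le_mul_of_nonneg_left (hM _) (by positivity)
      have hprod : ‖z - p‖ * ‖kerT Φ p t z‖ ≤ t * ρ * ((t ^ 2)⁻¹ * M) :=
        mul_le_mul hz' hkM (norm_nonneg _) (by positivity)
      calc _ ≤ ‖g z * ((z - p) * kerT Φ p t z)‖ + ‖h z * (conj (z - p) * kerT Φ p t z)‖ :=
            norm_add_le _ _
        _ = (‖g z‖ + ‖h z‖) * (‖z - p‖ * ‖kerT Φ p t z‖) := by
            rw [norm_mul, norm_mul, norm_mul, norm_mul, RCLike.norm_conj]; ring
        _ ≤ _ := mul_le_mul_of_nonneg_left hprod (by positivity)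
    rw [integral_mul_const] at hle
    have hε' := hε (t * ρ) (by positivity) (by nlinarith)
    calc _ ≤ t⁻¹ * ((ε * (t * ρ) ^ 2) * (t * ρ * ((t ^ 2)⁻¹ * M))) := by
          refine mul_le_mul_of_nonneg_left (hle.trans ?_) (by positivity)
          exact mul_le_mul_of_nonneg_right hε' (by positivity)
      _ = _ := by field_simp
  -- limit at zero
  have hpB : p ∈ B := mem_closedBall_self (by positivity)
  have hlim : Filter.Tendsto U (𝓝[>] 0) (𝓝 (u p * ∫ z, Φ z)) := by
    rw [Metric.tendsto_nhds]
    intro e he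
    have hcont : ContinuousAt u p := hu.continuousAt (hA.mem_nhds (hball hpB))
    set V := volume.real (closedBall (0:ℂ) 1)
    have hV0 : 0 ≤ V := measureReal_nonneg
    set e' := e / (2 * (M * ρ ^ 2 * V + 1)) with he'
    have he'0 : 0 < e' := by positivity
    obtain ⟨δ, hδ, hδu⟩ := Metric.continuousAt_iff.1 hcont e' he'0
    have hev : ∀ᶠ t in 𝓝[>] (0:ℝ), t < min 1 (δ / ρ) :=
      (eventually_lt_nhds (by positivity)).filter_mono nhdsWithin_le_nhds
    filter_upwards [hev, self_mem_nhdsWithin] with t ht ht0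
    have ht0 : 0 < t := ht0
    have ht1 : t < 1 := ht.trans_le (min_le_left _ _)
    have htδ : t * ρ < δ := by
      have := ht.trans_le (min_le_right _ _)
      rwa [lt_div_iff₀ hρ] at this
    have hsubB := hsub t (by linarith)
    have eU : U t = ∫ z in closedBall p (t * ρ), u z * kerT Φ p t z :=
      setIntegral_shrink hBm hsubB (fun z hz => by rw [hkz t ht0 z hz, mul_zero])
    have eI : u p * ∫ z, Φ z = ∫ z in closedBall p (t * ρ), u p * kerT Φ p t z := by
      rw [← kerT_integral Φ p ht0, ← integral_const_mul, ← setIntegral_univ]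
      exact setIntegral_shrink MeasurableSet.univ (subset_univ _)
        (fun z hz => by rw [hkz t ht0 z hz, mul_zero])
    have hcb : IsCompact (closedBall p (t * ρ)) := isCompact_closedBall _ _
    have hck : Continuous (kerT Φ p t) := (kerT_contDiff hΦ p t).continuous
    rw [dist_eq_norm, eU, eI, ← integral_sub]
    rotate_left
    · exact ((huB.mono hsubB).mul hck.continuousOn).integrableOn_compact hcb
    · exact (continuousOn_const.mul hck.continuousOn).integrableOn_compact hcb
    have hnb : ‖∫ z in closedBall p (t * ρ), (u z * kerT Φ p t z - u p * kerT Φ p t z)‖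
        ≤ (e' * ((t ^ 2)⁻¹ * M)) * volume.real (closedBall p (t * ρ)) := by
      refine norm_setIntegral_le_of_norm_le_const hcb.measure_lt_top ?_
      intro z hz
      rw [← sub_mul, norm_mul]
      have h1 : ‖u z - u p‖ ≤ e' := by
        have : dist z p < δ := lt_of_le_of_lt hz htδ
        exact (dist_eq_norm (u z) (u p) ▸ (hδu this).le)
      have h2 : ‖kerT Φ p t z‖ ≤ (t ^ 2)⁻¹ * M := by
        unfold kerT
        rw [norm_smul, Real.norm_of_nonneg (by positivity)]
        exact mul_le_mul_of_nonneg_left (hM _) (by positivity)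
      exact mul_le_mul h1 h2 (norm_nonneg _) he'0.le
    have hvol : volume.real (closedBall p (t * ρ)) = (t * ρ) ^ 2 * V := by
      rw [Measure.real, Measure.addHaar_closedBall' _ _ (by positivity)]
      rw [ENNReal.toReal_mul, ENNReal.toReal_ofReal (by positivity), Complex.finrank_real_complex]
      rfl
    refine hnb.trans_lt ?_
    rw [hvol]
    have : (e' * ((t ^ 2)⁻¹ * M)) * ((t * ρ) ^ 2 * V) = e' * (M * ρ ^ 2 * V) := by
      field_simp
    rw [this, he', div_mul_eq_mul_div, div_lt_iff₀ (by positivity)]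
    have : 0 ≤ M * ρ ^ 2 * V := by positivity
    nlinarith
  -- conclusion
  have hU1 : U 1 = ∫ z in A, u z * Φ z := by
    have hk1 : ∀ z, kerT Φ p 1 z = Φ z := by intro z; simp [kerT]
    simp only [hU, hk1]
    symm
    refine setIntegral_shrink hAm hball (fun z hz => ?_)
    have := hkz 1 one_pos z (fun h => hz (hsub 1 (by norm_num) h))
    rw [hk1 z] at this
    rw [this, mul_zero]
  rw [← hU1]
  have hmv : ∀ t ∈ Ioc (0:ℝ) 1, ‖U 1 - U t‖ ≤ M * ε * ρ ^ 3 := by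
    intro t ht
    have hC0 : 0 ≤ M * ε * ρ ^ 3 := (norm_nonneg _).trans (hbd 1 one_pos le_rfl)
    have := (convex_Ioc (0:ℝ) 1).norm_image_sub_le_of_norm_hasDerivWithin_le
      (f := U) (f' := fun t => ∫ z in B, u z * kerT' Φ p t z) (C := M * ε * ρ ^ 3)
      (fun x hx => (hder x hx.1).hasDerivWithinAt) (fun x hx => hbd x hx.1 hx.2) ht
      (right_mem_Ioc.2 one_pos)
    refine this.trans ?_
    rw [Real.norm_of_nonneg (by linarith [ht.2])]
    nlinarith [ht.1]
  have hlim2 : Filter.Tendsto (fun t => ‖U 1 - U t‖) (𝓝[>] 0) (𝓝 ‖U 1 - u p * ∫ z, Φ z‖) :=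
    (tendsto_const_nhds.sub hlim).norm
  refine le_of_tendsto hlim2 ?_
  have : Ioc (0:ℝ) 1 ∈ 𝓝[>] (0:ℝ) := Ioc_mem_nhdsGT one_pos
  filter_upwards [this] with t ht using hmv t ht

lemma wirtinger_zero_off {φ : ℂ → ℂ} {z : ℂ} (hz : z ∉ tsupport φ) :
    wirtingerZ φ z = 0 ∧ wirtingerZBar φ z = 0 ∧ φ z = 0 := by
  have h1 : fderiv ℝ φ z = 0 :=
    image_eq_zero_of_notMem_tsupport (fun h => hz (tsupport_fderiv_subset ℝ h))
  refine ⟨?_, ?_, image_eq_zero_of_notMem_tsupport hz⟩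
  · rw [wirtingerZ, h1]; simp
  · rw [wirtingerZBar, h1]; simp

lemma weak_mono {A A' : Set ℂ} {u g h : ℂ → ℂ} (hA : IsOpen A) (hAA : A' ⊆ A)
    (hw : HasDistribWirtingerDerivs A u g h) : HasDistribWirtingerDerivs A' u g h := by
  refine ⟨hw.1.mono_set hAA, hw.2.1.mono_set hAA, fun φ hφ hc hs => ?_⟩
  obtain ⟨h1, h2⟩ := hw.2.2 φ hφ hc (hs.trans hAA)
  have hz := fun z (hz : z ∉ A') => wirtinger_zero_off (φ := φ) (fun h => hz (hs h))
  rw [setIntegral_shrink hA.measurableSet hAA (fun z h => by rw [(hz z h).1, mul_zero]),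
    setIntegral_shrink hA.measurableSet hAA (fun z h => by rw [(hz z h).2.2, mul_zero])] at h1
  rw [setIntegral_shrink hA.measurableSet hAA (fun z h => by rw [(hz z h).2.1, mul_zero]),
    setIntegral_shrink hA.measurableSet hAA (fun z h => by rw [(hz z h).2.2, mul_zero])] at h2
  exact ⟨h1, h2⟩

/-- product of a locally integrable function on an open set and a continuous function compactly
supported in the set -/
lemma integrable_mul_of_tsupport {A : Set ℂ} {g φ : ℂ → ℂ}
    (hg : LocallyIntegrableOn g A) (hφ : Continuous φ) (hc : HasCompactSupport φ)
    (hs : tsupport φ ⊆ A) : Integrable (fun z => g z * φ z) := by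
  have h1 : IntegrableOn g (tsupport φ) := hg.integrableOn_compact_subset hs hc
  have h2 : IntegrableOn (fun z => g z * φ z) (tsupport φ) := h1.mul_continuousOn hφ.continuousOn hc
  refine (integrableOn_iff_integrable_of_support_subset ?_).1 h2
  intro z hz
  by_contra hn
  exact hz (show g z * φ z = 0 by rw [image_eq_zero_of_notMem_tsupport hn, mul_zero])

lemma classical_weak {A : Set ℂ} {u : ℂ → ℂ} (hA : IsOpen A)
    (hd : ∀ z ∈ A, DifferentiableAt ℝ u z)
    (h1 : LocallyIntegrableOn (fun z => fderiv ℝ u z 1) A)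
    (h2 : LocallyIntegrableOn (fun z => fderiv ℝ u z I) A) :
    HasDistribWirtingerDerivs A u (wirtingerZ u) (wirtingerZBar u) := by
  have l1 : LocallyIntegrableOn (wirtingerZ u) A := by
    have e : wirtingerZ u = (2⁻¹ : ℂ) • (fun z => fderiv ℝ u z 1)
        - (I / 2) • (fun z => fderiv ℝ u z I) := by
      ext z; simp only [wirtingerZ, smul_eq_mul, Pi.sub_apply, Pi.smul_apply]; ring
    rw [e]
    exact (h1.smul (2⁻¹ : ℂ)).sub (h2.smul (I / 2))
  have l2 : LocallyIntegrableOn (wirtingerZBar u) A := by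
    have e : wirtingerZBar u = (2⁻¹ : ℂ) • (fun z => fderiv ℝ u z 1)
        + (I / 2) • (fun z => fderiv ℝ u z I) := by
      ext z; simp only [wirtingerZBar, smul_eq_mul, Pi.add_apply, Pi.smul_apply]; ring
    rw [e]
    exact (h1.smul (2⁻¹ : ℂ)).add (h2.smul (I / 2))
  refine ⟨l1, l2, fun φ hφ hc hs => ?_⟩
  have hud : ∀ z ∈ tsupport φ, HasFDerivAt u (fderiv ℝ u z) z := fun z hz =>
    (hd z (hs hz)).hasFDerivAt
  have hφd : ∀ z ∈ tsupport u, HasFDerivAt φ (fderiv ℝ φ z) z := fun z _ =>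
    (hφ.differentiable (by simp)).differentiableAt.hasFDerivAt
  have huc : ContinuousOn u A := fun z hz => (hd z hz).continuousAt.continuousWithinAt
  have hul : LocallyIntegrableOn u A := huc.locallyIntegrableOn hA.measurableSet
  have hfc := hφ.continuous_fderiv (by simp)
  have key : ∀ v : ℂ, LocallyIntegrableOn (fun z => fderiv ℝ u z v) A →
      Integrable (fun z => u z * fderiv ℝ φ z v) ∧ Integrable (fun z => fderiv ℝ u z v * φ z) ∧
      ∫ z, u z * fderiv ℝ φ z v = - ∫ z, fderiv ℝ u z v * φ z := by
    intro v hv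
    have i1 : Integrable (fun z => u z * fderiv ℝ φ z v) := by
      have hss : tsupport (fun z => fderiv ℝ φ z v) ⊆ tsupport φ := by
        apply closure_minimal _ (isClosed_tsupport _)
        intro z hz
        by_contra hn
        apply hz
        have : fderiv ℝ φ z = 0 :=
          image_eq_zero_of_notMem_tsupport (fun h => hn (tsupport_fderiv_subset ℝ h))
        simp [this]
      exact integrable_mul_of_tsupport hul (by fun_prop)
        (hc.of_isClosed_subset (isClosed_tsupport _) hss) (hss.trans hs)
    have i2 : Integrable (fun z => fderiv ℝ u z v * φ z) :=
      integrable_mul_of_tsupport hv hφ.continuous hc hs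
    have i3 : Integrable (fun z => u z * φ z) :=
      integrable_mul_of_tsupport hul hφ.continuous hc hs
    exact ⟨i1, i2, integral_bilinear_hasFDerivAt_right_eq_neg_left_of_integrable (μ := volume)
      (B := ContinuousLinearMap.mul ℝ ℂ) (v := v) i2 i1 i3 hud hφd⟩
  obtain ⟨a1, a2, a3⟩ := key 1 h1
  obtain ⟨b1, b2, b3⟩ := key I h2
  have hz := fun z (hz : z ∉ A) => wirtinger_zero_off (φ := φ) (fun h => hz (hs h))
  have full : ∀ f : ℂ → ℂ, (∀ z ∉ A, f z = 0) → ∫ z in A, f z = ∫ z, f z := by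
    intro f hf
    have := setIntegral_shrink MeasurableSet.univ (subset_univ A) hf
    rw [setIntegral_univ] at this
    exact this.symm
  constructor
  · rw [full _ (fun z h => by rw [(hz z h).1, mul_zero]),
      full _ (fun z h => by rw [(hz z h).2.2, mul_zero])]
    have e1 : ∀ z, u z * wirtingerZ φ z
        = 2⁻¹ * (u z * fderiv ℝ φ z 1) - (I / 2) * (u z * fderiv ℝ φ z I) := by
      intro z; simp only [wirtingerZ]; ring
    have e2 : ∀ z, wirtingerZ u z * φ z
        = 2⁻¹ * (fderiv ℝ u z 1 * φ z) - (I / 2) * (fderiv ℝ u z I * φ z) := by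
      intro z; simp only [wirtingerZ]; ring
    simp_rw [e1, e2]
    rw [integral_sub (a1.const_mul _) (b1.const_mul _), integral_sub (a2.const_mul _) (b2.const_mul _)]
    simp only [integral_const_mul]
    rw [a3, b3]; ring
  · rw [full _ (fun z h => by rw [(hz z h).2.1, mul_zero]),
      full _ (fun z h => by rw [(hz z h).2.2, mul_zero])]
    have e1 : ∀ z, u z * wirtingerZBar φ z
        = 2⁻¹ * (u z * fderiv ℝ φ z 1) + (I / 2) * (u z * fderiv ℝ φ z I) := by
      intro z; simp only [wirtingerZBar]; ring
    have e2 : ∀ z, wirtingerZBar u z * φ z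
        = 2⁻¹ * (fderiv ℝ u z 1 * φ z) + (I / 2) * (fderiv ℝ u z I * φ z) := by
      intro z; simp only [wirtingerZBar]; ring
    simp_rw [e1, e2]
    rw [integral_add (a1.const_mul _) (b1.const_mul _), integral_add (a2.const_mul _) (b2.const_mul _)]
    simp only [integral_const_mul]
    rw [a3, b3]; ring

lemma weak_sub {A : Set ℂ} {u g h u' g' h' : ℂ → ℂ} (hA : IsOpen A) (hu : ContinuousOn u A)
    (hu' : ContinuousOn u' A)
    (hw : HasDistribWirtingerDerivs A u g h) (hw' : HasDistribWirtingerDerivs A u' g' h') :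
    HasDistribWirtingerDerivs A (fun z => u z - u' z) (fun z => g z - g' z)
      (fun z => h z - h' z) := by
  refine ⟨hw.1.sub hw'.1, hw.2.1.sub hw'.2.1, fun φ hφ hc hs => ?_⟩
  have hul : LocallyIntegrableOn u A := hu.locallyIntegrableOn hA.measurableSet
  have hul' : LocallyIntegrableOn u' A := hu'.locallyIntegrableOn hA.measurableSet
  have hcZ : Continuous (wirtingerZ φ) := by
    have := hφ.continuous_fderiv (by simp)
    unfold wirtingerZ
    fun_prop
  have hcB : Continuous (wirtingerZBar φ) := by
    have := hφ.continuous_fderiv (by simp)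
    unfold wirtingerZBar
    fun_prop
  have sZ : tsupport (wirtingerZ φ) ⊆ tsupport φ := by
    apply closure_minimal _ (isClosed_tsupport _)
    intro z hz
    by_contra hn
    exact hz (wirtinger_zero_off hn).1
  have sB : tsupport (wirtingerZBar φ) ⊆ tsupport φ := by
    apply closure_minimal _ (isClosed_tsupport _)
    intro z hz
    by_contra hn
    exact hz (wirtinger_zero_off hn).2.1
  have cZ : HasCompactSupport (wirtingerZ φ) := hc.of_isClosed_subset (isClosed_tsupport _) sZ
  have cB : HasCompactSupport (wirtingerZBar φ) := hc.of_isClosed_subset (isClosed_tsupport _) sB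
  obtain ⟨h1, h2⟩ := hw.2.2 φ hφ hc hs
  obtain ⟨h1', h2'⟩ := hw'.2.2 φ hφ hc hs
  simp only [sub_mul]
  constructor
  · rw [integral_sub, integral_sub, h1, h1']
    · ring
    · exact (integrable_mul_of_tsupport hw.1 hφ.continuous hc hs).integrableOn
    · exact (integrable_mul_of_tsupport hw'.1 hφ.continuous hc hs).integrableOn
    · exact (integrable_mul_of_tsupport hul hcZ cZ (sZ.trans hs)).integrableOn
    · exact (integrable_mul_of_tsupport hul' hcZ cZ (sZ.trans hs)).integrableOn
  · rw [integral_sub, integral_sub, h2, h2']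
    · ring
    · exact (integrable_mul_of_tsupport hw.2.1 hφ.continuous hc hs).integrableOn
    · exact (integrable_mul_of_tsupport hw'.2.1 hφ.continuous hc hs).integrableOn
    · exact (integrable_mul_of_tsupport hul hcB cB (sB.trans hs)).integrableOn
    · exact (integrable_mul_of_tsupport hul' hcB cB (sB.trans hs)).integrableOn

lemma weak_linear (A : Set ℂ) (hA : IsOpen A) (α β : ℂ) :
    HasDistribWirtingerDerivs A (fun z => α * z + β * conj z) (fun _ => α) (fun _ => β) := by
  have hd : ∀ z : ℂ, HasFDerivAt (fun z : ℂ => α * z + β * conj z)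
      (α • ContinuousLinearMap.id ℝ ℂ + β • (Complex.conjCLE : ℂ →L[ℝ] ℂ)) z := by
    intro z
    exact ((hasFDerivAt_id z).const_mul α).add ((Complex.conjCLE.hasFDerivAt).const_mul β)
  have hf : ∀ z : ℂ, fderiv ℝ (fun z : ℂ => α * z + β * conj z) z
      = (α • ContinuousLinearMap.id ℝ ℂ + β • (Complex.conjCLE : ℂ →L[ℝ] ℂ)) := fun z => (hd z).fderiv
  have := classical_weak hA (u := fun z : ℂ => α * z + β * conj z)
    (fun z _ => (hd z).differentiableAt)
    (by simp_rw [hf]; exact continuousOn_const.locallyIntegrableOn hA.measurableSet)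
    (by simp_rw [hf]; exact continuousOn_const.locallyIntegrableOn hA.measurableSet)
  convert this using 1
  · ext z
    simp only [wirtingerZ, hf]
    simp
    ring_nf
    simp only [Complex.I_sq]; ring
  · ext z
    simp only [wirtingerZBar, hf]
    simp
    ring_nf
    simp only [Complex.I_sq]; ring

lemma two_point : ∃ K : ℝ, 0 < K ∧ ∀ (A : Set ℂ) (u g h : ℂ → ℂ) (x y : ℂ) (r ε : ℝ),
    IsOpen A → ContinuousOn u A → HasDistribWirtingerDerivs A u g h → r = dist x y → 0 < r →
    closedBall x (4 * r) ⊆ A → closedBall y (4 * r) ⊆ A →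
    (∀ s, 0 < s → s ≤ 2 * r → ∫ z in closedBall x s, (‖g z‖ + ‖h z‖) ≤ ε * s ^ 2) →
    (∀ s, 0 < s → s ≤ 2 * r → ∫ z in closedBall y s, (‖g z‖ + ‖h z‖) ≤ ε * s ^ 2) →
    ‖u x - u y‖ ≤ K * ε * r := by
  let b : ContDiffBump (0:ℂ) := ⟨1 / 2, 1, by norm_num, by norm_num⟩
  have hbc : Continuous (b.normed volume) := b.contDiff_normed.continuous (n := 0)
  obtain ⟨M0, hM0⟩ := (b.hasCompactSupport_normed (μ := volume)).exists_bound_of_continuous hbc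
  have hM0' : 0 ≤ M0 := (norm_nonneg _).trans (hM0 0)
  refine ⟨16 * M0 + 1, by positivity, ?_⟩
  intro A u g h x y r ε hA hu hw hr hr0 hx hy hεx hεy
  set Φ0 : ℂ → ℂ := fun z => ((b.normed volume (z - x) : ℝ) : ℂ) with hΦ0
  have c0 : ContDiff ℝ (⊤ : ℕ∞) Φ0 :=
    Complex.ofRealCLM.contDiff.comp (b.contDiff_normed.comp (contDiff_id.sub contDiff_const))
  have s0 : tsupport Φ0 ⊆ closedBall x 1 := by
    apply closure_minimal _ isClosed_closedBall
    intro z hz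
    have h1 : z - x ∈ Function.support (b.normed volume) := by
      intro h0
      apply hz
      simp [hΦ0, h0]
    rw [b.support_normed_eq] at h1
    have : ‖z - x‖ < 1 := by simpa [b] using h1
    rw [mem_closedBall, dist_eq_norm]
    exact this.le
  have i0 : ∫ z, Φ0 z = 1 := by
    show ∫ z, ((b.normed volume (z - x) : ℝ) : ℂ) = 1
    rw [integral_complex_ofReal]
    rw [integral_sub_right_eq_self (fun z => b.normed volume z) x, b.integral_normed]
    simp
  set Φ := kerT Φ0 x r with hΦ
  have c1 : ContDiff ℝ (⊤ : ℕ∞) Φ := kerT_contDiff c0 x r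
  have s1 : tsupport Φ ⊆ closedBall x r := by simpa using kerT_tsupport s0 hr0
  have i1 : ∫ z, Φ z = 1 := by rw [hΦ, kerT_integral _ _ hr0, i0]
  have b1 : ∀ z, ‖Φ z‖ ≤ (r ^ 2)⁻¹ * M0 := by
    intro z
    rw [hΦ, kerT, norm_smul, Real.norm_of_nonneg (by positivity)]
    refine mul_le_mul_of_nonneg_left ?_ (by positivity)
    rw [hΦ0, Complex.norm_real]
    exact hM0 _
  have sx : tsupport Φ ⊆ closedBall x (2 * r) := s1.trans (closedBall_subset_closedBall (by linarith))
  have sy : tsupport Φ ⊆ closedBall y (2 * r) := s1.trans (by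
    intro z hz
    rw [mem_closedBall] at hz ⊢
    linarith [dist_triangle z x y])
  have hx' : closedBall x (2 * (2 * r)) ⊆ A := by rwa [← mul_assoc, show (2:ℝ) * 2 = 4 by norm_num]
  have hy' : closedBall y (2 * (2 * r)) ⊆ A := by rwa [← mul_assoc, show (2:ℝ) * 2 = 4 by norm_num]
  have Wx := weak_base hA hu hw (by positivity) hx' c1 sx b1 hεx
  have Wy := weak_base hA hu hw (by positivity) hy' c1 sy b1 hεy
  rw [i1, mul_one] at Wx Wy
  have hε0 : 0 ≤ ε := by
    have h1 := hεx (2 * r) (by positivity) le_rfl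
    have h2 : 0 ≤ ∫ z in closedBall x (2 * r), (‖g z‖ + ‖h z‖) :=
      integral_nonneg (fun z => by positivity)
    by_contra hn
    push Not at hn
    nlinarith [mul_pos hr0 hr0]
  have e : (r ^ 2)⁻¹ * M0 * ε * (2 * r) ^ 3 = 8 * M0 * ε * r := by field_simp; ring
  rw [e] at Wx Wy
  calc ‖u x - u y‖ = ‖((∫ z in A, u z * Φ z) - u y) - ((∫ z in A, u z * Φ z) - u x)‖ := by
        congr 1; ring
    _ ≤ _ := norm_sub_le _ _
    _ ≤ 8 * M0 * ε * r + 8 * M0 * ε * r := add_le_add Wy Wx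
    _ ≤ (16 * M0 + 1) * ε * r := by nlinarith [mul_nonneg hε0 hr0.le]

lemma real_volume_closedBall (x : ℂ) {s : ℝ} (hs : 0 ≤ s) :
    volume.real (closedBall x s) = π * s ^ 2 := by
  rw [Measure.real, Complex.volume_closedBall, ENNReal.toReal_mul, ENNReal.toReal_pow,
    ENNReal.toReal_ofReal hs]
  simp [mul_comm]

/-- Lebesgue points. -/
lemma lebesgue_points {A : Set ℂ} (hA : IsOpen A) {g : ℂ → ℂ} (hg : LocallyIntegrableOn g A) :
    ∀ᵐ x ∂(volume.restrict A), ∀ ε > 0, ∃ ρ > 0, closedBall x ρ ⊆ A ∧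
      IntegrableOn g (closedBall x ρ) ∧
      ∀ s, 0 < s → s ≤ ρ → ∫ z in closedBall x s, ‖g z - g x‖ ≤ ε * s ^ 2 := by
  obtain ⟨u, huo, hcov, hIntg⟩ := hg.exists_nat_integrableOn
  have hae : ∀ n, ∀ᵐ x, Filter.Tendsto (fun s => ⨍ y in closedBall x s,
      ‖(u n ∩ A).indicator g y - (u n ∩ A).indicator g x‖) (𝓝[>] 0) (𝓝 0) := by
    intro n
    have hi : Integrable ((u n ∩ A).indicator g) :=
      (integrable_indicator_iff ((huo n).inter hA).measurableSet).2 (hIntg n)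
    filter_upwards [(Besicovitch.vitaliFamily (volume : Measure ℂ)).ae_tendsto_average_norm_sub
      hi.locallyIntegrable] with x hx
    exact hx.comp (Besicovitch.tendsto_filterAt volume x)
  rw [ae_restrict_iff' hA.measurableSet]
  filter_upwards [ae_all_iff.2 hae] with x hx hxA ε hε
  obtain ⟨n, hn⟩ := mem_iUnion.1 (hcov hxA)
  have hxV : x ∈ u n ∩ A := ⟨hn, hxA⟩
  have h1 := hx n
  have hε' : (0:ℝ) < ε / π := by positivity
  have h2 := (Metric.tendsto_nhds.1 h1) _ hε'
  rw [eventually_nhdsWithin_iff] at h2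
  obtain ⟨ρ1, hρ1, h3⟩ := Metric.eventually_nhds_iff.1 h2
  obtain ⟨ρ2, hρ2, h4⟩ := Metric.nhds_basis_closedBall.mem_iff.1 (((huo n).inter hA).mem_nhds hxV)
  refine ⟨min (ρ1 / 2) ρ2, by positivity, ?_, ?_, ?_⟩
  · exact (closedBall_subset_closedBall (min_le_right _ _)).trans (h4.trans inter_subset_right)
  · exact (hIntg n).mono_set ((closedBall_subset_closedBall (min_le_right _ _)).trans h4)
  · intro s hs hsρ
    have hsub : closedBall x s ⊆ u n ∩ A :=
      (closedBall_subset_closedBall (hsρ.trans (min_le_right _ _))).trans h4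
    have h5 := h3 (y := s) (by
      rw [Real.dist_eq, sub_zero, abs_of_pos hs]
      have := min_le_left (ρ1 / 2) ρ2
      linarith) hs
    rw [Real.dist_eq, sub_zero, setAverage_eq, real_volume_closedBall x hs.le] at h5
    have e : ∫ y in closedBall x s, ‖(u n ∩ A).indicator g y - (u n ∩ A).indicator g x‖
        = ∫ z in closedBall x s, ‖g z - g x‖ := by
      refine setIntegral_congr_fun measurableSet_closedBall (fun z hz => ?_)
      simp only [indicator_of_mem (hsub hz), indicator_of_mem hxV]
    rw [e] at h5
    have h6 := (le_abs_self _).trans h5.le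
    rw [smul_eq_mul, inv_mul_le_iff₀ (by positivity)] at h6
    calc _ ≤ _ := h6
      _ = ε * s ^ 2 := by field_simp

lemma volume_le_of_antilip {f : ℂ → ℂ} {X : Set ℂ} {l : ℝ} (hl : 0 < l)
    (hf : ∀ x ∈ X, ∀ y ∈ X, l * dist x y ≤ dist (f x) (f y)) :
    ENNReal.ofReal (l ^ 2) * volume X ≤ volume (f '' X) := by
  have hH : (Measure.hausdorffMeasure (Module.finrank ℝ ℂ : ℝ) : Measure ℂ).IsAddHaarMeasure :=
    isAddHaarMeasure_hausdorffMeasure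
  rw [Complex.finrank_real_complex] at hH
  have hv : (volume : Measure ℂ)
      = (volume : Measure ℂ).addHaarScalarFactor (Measure.hausdorffMeasure ((2:ℕ):ℝ)) •
        (Measure.hausdorffMeasure ((2:ℕ):ℝ) : Measure ℂ) :=
    Measure.isAddLeftInvariant_eq_smul _ _
  have hinj : InjOn f X := by
    intro x hx y hy hxy
    have := hf x hx y hy
    rw [hxy, dist_self] at this
    have h2 : dist x y ≤ 0 := by
      by_contra hn
      push Not at hn
      nlinarith
    exact dist_le_zero.1 h2
  have hlip : LipschitzOnWith (Real.toNNReal l⁻¹) (Function.invFunOn f X) (f '' X) := by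
    refine LipschitzOnWith.of_dist_le_mul ?_
    rintro _ ⟨x, hx, rfl⟩ _ ⟨y, hy, rfl⟩
    rw [hinj.leftInvOn_invFunOn hx, hinj.leftInvOn_invFunOn hy,
      Real.coe_toNNReal _ (by positivity)]
    have := hf x hx y hy
    rw [inv_mul_eq_div, le_div_iff₀ hl]
    linarith
  have himg : Function.invFunOn f X '' (f '' X) = X := hinj.leftInvOn_invFunOn.image_image
  have h1 := hlip.hausdorffMeasure_image_le (d := ((2:ℕ):ℝ)) (by norm_num)
  rw [himg] at h1
  have h2 : volume X ≤ ((Real.toNNReal l⁻¹ : NNReal) : ENNReal) ^ 2 * volume (f '' X) := by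
    have hv' : ∀ Y : Set ℂ, volume Y
        = ((volume : Measure ℂ).addHaarScalarFactor (Measure.hausdorffMeasure ((2:ℕ):ℝ)) : ENNReal)
          * (Measure.hausdorffMeasure ((2:ℕ):ℝ) : Measure ℂ) Y := by
      intro Y
      conv_lhs => rw [hv]
      rfl
    rw [hv', hv']
    rw [ENNReal.rpow_natCast] at h1
    refine (mul_le_mul_right h1 _).trans_eq ?_
    ring
  calc ENNReal.ofReal (l ^ 2) * volume X
      ≤ ENNReal.ofReal (l ^ 2) * (((Real.toNNReal l⁻¹ : NNReal) : ENNReal) ^ 2 * volume (f '' X)) := by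
        gcongr
    _ = (ENNReal.ofReal (l ^ 2) * ENNReal.ofReal (l⁻¹) ^ 2) * volume (f '' X) := by
        rw [mul_assoc]; rfl
    _ = volume (f '' X) := by
        rw [← ENNReal.ofReal_pow (by positivity), ← ENNReal.ofReal_mul (by positivity)]
        rw [show l ^ 2 * l⁻¹ ^ 2 = 1 by field_simp]
        simp

lemma area_abstract {A : Set ℂ} {f : ℂ → ℂ} (hf : ContinuousOn f A)
    (hi : InjOn f A) {g : ℂ → ℂ} (hg : AEStronglyMeasurable g (volume.restrict A))
    {ι : Type*} [Countable ι]
    (T : ι → Set ℂ) (hT : ∀ n, MeasurableSet (T n)) (l : ι → ℝ)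
    (hl : ∀ n, 0 < l n)
    (hfT : ∀ n, ∀ x ∈ T n, ∀ y ∈ T n, l n * dist x y ≤ dist (f x) (f y)) {C : ℝ}
    (hae : ∀ᵐ x ∂(volume.restrict A), g x ≠ 0 → ∃ n, x ∈ T n ∧ ‖g x‖ ≤ C * l n)
    {S : Set ℂ} (hS : MeasurableSet S) (hSA : S ⊆ A) :
    ∫⁻ z in S, ‖g z‖ₑ ^ 2 ≤ ENNReal.ofReal (C ^ 2) * volume (f '' S) := by
  rcases isEmpty_or_nonempty ι with hem | hne
  · have : ∀ᵐ x ∂(volume.restrict S), ‖g x‖ₑ ^ 2 = 0 := by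
      filter_upwards [ae_mono (Measure.restrict_mono hSA le_rfl) hae] with x hx
      by_contra hn
      obtain ⟨n, -⟩ := hx (fun h => hn (by simp [h]))
      exact hem.elim n
    rw [lintegral_congr_ae this]
    simp
  obtain ⟨e, he⟩ := exists_surjective_nat ι
  set g' := hg.mk g with hg'
  have hgm : Measurable g' := hg.stronglyMeasurable_mk.measurable
  set T' : ℕ → Set ℂ := fun n => T (e n) ∩ {z | ‖g' z‖ ≤ C * l (e n)} with hT'
  have hT'm : ∀ n, MeasurableSet (T' n) := fun n =>
    (hT _).inter (measurableSet_le hgm.norm measurable_const)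
  have haeS : ∀ᵐ x ∂(volume.restrict S), ‖g x‖ₑ ^ 2
      = (⋃ n, T' n).indicator (fun x => ‖g' x‖ₑ ^ 2) x := by
    filter_upwards [ae_mono (Measure.restrict_mono hSA le_rfl) hae,
      ae_mono (Measure.restrict_mono hSA le_rfl) hg.ae_eq_mk] with x hx hx2
    rw [hx2]
    by_cases h0 : g x = 0
    · have : g' x = 0 := by rw [hg', ← hx2, h0]
      by_cases hm : x ∈ ⋃ n, T' n
      · rw [indicator_of_mem hm]
      · rw [indicator_of_notMem hm, ← hg', this]; simp
    · obtain ⟨n, hn, hn2⟩ := hx h0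
      obtain ⟨m, rfl⟩ := he n
      rw [indicator_of_mem]
      refine mem_iUnion.2 ⟨m, hn, ?_⟩
      show ‖g' x‖ ≤ _
      rw [hg', ← hx2]; exact hn2
  rw [lintegral_congr_ae haeS, lintegral_indicator (MeasurableSet.iUnion hT'm),
    Measure.restrict_restrict (MeasurableSet.iUnion hT'm), ← iUnion_disjointed, iUnion_inter]
  have hDm : ∀ n, MeasurableSet (disjointed T' n ∩ S) := fun n =>
    (MeasurableSet.disjointed hT'm n).inter hS
  have hDd : Pairwise (Function.onFun Disjoint (fun n => disjointed T' n ∩ S)) := by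
    intro i j hij
    exact ((disjoint_disjointed T') hij).mono inter_subset_left inter_subset_left
  rw [lintegral_iUnion hDm hDd]
  have hterm : ∀ n, ∫⁻ a in disjointed T' n ∩ S, ‖g' a‖ₑ ^ 2
      ≤ ENNReal.ofReal (C ^ 2) * volume (f '' (disjointed T' n ∩ S)) := by
    intro n
    have hsub : disjointed T' n ∩ S ⊆ T' n := inter_subset_left.trans (disjointed_subset T' n)
    calc ∫⁻ a in disjointed T' n ∩ S, ‖g' a‖ₑ ^ 2
        ≤ ∫⁻ a in disjointed T' n ∩ S, ENNReal.ofReal ((C * l (e n)) ^ 2) := by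
          refine setLIntegral_mono measurable_const (fun x hx => ?_)
          have := (hsub hx).2
          rw [← ofReal_norm, ← ENNReal.ofReal_pow (norm_nonneg _)]
          exact ENNReal.ofReal_le_ofReal (pow_le_pow_left₀ (norm_nonneg _) this 2)
      _ = ENNReal.ofReal (C ^ 2) * (ENNReal.ofReal ((l (e n)) ^ 2) * volume (disjointed T' n ∩ S)) := by
          rw [setLIntegral_const, mul_pow, ENNReal.ofReal_mul (by positivity), mul_assoc]
      _ ≤ _ := by
          gcongr
          exact volume_le_of_antilip (hl _) (fun x hx y hy =>
            hfT _ x (hsub hx).1 y (hsub hy).1)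
  refine (ENNReal.tsum_le_tsum hterm).trans ?_
  rw [ENNReal.tsum_mul_left]
  gcongr
  have hmi : ∀ n, MeasurableSet (f '' (disjointed T' n ∩ S)) := fun n =>
    (hDm n).image_of_continuousOn_injOn (hf.mono (inter_subset_right.trans hSA))
      (hi.mono (inter_subset_right.trans hSA))
  rw [← measure_iUnion _ hmi, ← image_iUnion]
  · exact measure_mono (image_mono (iUnion_subset (fun n => inter_subset_right)))
  · intro i j hij
    have := hDd hij
    show Disjoint (f '' _) (f '' _)
    rw [Set.disjoint_left]
    rintro _ ⟨x, hx, rfl⟩ ⟨y, hy, hxy⟩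
    have : y = x := hi (hSA hy.2) (hSA hx.2) hxy
    subst this
    exact Set.disjoint_left.1 (hDd hij) hx hy

def lebE (A : Set ℂ) (g h : ℂ → ℂ) (α β : ℂ) (ε ρ : ℝ) : Set ℂ :=
  {x | closedBall x ρ ⊆ A ∧ ∀ s, 0 < s → s ≤ ρ →
    ∫ z in closedBall x s, (‖g z - α‖ + ‖h z - β‖) ≤ ε * s ^ 2}

lemma lebE_antilip {K : ℝ} (hK0 : 0 < K) (hK : ∀ (A : Set ℂ) (u g h : ℂ → ℂ) (x y : ℂ) (r ε : ℝ),
    IsOpen A → ContinuousOn u A → HasDistribWirtingerDerivs A u g h → r = dist x y → 0 < r →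
    closedBall x (4 * r) ⊆ A → closedBall y (4 * r) ⊆ A →
    (∀ s, 0 < s → s ≤ 2 * r → ∫ z in closedBall x s, (‖g z‖ + ‖h z‖) ≤ ε * s ^ 2) →
    (∀ s, 0 < s → s ≤ 2 * r → ∫ z in closedBall y s, (‖g z‖ + ‖h z‖) ≤ ε * s ^ 2) →
    ‖u x - u y‖ ≤ K * ε * r)
    {A : Set ℂ} (hA : IsOpen A) {f g h : ℂ → ℂ} (hf : ContinuousOn f A)
    (hw : HasDistribWirtingerDerivs A f g h) {k : ℝ} {α β : ℂ}
    (hβ : ‖β‖ ≤ (1 + k) / 2 * ‖α‖) {ε ρ : ℝ} (hε : K * ε ≤ (1 - k) / 4 * ‖α‖)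
    {x y : ℂ} (hx : x ∈ lebE A g h α β ε ρ) (hy : y ∈ lebE A g h α β ε ρ)
    (hxy : 4 * dist x y ≤ ρ) :
    (1 - k) / 4 * ‖α‖ * dist x y ≤ dist (f x) (f y) := by
  rcases eq_or_ne x y with rfl | hne
  · simp
  have hr : 0 < dist x y := dist_pos.2 hne
  have hw2 := weak_sub hA hf (by fun_prop) hw (weak_linear A hA α β)
  have h1 := hK A _ _ _ x y (dist x y) ε hA (hf.sub (by fun_prop)) hw2 rfl hr
    ((closedBall_subset_closedBall hxy).trans hx.1)
    ((closedBall_subset_closedBall hxy).trans hy.1)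
    (fun s hs hs2 => hx.2 s hs (by linarith)) (fun s hs hs2 => hy.2 s hs (by linarith))
  simp only [Pi.sub_apply] at h1
  have h2 : K * ε * dist x y ≤ (1 - k) / 4 * ‖α‖ * dist x y :=
    mul_le_mul_of_nonneg_right hε hr.le
  have h3 : f x - f y = (f x - (α * x + β * conj x) - (f y - (α * y + β * conj y)))
      + (α * (x - y) + β * conj (x - y)) := by
    rw [map_sub]; ring
  have h4 : ‖α * (x - y) + β * conj (x - y)‖ ≥ ‖α‖ * dist x y - ‖β‖ * dist x y := by
    have := norm_sub_norm_le (α * (x - y)) (-(β * conj (x - y)))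
    rw [norm_neg, norm_mul, norm_mul, RCLike.norm_conj, sub_neg_eq_add] at this
    rw [dist_eq_norm]; exact this
  have h5 : ‖f x - f y‖ ≥ ‖α * (x - y) + β * conj (x - y)‖
      - ‖f x - (α * x + β * conj x) - (f y - (α * y + β * conj y))‖ := by
    have := norm_sub_norm_le (α * (x - y) + β * conj (x - y))
      (-(f x - (α * x + β * conj x) - (f y - (α * y + β * conj y))))
    rw [norm_neg, sub_neg_eq_add, add_comm (α * (x - y) + β * conj (x - y)), ← h3] at this
    exact this
  rw [dist_eq_norm (f x)]
  have h6 : ‖β‖ * dist x y ≤ (1 + k) / 2 * ‖α‖ * dist x y := mul_le_mul_of_nonneg_right hβ hr.le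
  nlinarith

lemma area_lemma (k : ℝ) (hk0 : 0 ≤ k) (hk : k < 1) : ∃ C : ℝ, 0 ≤ C ∧
    ∀ (A : Set ℂ) (f g h : ℂ → ℂ), IsOpen A → ContinuousOn f A → InjOn f A →
    HasDistribWirtingerDerivs A f g h → (∀ᵐ z ∂(volume.restrict A), ‖h z‖ ≤ k * ‖g z‖) →
    ∀ S, MeasurableSet S → S ⊆ A →
      ∫⁻ z in S, ‖g z‖ₑ ^ 2 ≤ ENNReal.ofReal C * volume (f '' S) := by
  obtain ⟨K, hK0, hK⟩ := two_point
  have hk1 : 0 < 1 - k := by linarith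
  refine ⟨(8 / (1 - k)) ^ 2, by positivity, ?_⟩
  intro A f g h hA hf hi hw hkae S hS hSA
  -- index: (α, β) index, 1/(j+1), centre
  set d : ℕ → ℂ × ℂ := TopologicalSpace.denseSeq (ℂ × ℂ) with hd
  have hdd : DenseRange d := TopologicalSpace.denseRange_denseSeq _
  set c : ℕ → ℂ := TopologicalSpace.denseSeq ℂ with hc
  have hcd : DenseRange c := TopologicalSpace.denseRange_denseSeq _
  let ι := {p : ℕ × ℕ × ℕ // (d p.1).1 ≠ 0 ∧ ‖(d p.1).2‖ ≤ (1 + k) / 2 * ‖(d p.1).1‖}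
  let l : ι → ℝ := fun p => (1 - k) / 4 * ‖(d p.1.1).1‖
  let ε : ι → ℝ := fun p => (1 - k) / 4 * ‖(d p.1.1).1‖ / K
  let ρ : ι → ℝ := fun p => 1 / ((p.1.2.1 : ℝ) + 1)
  have hρ : ∀ p, 0 < ρ p := fun p => by positivity
  let E : ι → Set ℂ := fun p => lebE A g h (d p.1.1).1 (d p.1.1).2 (ε p) (ρ p) ∩ ball (c p.1.2.2) (ρ p / 8)
  have hEA : ∀ p, E p ⊆ A := fun p x hx => hx.1.1 (mem_closedBall_self (hρ p).le)
  let T : ι → Set ℂ := fun p => closure (E p) ∩ A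
  have hl : ∀ p, 0 < l p := fun p => by
    have := norm_pos_iff.2 p.2.1
    positivity
  have hE : ∀ p, ∀ x ∈ E p, ∀ y ∈ E p, l p * dist x y ≤ dist (f x) (f y) := by
    intro p x hx y hy
    refine lebE_antilip hK0 hK hA hf hw p.2.2 (ε := ε p) (ρ := ρ p) ?_ hx.1 hy.1 ?_
    · simp only [ε]; field_simp; exact le_rfl
    · have h1 : dist x (c p.1.2.2) < ρ p / 8 := hx.2
      have h2 : dist y (c p.1.2.2) < ρ p / 8 := hy.2
      have := dist_triangle_right x y (c p.1.2.2)
      linarith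
  have hTf : ∀ p, ∀ x ∈ T p, ∀ y ∈ T p, l p * dist x y ≤ dist (f x) (f y) := by
    intro p x hx y hy
    obtain ⟨xs, hxs, hxl⟩ := mem_closure_iff_seq_limit.1 hx.1
    obtain ⟨ys, hys, hyl⟩ := mem_closure_iff_seq_limit.1 hy.1
    have fx := ((hf.continuousAt (hA.mem_nhds hx.2)).tendsto.comp hxl)
    have fy := ((hf.continuousAt (hA.mem_nhds hy.2)).tendsto.comp hyl)
    refine le_of_tendsto_of_tendsto ((hxl.dist hyl).const_mul (l p)) (fx.dist fy) ?_
    exact Filter.Eventually.of_forall (fun n => hE p _ (hxs n) _ (hys n))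
  have hae : ∀ᵐ x ∂(volume.restrict A), g x ≠ 0 → ∃ n, x ∈ T n ∧ ‖g x‖ ≤ 8 / (1 - k) * l n := by
    filter_upwards [hkae, lebesgue_points hA hw.1, lebesgue_points hA hw.2.1,
      ae_restrict_mem hA.measurableSet] with x hx1 hx2 hx3 hxA hg0
    have hg : 0 < ‖g x‖ := norm_pos_iff.2 hg0
    -- choose approximations
    set δ : ℝ := min (1/2) (min ((1 - k) / 8) ((1 - k) / (64 * K * π))) * ‖g x‖ with hδ
    have hδ0 : 0 < δ := by positivity
    obtain ⟨i, hi⟩ := hdd.exists_dist_lt (g x, h x) hδ0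
    set α := (d i).1 with hα
    set β := (d i).2 with hβ
    have hα1 : ‖g x - α‖ < δ := by
      rw [← dist_eq_norm]
      exact (le_max_left _ _).trans_lt hi
    have hβ1 : ‖h x - β‖ < δ := by
      rw [← dist_eq_norm]
      exact (le_max_right _ _).trans_lt hi
    have hδ1 : δ ≤ 1 / 2 * ‖g x‖ := mul_le_mul_of_nonneg_right (min_le_left _ _) hg.le
    have hδ2 : δ ≤ (1 - k) / 8 * ‖g x‖ := mul_le_mul_of_nonneg_right
      ((min_le_right _ _).trans (min_le_left _ _)) hg.le
    have hδ3 : δ ≤ (1 - k) / (64 * K * π) * ‖g x‖ := mul_le_mul_of_nonneg_right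
      ((min_le_right _ _).trans (min_le_right _ _)) hg.le
    have hαg : ‖g x‖ - δ ≤ ‖α‖ := by linarith [norm_sub_norm_le (g x) α]
    have hβh : ‖β‖ ≤ ‖h x‖ + δ := by
      have := norm_sub_norm_le β (h x)
      rw [norm_sub_rev] at this; linarith
    have hαpos : ‖g x‖ / 2 ≤ ‖α‖ := by linarith
    have hβα : ‖β‖ ≤ (1 + k) / 2 * ‖α‖ := by
      have : (1 + k) / 2 * (‖g x‖ - δ) ≤ (1 + k) / 2 * ‖α‖ :=
        mul_le_mul_of_nonneg_left hαg (by positivity)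
      nlinarith
    set ε0 : ℝ := (1 - k) / 4 * ‖α‖ / K with hε0
    have hε0' : (1 - k) / 8 * ‖g x‖ / K ≤ ε0 := by
      rw [hε0]; gcongr ?_ / _; nlinarith
    have hpos : 0 < (1 - k) / 8 * ‖g x‖ / K := by positivity
    have hαpos' : 0 < ‖α‖ := by linarith
    have hε0pos : 0 < ε0 := by positivity
    obtain ⟨ρ1, hρ1, hs1, hi1, hb1⟩ := hx2 (ε0 / 4) (by positivity)
    obtain ⟨ρ2, hρ2, hs2, hi2, hb2⟩ := hx3 (ε0 / 4) (by positivity)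
    obtain ⟨j, hj⟩ := exists_nat_one_div_lt (lt_min hρ1 hρ2)
    have hj1 : 1 / ((j:ℝ) + 1) ≤ ρ1 := hj.le.trans (min_le_left _ _)
    have hj2 : 1 / ((j:ℝ) + 1) ≤ ρ2 := hj.le.trans (min_le_right _ _)
    have hj0 : (0:ℝ) < 1 / ((j:ℝ) + 1) := by positivity
    obtain ⟨m, hm⟩ := hcd.exists_dist_lt x (show (0:ℝ) < 1 / ((j:ℝ) + 1) / 8 by positivity)
    let n : ι := ⟨(i, j, m), by
      refine ⟨?_, hβα⟩
      exact norm_pos_iff.1 hαpos'⟩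
    refine ⟨n, ⟨subset_closure ⟨⟨?_, ?_⟩, hm⟩, hxA⟩, ?_⟩
    · exact (closedBall_subset_closedBall hj1).trans hs1
    · intro s hs hsj
      have hsj' : s ≤ 1 / ((j:ℝ) + 1) := hsj
      have I1 : IntegrableOn g (closedBall x s) :=
        hi1.mono_set (closedBall_subset_closedBall (hsj'.trans hj1))
      have I2 : IntegrableOn h (closedBall x s) :=
        hi2.mono_set (closedBall_subset_closedBall (hsj'.trans hj2))
      have ic : ∀ a : ℂ, IntegrableOn (fun _ => a) (closedBall x s) := fun a =>
        integrableOn_const (by simp [Complex.volume_closedBall, ENNReal.mul_eq_top])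
      have gen : ∀ (q : ℂ → ℂ) (b : ℂ), IntegrableOn q (closedBall x s) → ‖q x - b‖ < δ →
          ∫ z in closedBall x s, ‖q z - q x‖ ≤ ε0 / 4 * s ^ 2 →
          ∫ z in closedBall x s, ‖q z - b‖ ≤ ε0 / 2 * s ^ 2 := by
        intro q b hq hb hqi
        have a1 : IntegrableOn (fun z => ‖q z - q x‖) (closedBall x s) := (hq.sub (ic (q x))).norm
        have a2 : IntegrableOn (fun z => ‖q x - b‖) (closedBall x s) := (ic (q x - b)).norm
        calc ∫ z in closedBall x s, ‖q z - b‖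
            ≤ ∫ z in closedBall x s, (‖q z - q x‖ + ‖q x - b‖) := by
              refine integral_mono (hq.sub (ic b)).norm (a1.add a2) (fun z => ?_)
              exact norm_sub_le_norm_sub_add_norm_sub _ _ _
          _ = (∫ z in closedBall x s, ‖q z - q x‖) + π * s ^ 2 * ‖q x - b‖ := by
              rw [integral_add a1 a2, setIntegral_const, real_volume_closedBall x hs.le, smul_eq_mul]
          _ ≤ ε0 / 4 * s ^ 2 + π * s ^ 2 * δ := by gcongr
          _ ≤ ε0 / 4 * s ^ 2 + ε0 / 4 * s ^ 2 := by
              have : π * δ ≤ ε0 / 4 := by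
                calc π * δ ≤ π * ((1 - k) / (64 * K * π) * ‖g x‖) := by gcongr
                  _ = (1 - k) / 8 * ‖g x‖ / K / 8 := by field_simp; ring
                  _ ≤ ε0 / 4 := by linarith
              nlinarith [sq_nonneg s]
          _ = _ := by ring
      have G := gen g α I1 hα1 (hb1 s hs (hsj'.trans hj1))
      have H := gen h β I2 hβ1 (hb2 s hs (hsj'.trans hj2))
      have a1 : IntegrableOn (fun z => ‖g z - α‖) (closedBall x s) := (I1.sub (ic α)).norm
      have a2 : IntegrableOn (fun z => ‖h z - β‖) (closedBall x s) := (I2.sub (ic β)).norm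
      show ∫ z in closedBall x s, (‖g z - α‖ + ‖h z - β‖) ≤ ε0 * s ^ 2
      rw [integral_add a1 a2]
      linarith
    · show ‖g x‖ ≤ 8 / (1 - k) * ((1 - k) / 4 * ‖α‖)
      have : 8 / (1 - k) * ((1 - k) / 4 * ‖α‖) = 2 * ‖α‖ := by field_simp; ring
      rw [this]; linarith
  exact area_abstract hf hi hw.1.aestronglyMeasurable T
    (fun n => isClosed_closure.measurableSet.inter hA.measurableSet)
    l hl hTf hae hS hSA

lemma realLin_eq (L : ℂ →L[ℝ] ℂ) (v : ℂ) :
    L v = (L 1 - I * L I) / 2 * v + (L 1 + I * L I) / 2 * conj v := by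
  have h1 : L v = v.re * L 1 + v.im * L I := by
    conv_lhs => rw [← Complex.re_add_im v]
    rw [map_add, mul_comm (v.im : ℂ) I]
    have e1 : (v.re : ℂ) = (v.re : ℝ) • (1:ℂ) := by simp
    have e2 : I * (v.im : ℂ) = (v.im : ℝ) • I := by simp [mul_comm]
    rw [e1, e2, map_smul, map_smul]
    simp
  have h2 : conj v = v.re - v.im * I := by
    apply Complex.ext <;> simp
  have h3 : v = v.re + v.im * I := (Complex.re_add_im v).symm
  rw [h1, h2]
  conv_rhs => rw [h3]
  simp only [Complex.add_re, Complex.add_im, Complex.ofReal_re, Complex.ofReal_im, Complex.mul_re,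
    Complex.mul_im, Complex.I_re, Complex.I_im]
  ring_nf
  simp only [Complex.I_sq]
  ring

lemma det_mul_real (w : ℂ) :
    ((ContinuousLinearMap.toSpanSingleton ℂ w).restrictScalars ℝ).det = ‖w‖ ^ 2 := by
  rw [← Complex.normSq_eq_norm_sq, ← Algebra.norm_complex_apply]
  rw [Algebra.norm_apply, ContinuousLinearMap.det]
  congr 1
  ext
  simp [mul_comm]

lemma holo_inverse {B : Set ℂ} (hB : IsOpen B) {Ψ dΨ : ℂ → ℂ}
    (hΨ : ∀ z ∈ B, HasDerivAt Ψ (dΨ z) z) (hne : ∀ z ∈ B, dΨ z ≠ 0) (hinj : InjOn Ψ B) :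
    IsOpen (Ψ '' B) ∧ ∀ z ∈ B,
      HasDerivAt (Function.invFunOn Ψ B) (dΨ z)⁻¹ (Ψ z) := by
  have hstrict : ∀ z ∈ B, HasStrictDerivAt Ψ (dΨ z) z := by
    intro z hz
    have hd : DifferentiableOn ℂ Ψ B := fun w hw => (hΨ w hw).differentiableAt.differentiableWithinAt
    have : AnalyticAt ℂ Ψ z := hd.analyticAt (hB.mem_nhds hz)
    have h2 := this.hasStrictDerivAt
    rwa [(hΨ z hz).deriv] at h2
  have hmap : ∀ z ∈ B, Filter.map Ψ (𝓝 z) = 𝓝 (Ψ z) := fun z hz =>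
    (hstrict z hz).map_nhds_eq (hne z hz)
  have hop : ∀ V, IsOpen V → V ⊆ B → IsOpen (Ψ '' V) := by
    intro V hV hVB
    rw [isOpen_iff_mem_nhds]
    rintro _ ⟨z, hz, rfl⟩
    rw [← hmap z (hVB hz)]
    exact Filter.image_mem_map (hV.mem_nhds hz)
  have hO := hop B hB le_rfl
  refine ⟨hO, fun z hz => ?_⟩
  have hl := hinj.leftInvOn_invFunOn
  have hcont : ContinuousAt (Function.invFunOn Ψ B) (Ψ z) := by
    rw [ContinuousAt, hl hz]
    intro V hV
    obtain ⟨W, hWV, hW, hzW⟩ := _root_.mem_nhds_iff.1 (Filter.inter_mem hV (hB.mem_nhds hz))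
    have h1 : Ψ '' W ∈ 𝓝 (Ψ z) := (hop W hW (hWV.trans inter_subset_right)).mem_nhds ⟨z, hzW, rfl⟩
    refine Filter.mem_map.2 (Filter.mem_of_superset h1 ?_)
    rintro _ ⟨w, hw, rfl⟩
    show Function.invFunOn Ψ B (Ψ w) ∈ V
    rw [hl (hWV hw).2]
    exact (hWV hw).1
  have hd := hΨ z hz
  rw [← hl hz] at hd
  have := HasDerivAt.of_local_left_inverse (f' := dΨ z) hcont
    (by rw [hl hz]; exact hΨ z hz) (hne z hz) (by
      filter_upwards [hO.mem_nhds ⟨z, hz, rfl⟩]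
      rintro _ ⟨w, hw, rfl⟩
      rw [hl hw])
  exact this

lemma wirtinger_comp_conj {Φ Θ : ℂ → ℂ} {z t t2 : ℂ} {dΘ : ℂ → ℂ}
    (hΦ : DifferentiableAt ℝ Φ (Θ z)) (hΘ : HasDerivAt Θ t z) (hdΘ : HasDerivAt dΘ t2 z)
    (ht : dΘ z = t) :
    wirtingerZ (fun z => Φ (Θ z) * conj (dΘ z)) z = wirtingerZ Φ (Θ z) * (t * conj t) ∧
    wirtingerZBar (fun z => Φ (Θ z) * dΘ z) z = wirtingerZBar Φ (Θ z) * (t * conj t) := by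
  have hT := hΘ.hasFDerivAt.restrictScalars ℝ
  have hT2 := hdΘ.hasFDerivAt.restrictScalars ℝ
  have h1 := hΦ.hasFDerivAt.comp z hT
  have hI : conj I = -I := Complex.conj_I
  have hII := Complex.I_mul_I
  constructor
  · have h2 := h1.mul (((Complex.conjCLE.hasFDerivAt (x := dΘ z))).comp z hT2)
    refine (wirtingerZ_of_hasFDerivAt h2).trans ?_
    rw [wirtingerZ]
    set D := fderiv ℝ Φ (Θ z) with hD
    have e1 := realLin_eq D t
    have e2 := realLin_eq D (I * t)
    rw [map_mul conj, hI] at e2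
    simp [ht]
    rw [e1, e2]
    simp
    linear_combination ((Φ (Θ z) * conj t2) / 2 - (D 1 - I * D I)/4 * t * conj t
      + (D 1 + I * D I)/4 * conj t * conj t) * hII
  · have h2 := h1.mul hT2
    refine (wirtingerZBar_of_hasFDerivAt h2).trans ?_
    rw [wirtingerZBar]
    set D := fderiv ℝ Φ (Θ z) with hD
    have e1 := realLin_eq D t
    have e2 := realLin_eq D (I * t)
    rw [map_mul conj, hI] at e2
    simp [ht]
    rw [e1, e2]
    linear_combination ((Φ (Θ z) * t2) / 2 + (D 1 - I * D I)/4 * t * t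
      - (D 1 + I * D I)/4 * conj t * t) * hII

lemma transfer_test {A' K : Set ℂ} (hA' : IsOpen A') {Φ Θ q : ℂ → ℂ}
    (hΦ : ContDiff ℝ (⊤ : ℕ∞) Φ) (hK : IsCompact K) (hKA : K ⊆ A')
    (hKs : ∀ z ∈ A', Θ z ∈ tsupport Φ → z ∈ K)
    (hΘ : DifferentiableOn ℂ Θ A') (hq : ∀ z ∈ A', ContDiffAt ℝ (⊤ : ℕ∞) q z) :
    ContDiff ℝ (⊤ : ℕ∞) (A'.indicator (fun z => Φ (Θ z) * q z)) ∧
    HasCompactSupport (A'.indicator (fun z => Φ (Θ z) * q z)) ∧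
    tsupport (A'.indicator (fun z => Φ (Θ z) * q z)) ⊆ A' := by
  have hz : ∀ z ∉ K, A'.indicator (fun z => Φ (Θ z) * q z) z = 0 := by
    intro z hz
    by_cases hzA : z ∈ A'
    · rw [indicator_of_mem hzA]
      have : Θ z ∉ tsupport Φ := fun h => hz (hKs z hzA h)
      simp only [image_eq_zero_of_notMem_tsupport this, zero_mul]
    · exact indicator_of_notMem hzA _
  have hts : tsupport (A'.indicator (fun z => Φ (Θ z) * q z)) ⊆ K := by
    apply closure_minimal _ hK.isClosed
    intro z hzs
    by_contra hn
    exact hzs (hz z hn)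
  refine ⟨?_, hK.of_isClosed_subset (isClosed_tsupport _) hts, hts.trans hKA⟩
  rw [contDiff_iff_contDiffAt]
  intro z
  by_cases hzA : z ∈ A'
  · have h1 : ContDiffAt ℝ (⊤ : ℕ∞) (fun z => Φ (Θ z) * q z) z := by
      have ha : ContDiffAt ℂ (⊤ : ℕ∞) Θ z := (hΘ.analyticAt (hA'.mem_nhds hzA)).contDiffAt
      exact (hΦ.contDiffAt.comp z (ha.restrict_scalars ℝ)).mul (hq z hzA)
    refine h1.congr_of_eventuallyEq ?_
    filter_upwards [hA'.mem_nhds hzA] with w hw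
    exact indicator_of_mem hw _
  · have hzK : z ∉ K := fun h => hzA (hKA h)
    refine (contDiffAt_const (c := (0:ℂ))).congr_of_eventuallyEq ?_
    filter_upwards [hK.isClosed.isOpen_compl.mem_nhds hzK] with w hw
    exact hz w hw

lemma conformal_transfer {A B : Set ℂ} (hA : IsOpen A) (hB : IsOpen B) {Ψ dΨ : ℂ → ℂ}
    (hΨ : ∀ z ∈ B, HasDerivAt Ψ (dΨ z) z) (hne : ∀ z ∈ B, dΨ z ≠ 0) (hinj : InjOn Ψ B)
    (hcd : ContinuousOn dΨ B) (hmap : MapsTo Ψ B A) {f g h : ℂ → ℂ}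
    (hw : HasDistribWirtingerDerivs A f g h) :
    HasDistribWirtingerDerivs B (fun z => f (Ψ z)) (fun z => g (Ψ z) * dΨ z)
      (fun z => h (Ψ z) * conj (dΨ z)) := by
  obtain ⟨hO, hinv⟩ := holo_inverse hB hΨ hne hinj
  set A' := Ψ '' B with hA'
  set Θ := Function.invFunOn Ψ B with hΘ
  have hl : ∀ z ∈ B, Θ (Ψ z) = z := fun z hz => hinj.leftInvOn_invFunOn hz
  have hw' : HasDistribWirtingerDerivs A' f g h := weak_mono hA (hmap.image_subset) hw
  have hΘd : DifferentiableOn ℂ Θ A' := by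
    rintro _ ⟨z, hz, rfl⟩
    exact (hinv z hz).differentiableAt.differentiableWithinAt
  have hΨc : ContinuousOn Ψ B := fun z hz => (hΨ z hz).continuousAt.continuousWithinAt
  have hfd : ∀ s ⊆ B, ∀ z ∈ s, HasFDerivWithinAt Ψ
      ((ContinuousLinearMap.toSpanSingleton ℂ (dΨ z)).restrictScalars ℝ) s z := fun s hs z hz =>
    ((hΨ z (hs hz)).hasFDerivAt.restrictScalars ℝ).hasFDerivWithinAt
  have hconj : ∀ z, conj (dΨ z) * dΨ z = ((‖dΨ z‖ ^ 2 : ℝ) : ℂ) := by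
    intro z; rw [mul_comm, Complex.mul_conj, Complex.normSq_eq_norm_sq]
  have loc : ∀ q : ℂ → ℂ, LocallyIntegrableOn q A' → ∀ e : ℂ → ℂ, ContinuousOn e B →
      LocallyIntegrableOn (fun z => q (Ψ z) * (‖dΨ z‖ ^ 2 : ℝ) * e z) B := by
    intro q hq e he
    rw [locallyIntegrableOn_iff hB.isLocallyClosed]
    intro K hKB hK
    have h1 : IntegrableOn q (Ψ '' K) :=
      hq.integrableOn_compact_subset (image_mono hKB) (hK.image_of_continuousOn (hΨc.mono hKB))
    rw [integrableOn_image_iff_integrableOn_abs_det_fderiv_smul volume hK.measurableSet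
      (hfd K hKB) (hinj.mono hKB)] at h1
    have h2 := h1.mul_continuousOn (he.mono hKB) hK
    refine h2.congr_fun (fun z hz => ?_) hK.measurableSet
    simp only [det_mul_real, abs_of_nonneg (sq_nonneg ‖dΨ z‖), Complex.real_smul]
    ring
  have cconj : ContinuousOn (fun z => conj (dΨ z)) B := Complex.continuous_conj.comp_continuousOn hcd
  have hne' : ∀ z ∈ B, conj (dΨ z) ≠ 0 := fun z hz => by
    simpa using hne z hz
  refine ⟨?_, ?_, ?_⟩
  · have := loc g hw'.1 (fun z => (conj (dΨ z))⁻¹) (cconj.inv₀ hne')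
    rw [locallyIntegrableOn_iff hB.isLocallyClosed] at this ⊢
    intro K hKB hK
    refine (this K hKB hK).congr_fun (fun z hz => ?_) hK.measurableSet
    have := hne' z (hKB hz)
    simp only [← hconj]
    field_simp
  · have := loc h hw'.2.1 (fun z => (dΨ z)⁻¹) (hcd.inv₀ hne)
    rw [locallyIntegrableOn_iff hB.isLocallyClosed] at this ⊢
    intro K hKB hK
    refine (this K hKB hK).congr_fun (fun z hz => ?_) hK.measurableSet
    have := hne z (hKB hz)
    simp only [← hconj]
    field_simp
  intro Φ hΦ hc hs
  have hKc : IsCompact (Ψ '' tsupport Φ) := hc.image_of_continuousOn (hΨc.mono hs)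
  have hKA : Ψ '' tsupport Φ ⊆ A' := image_mono hs
  have hKs : ∀ z ∈ A', Θ z ∈ tsupport Φ → z ∈ Ψ '' tsupport Φ := by
    rintro _ ⟨z, hz, rfl⟩ h1
    rw [hl z hz] at h1
    exact ⟨z, h1, rfl⟩
  have han : ∀ z ∈ A', AnalyticAt ℂ (deriv Θ) z := fun z hz =>
    (hΘd.analyticAt (hO.mem_nhds hz)).deriv
  have hq1 : ∀ z ∈ A', ContDiffAt ℝ (⊤ : ℕ∞) (deriv Θ) z := fun z hz =>
    ((han z hz).contDiffAt (n := (⊤ : ℕ∞))).restrict_scalars ℝ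
  have hq2 : ∀ z ∈ A', ContDiffAt ℝ (⊤ : ℕ∞) (fun z => conj (deriv Θ z)) z := fun z hz =>
    (Complex.conjCLE.contDiff.contDiffAt).comp z (hq1 z hz)
  have hdT : ∀ z ∈ B, deriv Θ (Ψ z) = (dΨ z)⁻¹ := fun z hz => (hinv z hz).deriv
  have cov : ∀ q : ℂ → ℂ, ∫ z in A', q z = ∫ z in B, (‖dΨ z‖ ^ 2 : ℝ) • q (Ψ z) := by
    intro q
    rw [hA', integral_image_eq_integral_abs_det_fderiv_smul volume hB.measurableSet
      (hfd B le_rfl) hinj]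
    refine setIntegral_congr_fun hB.measurableSet (fun z hz => ?_)
    simp only [det_mul_real, abs_of_nonneg (sq_nonneg ‖dΨ z‖)]
  have nz : ∀ z ∈ B, (dΨ z) * (dΨ z)⁻¹ = 1 := fun z hz => mul_inv_cancel₀ (hne z hz)
  have nz' : ∀ z ∈ B, conj (dΨ z) * (conj (dΨ z))⁻¹ = 1 := fun z hz => mul_inv_cancel₀ (hne' z hz)
  constructor
  · obtain ⟨c1, c2, c3⟩ := transfer_test hO hΦ hKc hKA hKs hΘd hq2
    have key := (hw'.2.2 _ c1 c2 c3).1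
    rw [cov, cov] at key
    calc ∫ z in B, f (Ψ z) * wirtingerZ Φ z = _ := ?_
      _ = _ := key
      _ = _ := ?_
    · refine setIntegral_congr_fun hB.measurableSet (fun z hz => ?_)
      have hzA : Ψ z ∈ A' := ⟨z, hz, rfl⟩
      have e1 : wirtingerZ (A'.indicator (fun z => Φ (Θ z) * conj (deriv Θ z))) (Ψ z)
          = wirtingerZ (fun z => Φ (Θ z) * conj (deriv Θ z)) (Ψ z) := by
        have : A'.indicator (fun z => Φ (Θ z) * conj (deriv Θ z)) =ᶠ[𝓝 (Ψ z)]
            (fun z => Φ (Θ z) * conj (deriv Θ z)) := by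
          filter_upwards [hO.mem_nhds hzA] with w hw
          exact indicator_of_mem hw _
        simp only [wirtingerZ, this.fderiv_eq]
      have e2 := (wirtinger_comp_conj (Φ := Φ) (Θ := Θ) (z := Ψ z) (dΘ := deriv Θ)
        (hΦ.differentiable (by simp)).differentiableAt (hinv z hz)
        (han _ hzA).differentiableAt.hasDerivAt (hdT z hz)).1
      simp only [e1, e2, hl z hz, Complex.real_smul, ← hconj, map_inv₀]
      have n1 := nz z hz
      have n2 := nz' z hz
      linear_combination (-(f (Ψ z) * wirtingerZ Φ z * (conj (dΨ z) * (conj (dΨ z))⁻¹))) * n1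
        - (f (Ψ z) * wirtingerZ Φ z) * n2
    · congr 1
      refine setIntegral_congr_fun hB.measurableSet (fun z hz => ?_)
      have hzA : Ψ z ∈ A' := ⟨z, hz, rfl⟩
      simp only [indicator_of_mem hzA, hl z hz, hdT z hz, Complex.real_smul, ← hconj, map_inv₀]
      have n2 := nz' z hz
      linear_combination (g (Ψ z) * dΨ z * Φ z) * n2
  · obtain ⟨c1, c2, c3⟩ := transfer_test hO hΦ hKc hKA hKs hΘd hq1
    have key := (hw'.2.2 _ c1 c2 c3).2
    rw [cov, cov] at key
    calc ∫ z in B, f (Ψ z) * wirtingerZBar Φ z = _ := ?_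
      _ = _ := key
      _ = _ := ?_
    · refine setIntegral_congr_fun hB.measurableSet (fun z hz => ?_)
      have hzA : Ψ z ∈ A' := ⟨z, hz, rfl⟩
      have e1 : wirtingerZBar (A'.indicator (fun z => Φ (Θ z) * (deriv Θ z))) (Ψ z)
          = wirtingerZBar (fun z => Φ (Θ z) * (deriv Θ z)) (Ψ z) := by
        have : A'.indicator (fun z => Φ (Θ z) * (deriv Θ z)) =ᶠ[𝓝 (Ψ z)]
            (fun z => Φ (Θ z) * (deriv Θ z)) := by
          filter_upwards [hO.mem_nhds hzA] with w hw
          exact indicator_of_mem hw _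
        simp only [wirtingerZBar, this.fderiv_eq]
      have e2 := (wirtinger_comp_conj (Φ := Φ) (Θ := Θ) (z := Ψ z) (dΘ := deriv Θ)
        (hΦ.differentiable (by simp)).differentiableAt (hinv z hz)
        (han _ hzA).differentiableAt.hasDerivAt (hdT z hz)).2
      simp only [e1, e2, hl z hz, Complex.real_smul, ← hconj, map_inv₀]
      have n1 := nz z hz
      have n2 := nz' z hz
      linear_combination (-(f (Ψ z) * wirtingerZBar Φ z * (conj (dΨ z) * (conj (dΨ z))⁻¹))) * n1
        - (f (Ψ z) * wirtingerZBar Φ z) * n2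
    · congr 1
      refine setIntegral_congr_fun hB.measurableSet (fun z hz => ?_)
      have hzA : Ψ z ∈ A' := ⟨z, hz, rfl⟩
      simp only [indicator_of_mem hzA, hl z hz, hdT z hz, Complex.real_smul, ← hconj]
      have n2 := nz z hz
      linear_combination (h (Ψ z) * conj (dΨ z) * Φ z) * n2

lemma dST_zero {u : ℝ} (hu : u ∉ Icc (0:ℝ) 1) : deriv Real.smoothTransition u = 0 := by
  rw [mem_Icc, not_and_or, not_le, not_le] at hu
  rcases hu with h | h
  · have : Real.smoothTransition =ᶠ[𝓝 u] fun _ => 0 := by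
      filter_upwards [Iio_mem_nhds h] with v hv
      exact Real.smoothTransition.zero_of_nonpos (le_of_lt hv)
    rw [this.deriv_eq]; simp
  · have : Real.smoothTransition =ᶠ[𝓝 u] fun _ => 1 := by
      filter_upwards [Ioi_mem_nhds h] with v hv
      exact Real.smoothTransition.one_of_one_le (le_of_lt hv)
    rw [this.deriv_eq]; simp

lemma dST_cont : Continuous (deriv Real.smoothTransition) :=
  (Real.smoothTransition.contDiff (n := 1)).continuous_deriv le_rfl

lemma dST_integrable : Integrable (deriv Real.smoothTransition) :=
  dST_cont.integrable_of_hasCompactSupport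
    (HasCompactSupport.intro isCompact_Icc (fun _ h => dST_zero h))

lemma dST_integral : ∫ u, deriv Real.smoothTransition u = 1 := by
  have h1 : ∫ u, deriv Real.smoothTransition u = ∫ u in (0:ℝ)..1, deriv Real.smoothTransition u := by
    rw [intervalIntegral.integral_of_le zero_le_one, ← integral_Icc_eq_integral_Ioc]
    exact (setIntegral_eq_integral_of_forall_compl_eq_zero (fun x hx => dST_zero hx)).symm
  rw [h1, intervalIntegral.integral_deriv_eq_sub]
  · rw [Real.smoothTransition.one, Real.smoothTransition.zero]; norm_num
  · intro x _
    exact (Real.smoothTransition.contDiff (n := 1)).differentiable one_ne_zero x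
  · exact dST_cont.intervalIntegrable _ _

lemma ST_approx {U : ℝ → ℂ} (hU : Continuous U) {K : ℝ} (hK : ∀ θ, ‖U θ‖ ≤ K) (c : ℝ) :
    Filter.Tendsto (fun n : ℕ => ∫ θ, (((n + 1 : ℝ) * deriv Real.smoothTransition ((n + 1 : ℝ) * (θ - c)) : ℝ) : ℂ) * U θ)
      Filter.atTop (𝓝 (U c)) := by
  have key : ∀ n : ℕ, (∫ θ, (((n + 1 : ℝ) * deriv Real.smoothTransition ((n + 1 : ℝ) * (θ - c)) : ℝ) : ℂ) * U θ)
      = ∫ u, ((deriv Real.smoothTransition u : ℝ) : ℂ) * U (c + u / (n + 1)) := by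
    intro n
    have hn : (0:ℝ) < n + 1 := by positivity
    set G : ℝ → ℂ := fun u => ((deriv Real.smoothTransition u : ℝ) : ℂ) * U (c + u / (n + 1)) with hG
    have h1 : ∀ θ : ℝ, (((n + 1 : ℝ) * deriv Real.smoothTransition ((n + 1 : ℝ) * (θ - c)) : ℝ) : ℂ) * U θ
        = ((n + 1 : ℝ) : ℂ) * G ((n + 1 : ℝ) * (θ - c)) := by
      intro θ
      simp only [hG]
      have : c + (n + 1 : ℝ) * (θ - c) / (n + 1) = θ := by field_simp; ring
      rw [this, Complex.ofReal_mul, mul_assoc]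
    simp_rw [h1]
    rw [integral_const_mul, integral_sub_right_eq_self (fun θ => G ((n + 1 : ℝ) * θ)) c,
      Measure.integral_comp_mul_left, abs_of_pos (inv_pos.mpr hn), Complex.real_smul, ← mul_assoc,
      ← Complex.ofReal_mul, mul_inv_cancel₀ hn.ne']
    simp
  simp_rw [key]
  have h0 : U c = ∫ u, ((deriv Real.smoothTransition u : ℝ) : ℂ) * U c := by
    rw [integral_mul_const, integral_complex_ofReal, dST_integral]; simp
  rw [h0]
  refine tendsto_integral_of_dominated_convergence (fun u => ‖deriv Real.smoothTransition u‖ * K) ?_ ?_ ?_ ?_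
  · intro n
    have : Continuous fun u : ℝ => ((deriv Real.smoothTransition u : ℝ) : ℂ) * U (c + u / (n + 1)) :=
      (Complex.continuous_ofReal.comp dST_cont).mul (hU.comp (by fun_prop))
    exact this.aestronglyMeasurable
  · exact dST_integrable.norm.mul_const K
  · intro n
    filter_upwards with u
    rw [norm_mul, Complex.norm_real]
    exact mul_le_mul_of_nonneg_left (hK _) (norm_nonneg _)
  · filter_upwards with u
    refine Filter.Tendsto.const_mul _ ((hU.tendsto c).comp ?_)
    have : Filter.Tendsto (fun n : ℕ => c + u * (1 / ((n:ℝ) + 1))) Filter.atTop (𝓝 (c + u * 0)) :=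
      (tendsto_one_div_add_atTop_nhds_zero_nat.const_mul u).const_add c
    simp only [mul_zero, add_zero] at this
    refine this.congr (fun n => ?_)
    ring

lemma weak1D {a b : ℝ} {U W : ℝ → ℂ} (hU : ContinuousOn U (Ioo a b))
    (hW : LocallyIntegrableOn W (Ioo a b))
    (h : ∀ χ : ℝ → ℝ, ContDiff ℝ (⊤ : ℕ∞) χ → HasCompactSupport χ → tsupport χ ⊆ Ioo a b →
      ∫ θ, ((deriv χ θ : ℝ) : ℂ) * U θ = - ∫ θ, ((χ θ : ℝ) : ℂ) * W θ)
    {c d : ℝ} (hac : a < c) (hcd : c < d) (hdb : d < b) :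
    U d - U c = ∫ θ in c..d, W θ := by
  set d' := (d + b) / 2 with hd'
  have hdd' : d < d' := by rw [hd']; linarith
  have hd'b : d' < b := by rw [hd']; linarith
  have hsub : Icc c d' ⊆ Ioo a b := fun x hx => ⟨by linarith [hx.1], by linarith [hx.2]⟩
  set U' : ℝ → ℂ := fun θ => U (max c (min θ d')) with hU'
  have hproj : ∀ θ, max c (min θ d') ∈ Icc c d' := fun θ =>
    ⟨le_max_left _ _, max_le (by linarith) (min_le_right _ _)⟩
  have hU'c : Continuous U' :=
    (hU.mono hsub).comp_continuous (by fun_prop) hproj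
  obtain ⟨K, hK⟩ := (isCompact_Icc (a := c) (b := d')).exists_bound_of_continuousOn (hU.mono hsub)
  have hU'K : ∀ θ, ‖U' θ‖ ≤ K := fun θ => hK _ (hproj θ)
  have hU'eq : ∀ θ ∈ Icc c d', U' θ = U θ := by
    intro θ hθ
    simp only [hU', min_eq_left hθ.2, max_eq_right hθ.1]
  have hWi : IntegrableOn W (Icc c d') := hW.integrableOn_compact_subset hsub isCompact_Icc
  set W' : ℝ → ℂ := (Icc c d').indicator W with hW'
  have hW'i : Integrable W' := hWi.integrable_indicator measurableSet_Icc
  set σ := Real.smoothTransition with hσ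
  set χ : ℕ → ℝ → ℝ := fun n θ => σ ((n + 1 : ℝ) * (θ - c)) - σ ((n + 1 : ℝ) * (θ - d)) with hχ
  have hderiv : ∀ n θ, deriv (χ n) θ = (n + 1 : ℝ) * deriv σ ((n + 1 : ℝ) * (θ - c))
      - (n + 1 : ℝ) * deriv σ ((n + 1 : ℝ) * (θ - d)) := by
    intro n θ
    have hone : ∀ e : ℝ, HasDerivAt (fun θ => σ ((n + 1 : ℝ) * (θ - e)))
        ((n + 1 : ℝ) * deriv σ ((n + 1 : ℝ) * (θ - e))) θ := by
      intro e
      have h1 : HasDerivAt σ (deriv σ ((n + 1 : ℝ) * (θ - e))) ((n + 1 : ℝ) * (θ - e)) :=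
        ((Real.smoothTransition.contDiff (n := 1)).differentiable one_ne_zero _).hasDerivAt
      have h2 : HasDerivAt (fun θ : ℝ => (n + 1 : ℝ) * (θ - e)) ((n + 1 : ℝ) * 1) θ :=
        ((hasDerivAt_id θ).sub_const e).const_mul _
      have := h1.comp θ h2
      rw [mul_one, mul_comm] at this
      exact this
    exact ((hone c).sub (hone d)).deriv
  have hIntg : ∀ n : ℕ, ∀ e : ℝ, Integrable fun θ => (((n + 1 : ℝ) * deriv σ ((n + 1 : ℝ) * (θ - e)) : ℝ) : ℂ) * U' θ := by
    intro n e
    have hn : (0:ℝ) < n + 1 := by positivity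
    refine Continuous.integrable_of_hasCompactSupport ?_ (HasCompactSupport.intro (isCompact_Icc (a := e) (b := e + 1 / (n + 1))) ?_)
    · have := dST_cont
      fun_prop
    · intro x hx
      rw [dST_zero]; · simp
      intro hh
      apply hx
      constructor
      · have := (mul_nonneg_iff_of_pos_left hn).mp hh.1; linarith
      · have := hh.2; rw [← le_div_iff₀' hn] at this; linarith
  have hL : Filter.Tendsto (fun n : ℕ => ∫ θ, ((deriv (χ n) θ : ℝ) : ℂ) * U' θ) Filter.atTop (𝓝 (U' c - U' d)) := by
    refine ((ST_approx hU'c hU'K c).sub (ST_approx hU'c hU'K d)).congr (fun n => ?_)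
    rw [← integral_sub (hIntg n c) (hIntg n d)]
    congr 1; ext θ
    rw [hderiv]; push_cast; ring
  have hR : Filter.Tendsto (fun n : ℕ => ∫ θ, ((χ n θ : ℝ) : ℂ) * W' θ) Filter.atTop
      (𝓝 (∫ θ, (Ioc c d).indicator W θ)) := by
    refine tendsto_integral_of_dominated_convergence (fun θ => 1 * ‖W' θ‖) ?_ (hW'i.norm.const_mul 1) ?_ ?_
    · intro n
      refine AEStronglyMeasurable.mul ?_ hW'i.1
      have := Real.smoothTransition.continuous
      refine Continuous.aestronglyMeasurable ?_
      simp only [hχ]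
      fun_prop
    · intro n
      filter_upwards with θ
      rw [norm_mul, Complex.norm_real]
      refine mul_le_mul_of_nonneg_right ?_ (norm_nonneg _)
      rw [Real.norm_eq_abs, abs_le]
      have := Real.smoothTransition.le_one ((n + 1 : ℝ) * (θ - c))
      have := Real.smoothTransition.le_one ((n + 1 : ℝ) * (θ - d))
      have := Real.smoothTransition.nonneg ((n + 1 : ℝ) * (θ - c))
      have := Real.smoothTransition.nonneg ((n + 1 : ℝ) * (θ - d))
      constructor <;> simp only [hχ, hσ] <;> linarith
    · filter_upwards with θ
      by_cases h1 : θ ≤ c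
      · have h2 : θ ∉ Ioc c d := fun hh => absurd hh.1 (not_lt.mpr h1)
        rw [indicator_of_notMem h2]
        refine tendsto_const_nhds.congr (fun n => ?_)
        have hn : (0:ℝ) < n + 1 := by positivity
        simp only [hχ, hσ]
        rw [Real.smoothTransition.zero_of_nonpos, Real.smoothTransition.zero_of_nonpos]
        · simp
        · exact mul_nonpos_of_nonneg_of_nonpos hn.le (by linarith)
        · exact mul_nonpos_of_nonneg_of_nonpos hn.le (by linarith)
      push Not at h1
      have hbig : ∀ e, e < θ → ∀ᶠ n : ℕ in Filter.atTop, σ ((n + 1 : ℝ) * (θ - e)) = 1 := by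
        intro e he
        have h3 : 0 < θ - e := by linarith
        obtain ⟨N, hN⟩ := exists_nat_gt (1 / (θ - e))
        filter_upwards [Filter.eventually_ge_atTop N] with n hn
        apply Real.smoothTransition.one_of_one_le
        have : (N:ℝ) ≤ n := by exact_mod_cast hn
        rw [← div_le_iff₀ h3]; linarith
      by_cases h2 : θ ≤ d
      · have h3 : θ ∈ Ioc c d := ⟨h1, h2⟩
        rw [indicator_of_mem h3]
        refine tendsto_const_nhds.congr' ?_
        filter_upwards [hbig c h1] with n hn
        have hn' : (0:ℝ) < n + 1 := by positivity
        have h4 : σ ((n + 1 : ℝ) * (θ - d)) = 0 := Real.smoothTransition.zero_of_nonpos (mul_nonpos_of_nonneg_of_nonpos hn'.le (by linarith))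
        simp only [hχ]
        rw [hn, h4, hW', indicator_of_mem (show θ ∈ Icc c d' from ⟨h1.le, by linarith⟩)]; simp
      · push Not at h2
        have h3 : θ ∉ Ioc c d := fun hh => absurd hh.2 (not_le.mpr h2)
        rw [indicator_of_notMem h3]
        refine tendsto_const_nhds.congr' ?_
        filter_upwards [hbig c h1, hbig d h2] with n hn hn2
        simp only [hχ]
        rw [hn, hn2]; simp
  have hev : ∀ᶠ n : ℕ in Filter.atTop, ∫ θ, ((deriv (χ n) θ : ℝ) : ℂ) * U' θ = - ∫ θ, ((χ n θ : ℝ) : ℂ) * W' θ := by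
    obtain ⟨N, hN⟩ := exists_nat_gt (1 / (d' - d))
    have h3 : 0 < d' - d := by linarith
    filter_upwards [Filter.eventually_ge_atTop N] with n hn
    have hn1 : (N:ℝ) ≤ n := by exact_mod_cast hn
    have hn' : (0:ℝ) < n + 1 := by positivity
    have hz : ∀ θ ∉ Icc c d', χ n θ = 0 := by
      intro θ hθ
      rw [mem_Icc, not_and_or, not_le, not_le] at hθ
      simp only [hχ, hσ]
      rcases hθ with h | h
      · rw [Real.smoothTransition.zero_of_nonpos, Real.smoothTransition.zero_of_nonpos]
        · simp
        · exact mul_nonpos_of_nonneg_of_nonpos hn'.le (by linarith)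
        · exact mul_nonpos_of_nonneg_of_nonpos hn'.le (by linarith)
      · have h4 : 1 ≤ (n + 1 : ℝ) * (θ - d) := by
          rw [div_lt_iff₀ h3] at hN
          nlinarith
        rw [Real.smoothTransition.one_of_one_le h4, Real.smoothTransition.one_of_one_le]
        · simp
        · nlinarith
    have hts : tsupport (χ n) ⊆ Icc c d' := by
      refine closure_minimal ?_ isClosed_Icc
      intro θ hθ
      by_contra hc
      exact hθ (hz θ hc)
    have hdz : ∀ θ ∉ Icc c d', deriv (χ n) θ = 0 := by
      intro θ hθ
      have : χ n =ᶠ[𝓝 θ] fun _ => 0 := by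
        filter_upwards [isClosed_Icc.isOpen_compl.mem_nhds hθ] with v hv
        exact hz v hv
      rw [this.deriv_eq]; simp
    have hsm : ContDiff ℝ (⊤ : ℕ∞) (χ n) := by
      have h5 : ∀ e : ℝ, ContDiff ℝ (⊤ : ℕ∞) (fun θ => σ ((n + 1 : ℝ) * (θ - e))) := fun e =>
        Real.smoothTransition.contDiff.comp (by fun_prop)
      exact (h5 c).sub (h5 d)
    have := h (χ n) hsm (HasCompactSupport.intro isCompact_Icc hz) (hts.trans hsub)
    convert this using 1
    · congr 1; ext θ
      by_cases hθ : θ ∈ Icc c d'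
      · rw [hU'eq θ hθ]
      · rw [hdz θ hθ]; simp
    · congr 2; ext θ
      by_cases hθ : θ ∈ Icc c d'
      · rw [hW', indicator_of_mem hθ]
      · rw [hz θ hθ]; simp
  have := tendsto_nhds_unique (hL.congr' hev) hR.neg
  rw [hU'eq c ⟨le_rfl, by linarith⟩, hU'eq d ⟨hcd.le, hdd'.le⟩, integral_indicator measurableSet_Ioc] at this
  rw [intervalIntegral.integral_of_le hcd.le]
  linear_combination -this

lemma fub_integrable {G : ℂ → ℂ} (hG : Integrable G) :
    Integrable (fun p : ℝ × ℝ => G ⟨p.1, p.2⟩) (volume.prod volume) := by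
  have h := (Complex.volume_preserving_equiv_real_prod.symm Complex.measurableEquivRealProd)
  have := (h.integrable_comp_emb (Complex.measurableEquivRealProd.symm.measurableEmbedding) (g := G)).mpr hG
  exact this

lemma fub_eq {G : ℂ → ℂ} (hG : Integrable G) :
    ∫ z, G z = ∫ s, ∫ θ, G ⟨s, θ⟩ := by
  have h := (Complex.volume_preserving_equiv_real_prod.symm Complex.measurableEquivRealProd)
  rw [← h.integral_comp' (g := G)]
  exact integral_prod _ (fub_integrable hG)

lemma fub_eq_symm {G : ℂ → ℂ} (hG : Integrable G) :
    ∫ z, G z = ∫ θ, ∫ s, G ⟨s, θ⟩ := by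
  have h := (Complex.volume_preserving_equiv_real_prod.symm Complex.measurableEquivRealProd)
  rw [← h.integral_comp' (g := G)]
  exact integral_prod_symm _ (fub_integrable hG)

lemma box_ind_apply (K K' : Set ℝ) (G : ℂ → ℂ) (s θ : ℝ) :
    (K ×ℂ K').indicator G ⟨s, θ⟩ = K.indicator (fun s => K'.indicator (fun θ => G ⟨s, θ⟩) θ) s := by
  classical
  simp only [indicator_apply, Complex.mem_reProdIm]
  by_cases h1 : s ∈ K <;> by_cases h2 : θ ∈ K' <;> simp [h1, h2]

lemma box_integrable {R : Set ℂ} {w : ℂ → ℂ} (hw : LocallyIntegrableOn w R) {K K' : Set ℝ}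
    (hK : IsCompact K) (hK' : IsCompact K') (hs : K ×ℂ K' ⊆ R) {φ : ℝ → ℝ} (hφ : Continuous φ) :
    Integrable ((K ×ℂ K').indicator (fun z => ((φ z.re : ℝ) : ℂ) * w z)) := by
  have hc : IsCompact (K ×ℂ K') := hK.reProdIm hK'
  refine IntegrableOn.integrable_indicator ?_ hc.isClosed.measurableSet
  exact (hw.integrableOn_compact_subset hs hc).continuousOn_mul (by fun_prop) hc

lemma prodTest {a b a' b' : ℝ} {φ χ : ℝ → ℝ} (hφ : HasCompactSupport φ) (hφs : tsupport φ ⊆ Ioo a b)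
    (hχ : HasCompactSupport χ) (hχs : tsupport χ ⊆ Ioo a' b') :
    HasCompactSupport (fun z : ℂ => ((φ z.re * χ z.im : ℝ) : ℂ)) ∧
    tsupport (fun z : ℂ => ((φ z.re * χ z.im : ℝ) : ℂ)) ⊆ Ioo a b ×ℂ Ioo a' b' := by
  have hc : IsCompact (tsupport φ ×ℂ tsupport χ) := IsCompact.reProdIm hφ hχ
  have hz : ∀ z ∉ tsupport φ ×ℂ tsupport χ, ((φ z.re * χ z.im : ℝ) : ℂ) = 0 := by
    intro z hz
    rw [Complex.mem_reProdIm, not_and_or] at hz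
    rcases hz with h | h
    · rw [image_eq_zero_of_notMem_tsupport h]; simp
    · rw [image_eq_zero_of_notMem_tsupport h]; simp
  refine ⟨HasCompactSupport.intro hc hz, ?_⟩
  refine (closure_minimal (s := Function.support _) (t := tsupport φ ×ℂ tsupport χ) ?_ hc.isClosed).trans ?_
  · intro z hz'
    by_contra h
    exact hz' (hz z h)
  · intro z hz
    rw [Complex.mem_reProdIm] at hz ⊢
    exact ⟨hφs hz.1, hχs hz.2⟩

lemma prodTest_deriv {φ χ : ℝ → ℝ} (hφ : ContDiff ℝ (⊤ : ℕ∞) φ) (hχ : ContDiff ℝ (⊤ : ℕ∞) χ) :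
    ContDiff ℝ (⊤ : ℕ∞) (fun z : ℂ => ((φ z.re * χ z.im : ℝ) : ℂ)) ∧
    ∀ z, fderiv ℝ (fun z : ℂ => ((φ z.re * χ z.im : ℝ) : ℂ)) z I = ((φ z.re * deriv χ z.im : ℝ) : ℂ) := by
  have h1 : ContDiff ℝ (⊤ : ℕ∞) (fun z : ℂ => φ z.re) := hφ.comp Complex.reCLM.contDiff
  have h2 : ContDiff ℝ (⊤ : ℕ∞) (fun z : ℂ => χ z.im) := hχ.comp Complex.imCLM.contDiff
  refine ⟨Complex.ofRealCLM.contDiff.comp (h1.mul h2), fun z => ?_⟩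
  have d1 : HasFDerivAt (fun z : ℂ => φ z.re) ((deriv φ z.re) • Complex.reCLM) z := by
    have := ((hφ.differentiable (by simp)) z.re).hasDerivAt
    exact this.comp_hasFDerivAt z Complex.reCLM.hasFDerivAt
  have d2 : HasFDerivAt (fun z : ℂ => χ z.im) ((deriv χ z.im) • Complex.imCLM) z := by
    have := ((hχ.differentiable (by simp)) z.im).hasDerivAt
    exact this.comp_hasFDerivAt z Complex.imCLM.hasFDerivAt
  have d3 := Complex.ofRealCLM.hasFDerivAt.comp z (d1.mul d2)
  rw [show (fun z : ℂ => ((φ z.re * χ z.im : ℝ) : ℂ)) = Complex.ofRealCLM ∘ ((fun z : ℂ => φ z.re) * (fun z : ℂ => χ z.im)) from rfl, d3.fderiv]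
  simp

lemma integ1 {A : Set ℝ} {u : ℝ → ℂ} (hu : LocallyIntegrableOn u A) {φ : ℝ → ℝ}
    (hφ : Continuous φ) (hc : HasCompactSupport φ) (hs : tsupport φ ⊆ A) :
    Integrable (fun s => ((φ s : ℝ) : ℂ) * u s) := by
  have h1 : IntegrableOn (fun s => ((φ s : ℝ) : ℂ) * u s) (tsupport φ) :=
    (hu.integrableOn_compact_subset hs hc).continuousOn_mul (by fun_prop) hc
  refine (h1.integrable_indicator (isClosed_tsupport φ).measurableSet).congr ?_
  filter_upwards with s
  by_cases hs : s ∈ tsupport φ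
  · rw [indicator_of_mem hs]
  · rw [indicator_of_notMem hs, image_eq_zero_of_notMem_tsupport hs]; simp

lemma acl_pair {a b a' b' : ℝ} {f g h : ℂ → ℂ} (hf : ContinuousOn f (Ioo a b ×ℂ Ioo a' b'))
    (hw : HasDistribWirtingerDerivs (Ioo a b ×ℂ Ioo a' b') f g h)
    {c d : ℝ} (hac : a' < c) (hcd : c < d) (hdb : d < b') :
    ∀ᵐ s : ℝ, s ∈ Ioo a b → f ⟨s, d⟩ - f ⟨s, c⟩ = ∫ θ in c..d, I * (g ⟨s, θ⟩ - h ⟨s, θ⟩) := by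
  set R := Ioo a b ×ℂ Ioo a' b' with hR
  have hRo : IsOpen R := isOpen_Ioo.reProdIm isOpen_Ioo
  set w : ℂ → ℂ := fun z => I * (g z - h z) with hwdef
  have hwl : LocallyIntegrableOn w R := by
    have := hw.1.sub hw.2.1
    intro x hx
    obtain ⟨u, hu, hi⟩ := this x hx
    exact ⟨u, hu, hi.const_mul I⟩
  have hfl : LocallyIntegrableOn f R := hf.locallyIntegrableOn hRo.measurableSet
  have hcdsub : Icc c d ⊆ Ioo a' b' := fun x hx => ⟨by linarith [hx.1], by linarith [hx.2]⟩
  have hsubR : ∀ {K K' : Set ℝ}, K ⊆ Ioo a b → K' ⊆ Ioo a' b' → K ×ℂ K' ⊆ R := by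
    intro K K' h1 h2 z hz
    rw [Complex.mem_reProdIm] at hz
    rw [hR, Complex.mem_reProdIm]
    exact ⟨h1 hz.1, h2 hz.2⟩
  have hfline : ∀ e ∈ Ioo a' b', ContinuousOn (fun s : ℝ => f ⟨s, e⟩) (Ioo a b) := by
    intro e he
    refine hf.comp (f := fun s : ℝ => (⟨s, e⟩ : ℂ)) ?_ ?_
    · have : (fun s : ℝ => (⟨s, e⟩ : ℂ)) = fun s : ℝ => (s : ℂ) + e * I := by
        ext s; exact Complex.mk_eq_add_mul_I _ _
      rw [this]; fun_prop
    · intro s hs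
      rw [hR, Complex.mem_reProdIm]; exact ⟨hs, he⟩
  set V : ℝ → ℂ := fun s => f ⟨s, d⟩ - f ⟨s, c⟩ - ∫ θ in c..d, w ⟨s, θ⟩ with hV
  have hWint : LocallyIntegrableOn (fun s => ∫ θ in c..d, w ⟨s, θ⟩) (Ioo a b) := by
    rw [locallyIntegrableOn_iff isOpen_Ioo.isLocallyClosed]
    intro K hK hKc
    have hb := box_integrable hwl hKc isCompact_Icc (hsubR hK hcdsub) (φ := fun _ => 1) continuous_const
    have := (fub_integrable hb).integral_prod_left
    rw [← integrable_indicator_iff hKc.isClosed.measurableSet]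
    refine this.congr ?_
    filter_upwards with s
    simp only [box_ind_apply]
    by_cases hs : s ∈ K
    · simp only [indicator_of_mem hs]
      rw [integral_indicator measurableSet_Icc, intervalIntegral.integral_of_le hcd.le, integral_Icc_eq_integral_Ioc]
      simp
    · simp [indicator_of_notMem hs]
  have hVl : LocallyIntegrableOn V (Ioo a b) :=
    (((hfline d ⟨by linarith, hdb⟩).sub (hfline c ⟨hac, by linarith⟩)).locallyIntegrableOn measurableSet_Ioo).sub hWint
  have main : ∀ᵐ s : ℝ, s ∈ Ioo a b → V s = 0 := by
    refine IsOpen.ae_eq_zero_of_integral_contDiff_smul_eq_zero isOpen_Ioo hVl ?_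
    intro φ hφ hφc hφs
    have hφcont := hφ.continuous
    set U : ℝ → ℂ := fun θ => ∫ s, ((φ s : ℝ) : ℂ) * f ⟨s, θ⟩ with hU
    set W : ℝ → ℂ := fun θ => ∫ s, ((φ s : ℝ) : ℂ) * w ⟨s, θ⟩ with hW
    have hslice : ∀ K' : Set ℝ, ∀ θ, (∫ s, (tsupport φ ×ℂ K').indicator (fun z => ((φ z.re : ℝ) : ℂ) * w z) ⟨s, θ⟩)
        = K'.indicator W θ := by
      intro K' θ
      by_cases hθ : θ ∈ K'
      · rw [indicator_of_mem hθ]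
        simp only [hW]
        congr 1; ext s
        rw [box_ind_apply]
        by_cases hs : s ∈ tsupport φ
        · simp [indicator_of_mem hs, indicator_of_mem hθ]
        · simp [indicator_of_notMem hs, image_eq_zero_of_notMem_tsupport hs]
      · rw [indicator_of_notMem hθ]
        rw [← integral_zero ℝ ℂ]
        congr 1; ext s
        rw [box_ind_apply]
        by_cases hs : s ∈ tsupport φ
        · simp [indicator_of_mem hs, indicator_of_notMem hθ]
        · simp [indicator_of_notMem hs]
    have hUc : ContinuousOn U (Ioo a' b') := by
      refine continuousOn_integral_of_compact_support (k := tsupport φ) hφc ?_ ?_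
      · intro p hp
        by_cases hs : p.2 ∈ tsupport φ
        · have hpR : (⟨p.2, p.1⟩ : ℂ) ∈ R := by
            rw [hR, Complex.mem_reProdIm]; exact ⟨hφs hs, hp.1⟩
          have h1 : ContinuousAt f (⟨p.2, p.1⟩ : ℂ) := hf.continuousAt (hRo.mem_nhds hpR)
          have h2 : Continuous (fun q : ℝ × ℝ => (⟨q.2, q.1⟩ : ℂ)) := by
            have : (fun q : ℝ × ℝ => (⟨q.2, q.1⟩ : ℂ)) = fun q : ℝ × ℝ => ((q.2 : ℝ) : ℂ) + ((q.1 : ℝ) : ℂ) * I := by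
              ext q; exact Complex.mk_eq_add_mul_I _ _
            rw [this]; fun_prop
          have h3 : ContinuousAt (fun q : ℝ × ℝ => f (⟨q.2, q.1⟩ : ℂ)) p :=
            ContinuousAt.comp (f := fun q : ℝ × ℝ => (⟨q.2, q.1⟩ : ℂ)) h1 h2.continuousAt
          have h4 : ContinuousAt (fun q : ℝ × ℝ => ((φ q.2 : ℝ) : ℂ)) p := by fun_prop
          exact (h4.mul h3).continuousWithinAt
        · have : ContinuousAt (Function.uncurry fun (θ s : ℝ) => ((φ s : ℝ) : ℂ) * f ⟨s, θ⟩) p := by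
            refine continuousAt_const (y := (0:ℂ)) |>.congr ?_
            have hop : IsOpen {q : ℝ × ℝ | q.2 ∉ tsupport φ} := ((isClosed_tsupport φ).preimage continuous_snd).isOpen_compl
            filter_upwards [hop.mem_nhds hs] with q hq
            simp only [Function.uncurry]
            rw [image_eq_zero_of_notMem_tsupport hq]; simp
          exact this.continuousWithinAt
      · intro p x _ hx
        rw [image_eq_zero_of_notMem_tsupport hx]; simp
    have hWl : LocallyIntegrableOn W (Ioo a' b') := by
      rw [locallyIntegrableOn_iff isOpen_Ioo.isLocallyClosed]
      intro K hK hKc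
      have hb := box_integrable hwl hφc hKc (hsubR hφs hK) hφcont
      have := (fub_integrable hb).integral_prod_right
      rw [← integrable_indicator_iff hKc.isClosed.measurableSet]
      refine this.congr ?_
      filter_upwards with θ
      exact hslice K θ
    have h1d := weak1D hUc hWl ?_ hac hcd hdb
    · -- conclude
      have hb := box_integrable hwl hφc (isCompact_Icc (a := c) (b := d)) (hsubR hφs hcdsub) hφcont
      have e1 := (fub_eq_symm hb).symm.trans (fub_eq hb)
      simp only [hslice] at e1
      rw [integral_indicator measurableSet_Icc, integral_Icc_eq_integral_Ioc, ← intervalIntegral.integral_of_le hcd.le, ← h1d] at e1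
      have e2 : ∀ s, (∫ θ, (tsupport φ ×ℂ Icc c d).indicator (fun z => ((φ z.re : ℝ) : ℂ) * w z) ⟨s, θ⟩)
          = ((φ s : ℝ) : ℂ) * ∫ θ in c..d, w ⟨s, θ⟩ := by
        intro s
        simp only [box_ind_apply]
        by_cases hs : s ∈ tsupport φ
        · simp only [indicator_of_mem hs]
          rw [integral_indicator measurableSet_Icc, intervalIntegral.integral_of_le hcd.le, integral_Icc_eq_integral_Ioc,
            integral_const_mul]
        · simp [indicator_of_notMem hs, image_eq_zero_of_notMem_tsupport hs]
      simp only [e2] at e1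
      have hfi : ∀ e ∈ Ioo a' b', Integrable (fun s => ((φ s : ℝ) : ℂ) * f ⟨s, e⟩) := by
        intro e he
        have := (hfline e he).locallyIntegrableOn (μ := volume) measurableSet_Ioo
        exact integ1 this hφcont hφc hφs
      have hwi : Integrable (fun s => ((φ s : ℝ) : ℂ) * ∫ θ in c..d, w ⟨s, θ⟩) := by
        exact integ1 hWint hφcont hφc hφs
      have hd1 : d ∈ Ioo a' b' := ⟨by linarith, hdb⟩
      have hc1 : c ∈ Ioo a' b' := ⟨hac, by linarith⟩
      have e3 : ∀ s, φ s • V s = ((φ s : ℝ) : ℂ) * f ⟨s, d⟩ - ((φ s : ℝ) : ℂ) * f ⟨s, c⟩ - ((φ s : ℝ) : ℂ) * ∫ θ in c..d, w ⟨s, θ⟩ := by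
        intro s; rw [Complex.real_smul]; simp only [hV]; ring
      simp_rw [e3]
      have hfi2 : Integrable (fun s => ((φ s : ℝ) : ℂ) * f ⟨s, d⟩ - ((φ s : ℝ) : ℂ) * f ⟨s, c⟩) :=
        (hfi d hd1).sub (hfi c hc1)
      rw [integral_sub hfi2 hwi, integral_sub (hfi d hd1) (hfi c hc1)]
      rw [← e1]
      simp only [hU]; ring
    · intro χ hχ hχc hχs
      obtain ⟨hΦc, hΦs⟩ := prodTest hφc hφs hχc hχs
      have hφ' : ContDiff ℝ (⊤ : ℕ∞) φ := hφ
      obtain ⟨hΦ, hΦd⟩ := prodTest_deriv hφ' hχ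
      have hdχc : HasCompactSupport (deriv χ) := hχc.deriv
      have hdχs : tsupport (deriv χ) ⊆ Ioo a' b' := (tsupport_deriv_subset (f := χ)).trans hχs
      obtain ⟨hΦ'c, hΦ's⟩ := prodTest hφc hφs hdχc hdχs
      have hdχcont : Continuous (deriv χ) := hχ.continuous_deriv (by simp)
      have hχcont := hχ.continuous
      set Φ : ℂ → ℂ := fun z : ℂ => ((φ z.re * χ z.im : ℝ) : ℂ) with hΦdef
      set Φ' : ℂ → ℂ := fun z : ℂ => ((φ z.re * deriv χ z.im : ℝ) : ℂ) with hΦ'def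
      have hΦcont : Continuous Φ := hΦ.continuous
      have hΦ'cont : Continuous Φ' := by
        have : Continuous fun z : ℂ => (φ z.re * deriv χ z.im : ℝ) := 
          (hφcont.comp Complex.continuous_re).mul (hdχcont.comp Complex.continuous_im)
        exact Complex.continuous_ofReal.comp this
      have hi1 := integrable_mul_of_tsupport hfl hΦ'cont hΦ'c hΦ's
      have hi2 := integrable_mul_of_tsupport hwl hΦcont hΦc hΦs
      have hzero : ∀ {k Ψ : ℂ → ℂ}, tsupport Ψ ⊆ R → ∫ z in R, k z * Ψ z = ∫ z, k z * Ψ z := by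
        intro k Ψ hs
        refine setIntegral_eq_integral_of_forall_compl_eq_zero (fun z hz => ?_)
        rw [image_eq_zero_of_notMem_tsupport (fun h => hz (hs h))]; simp
      have key : ∫ z, f z * Φ' z = - ∫ z, w z * Φ z := by
        obtain ⟨hz1, hz2⟩ := hw.2.2 Φ hΦ hΦc hΦs
        have hg := integrable_mul_of_tsupport hw.1 hΦcont hΦc hΦs
        have hh := integrable_mul_of_tsupport hw.2.1 hΦcont hΦc hΦs
        rw [hzero hΦs] at hz1 hz2
        have hfd : Continuous (fun z => fderiv ℝ Φ z) := hΦ.continuous_fderiv (by simp)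
        have hsfd : tsupport (fderiv ℝ Φ) ⊆ R := (tsupport_fderiv_subset ℝ).trans hΦs
        have hcfd : HasCompactSupport (fderiv ℝ Φ) := hΦc.fderiv (𝕜 := ℝ)
        have hWc : ∀ v : ℂ, Integrable (fun z => f z * fderiv ℝ Φ z v) := by
          intro v
          have hsub : tsupport (fun z => fderiv ℝ Φ z v) ⊆ tsupport (fderiv ℝ Φ) := by
            refine closure_mono ?_
            intro z hz h0
            apply hz
            simp [h0]
          refine integrable_mul_of_tsupport hfl (by fun_prop) ?_ (hsub.trans hsfd)
          exact IsCompact.of_isClosed_subset hcfd (isClosed_tsupport _) hsub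
        have hR2 : ∀ G : ℂ → ℂ, (∀ z ∉ R, G z = 0) → ∫ z in R, G z = ∫ z, G z := fun G hG =>
          setIntegral_eq_integral_of_forall_compl_eq_zero hG
        have hfd0 : ∀ z ∉ R, fderiv ℝ Φ z = 0 := fun z hz =>
          image_eq_zero_of_notMem_tsupport (fun h => hz (hsfd h))
        rw [hR2 _ (fun z hz => by simp [wirtingerZ, hfd0 z hz])] at hz1
        rw [hR2 _ (fun z hz => by simp [wirtingerZBar, hfd0 z hz])] at hz2
        have hiz : Integrable (fun z => f z * wirtingerZ Φ z) := by
          refine (((hWc 1).sub ((hWc I).const_mul I)).div_const 2).congr ?_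
          filter_upwards with z
          simp only [wirtingerZ, Pi.sub_apply]; ring
        have hizb : Integrable (fun z => f z * wirtingerZBar Φ z) := by
          refine (((hWc 1).add ((hWc I).const_mul I)).div_const 2).congr ?_
          filter_upwards with z
          simp only [wirtingerZBar, Pi.add_apply]; ring
        have e1 : ∀ z, f z * Φ' z = I * (f z * wirtingerZ Φ z - f z * wirtingerZBar Φ z) := by
          intro z
          have : fderiv ℝ Φ z I = Φ' z := hΦd z
          simp only [wirtingerZ, wirtingerZBar]
          rw [this]
          linear_combination (f z * Φ' z) * Complex.I_mul_I
        have e2 : ∀ z, w z * Φ z = I * (g z * Φ z - h z * Φ z) := by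
          intro z; simp only [hwdef]; ring
        simp_rw [e1, e2]
        rw [integral_const_mul, integral_const_mul, integral_sub hiz hizb, integral_sub hg hh, hz1, hz2]
        ring
      rw [fub_eq_symm hi1, fub_eq_symm hi2] at key
      convert key using 1
      · congr 1; ext θ
        simp only [hU, hΦ'def]
        rw [← integral_const_mul]
        congr 1; ext s
        push_cast; ring
      · congr 2; ext θ
        simp only [hW, hΦdef]
        rw [← integral_const_mul]
        congr 1; ext s
        push_cast; ring
  filter_upwards [main] with s hs hsI
  have := hs hsI
  simp only [hV] at this
  exact sub_eq_zero.mp this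

lemma cont_vline (s : ℝ) : Continuous (fun θ : ℝ => (⟨s, θ⟩ : ℂ)) := by
  have : (fun θ : ℝ => (⟨s, θ⟩ : ℂ)) = fun θ : ℝ => (s : ℂ) + θ * I := by
    ext θ; exact Complex.mk_eq_add_mul_I _ _
  rw [this]; fun_prop

lemma acl_box {a b a' b' : ℝ} {f g h : ℂ → ℂ} (hf : ContinuousOn f (Ioo a b ×ℂ Ioo a' b'))
    (hw : HasDistribWirtingerDerivs (Ioo a b ×ℂ Ioo a' b') f g h)
    {a1 b1 c d : ℝ} (ha : a < a1) (hb : b1 < b) (hac : a' < c) (hcd : c < d) (hdb : d < b') :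
    ∀ᵐ s : ℝ, s ∈ Icc a1 b1 → IntegrableOn (fun θ => I * (g ⟨s, θ⟩ - h ⟨s, θ⟩)) (Icc c d) ∧
      ∀ θ ∈ Icc c d, f ⟨s, θ⟩ - f ⟨s, c⟩ = ∫ θ in c..θ, I * (g ⟨s, θ⟩ - h ⟨s, θ⟩) := by
  set R := Ioo a b ×ℂ Ioo a' b' with hR
  have hwl : LocallyIntegrableOn (fun z => I * (g z - h z)) R := by
    have := hw.1.sub hw.2.1
    intro x hx
    obtain ⟨u, hu, hi⟩ := this x hx
    exact ⟨u, hu, hi.const_mul I⟩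
  have hsub : Icc a1 b1 ×ℂ Icc c d ⊆ R := by
    intro z hz
    rw [Complex.mem_reProdIm] at hz
    rw [hR, Complex.mem_reProdIm]
    exact ⟨⟨by linarith [hz.1.1], by linarith [hz.1.2]⟩, ⟨by linarith [hz.2.1], by linarith [hz.2.2]⟩⟩
  have hb1 := box_integrable hwl isCompact_Icc isCompact_Icc hsub (φ := fun _ => 1) continuous_const
  have h1 := (fub_integrable hb1).prod_right_ae
  have h2 : ∀ᵐ s : ℝ, ∀ q : ℚ, (c < q ∧ (q:ℝ) < d) → s ∈ Ioo a b → f ⟨s, q⟩ - f ⟨s, c⟩ = ∫ θ in c..q, I * (g ⟨s, θ⟩ - h ⟨s, θ⟩) := by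
    rw [ae_all_iff]
    intro q
    by_cases hq : c < q ∧ (q:ℝ) < d
    · filter_upwards [acl_pair hf hw hac hq.1 (by linarith [hq.2])] with s hs _ using hs
    · filter_upwards with s h using absurd h hq
  filter_upwards [h1, h2] with s hs1 hs2 hs
  have hsI : s ∈ Ioo a b := ⟨by linarith [hs.1], by linarith [hs.2]⟩
  have hIntg : IntegrableOn (fun θ => I * (g ⟨s, θ⟩ - h ⟨s, θ⟩)) (Icc c d) := by
    rw [← integrable_indicator_iff measurableSet_Icc]
    refine hs1.congr ?_
    filter_upwards with θ
    simp only [box_ind_apply, indicator_of_mem hs]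
    simp
  refine ⟨hIntg, ?_⟩
  have hcf : ContinuousOn (fun θ : ℝ => f ⟨s, θ⟩ - f ⟨s, c⟩) (Icc c d) := by
    refine ContinuousOn.sub ?_ continuousOn_const
    refine hf.comp (f := fun θ : ℝ => (⟨s, θ⟩ : ℂ)) (cont_vline s).continuousOn ?_
    intro θ hθ
    rw [hR, Complex.mem_reProdIm]
    exact ⟨hsI, ⟨by linarith [hθ.1], by linarith [hθ.2]⟩⟩
  have hci : ContinuousOn (fun x : ℝ => ∫ θ in c..x, I * (g ⟨s, θ⟩ - h ⟨s, θ⟩)) (Icc c d) := by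
    have := intervalIntegral.continuousOn_primitive_interval (a := c) (b := d) (μ := volume)
      (f := fun θ => I * (g ⟨s, θ⟩ - h ⟨s, θ⟩)) (by rwa [uIcc_of_le hcd.le])
    rwa [uIcc_of_le hcd.le] at this
  have hE : EqOn (fun θ : ℝ => f ⟨s, θ⟩ - f ⟨s, c⟩) (fun x : ℝ => ∫ θ in c..x, I * (g ⟨s, θ⟩ - h ⟨s, θ⟩))
      (Ioo c d ∩ range ((↑) : ℚ → ℝ)) := by
    rintro θ ⟨hθ, q, rfl⟩
    exact hs2 q hθ hsI
  have hcl : Icc c d ⊆ closure (Ioo c d ∩ range ((↑) : ℚ → ℝ)) := by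
    rw [← closure_Ioo hcd.ne]
    exact closure_minimal (Rat.denseRange_cast.open_subset_closure_inter isOpen_Ioo) isClosed_closure
  exact hE.of_subset_closure hcf hci (inter_subset_left.trans Ioo_subset_Icc_self) hcl

lemma cross_up {u : ℝ → ℝ} {c d p q : ℝ} (hcd : c ≤ d) (hpq : p < q) (hu : ContinuousOn u (Icc c d))
    (hc : u c ≤ p) (hd : q ≤ u d) :
    ∃ x ∈ Icc c d, ∃ y ∈ Icc c d, x ≤ y ∧ (∀ θ ∈ Ioo x y, p < u θ ∧ u θ < q) ∧ q - p ≤ |u y - u x| := by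
  have hS : IsCompact {θ ∈ Icc c d | q ≤ u θ} := by
    have := hu.preimage_isClosed_of_isClosed isClosed_Icc (isClosed_Ici (a := q))
    exact IsCompact.of_isClosed_subset isCompact_Icc this inter_subset_left
  obtain ⟨y, hy⟩ := hS.exists_isLeast ⟨d, ⟨hcd, le_rfl⟩, hd⟩
  have hy1 := hy.1.1
  have hT : IsCompact {θ ∈ Icc c y | u θ ≤ p} := by
    have := (hu.mono (Icc_subset_Icc_right hy1.2)).preimage_isClosed_of_isClosed isClosed_Icc (isClosed_Iic (a := p))
    exact IsCompact.of_isClosed_subset isCompact_Icc this inter_subset_left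
  obtain ⟨x, hx⟩ := hT.exists_isGreatest ⟨c, ⟨le_rfl, hy1.1⟩, hc⟩
  have hx1 := hx.1.1
  refine ⟨x, ⟨hx1.1, hx1.2.trans hy1.2⟩, y, hy1, hx1.2, ?_, ?_⟩
  · intro θ hθ
    constructor
    · by_contra h
      push Not at h
      have := hx.2 ⟨⟨hx1.1.trans hθ.1.le, hθ.2.le⟩, h⟩
      linarith [hθ.1]
    · by_contra h
      push Not at h
      have := hy.2 ⟨⟨hx1.1.trans hθ.1.le, hθ.2.le.trans hy1.2⟩, h⟩
      linarith [hθ.2]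
  · have := le_abs_self (u y - u x)
    have h1 : u x ≤ p := hx.1.2
    have h2 : q ≤ u y := hy.1.2
    linarith

lemma cross_any {u : ℝ → ℝ} {c d p q : ℝ} (hcd : c ≤ d) (hpq : p < q) (hu : ContinuousOn u (Icc c d))
    (h : (u c ≤ p ∧ q ≤ u d) ∨ (u d ≤ p ∧ q ≤ u c)) :
    ∃ x ∈ Icc c d, ∃ y ∈ Icc c d, x ≤ y ∧ (∀ θ ∈ Ioo x y, p < u θ ∧ u θ < q) ∧ q - p ≤ |u y - u x| := by
  rcases h with h | h
  · exact cross_up hcd hpq hu h.1 h.2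
  · have hm : ContinuousOn (fun θ => u (c + d - θ)) (Icc c d) := by
      refine hu.comp (by fun_prop) ?_
      intro θ hθ
      exact ⟨by linarith [hθ.2], by linarith [hθ.1]⟩
    obtain ⟨x, hx, y, hy, hxy, h1, h2⟩ := cross_up hcd hpq hm (by simpa using h.1) (by simpa using h.2)
    refine ⟨c + d - y, ⟨by linarith [hy.2], by linarith [hy.1]⟩, c + d - x, ⟨by linarith [hx.2], by linarith [hx.1]⟩, by linarith, ?_, ?_⟩
    · intro θ hθ
      have := h1 (c + d - θ) ⟨by linarith [hθ.2], by linarith [hθ.1]⟩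
      simpa using this
    · rw [abs_sub_comm]; exact h2

lemma crossing_line {f w : ℂ → ℂ} {s c d : ℝ} (hcd : c < d)
    (hfc : ContinuousOn (fun θ : ℝ => f ⟨s, θ⟩) (Icc c d))
    (hIntg : IntegrableOn (fun θ => w ⟨s, θ⟩) (Icc c d))
    (hacl : ∀ θ ∈ Icc c d, f ⟨s, θ⟩ - f ⟨s, c⟩ = ∫ θ in c..θ, w ⟨s, θ⟩)
    {y : ℂ} {p q : ℝ} (hpq : p < q)
    (h : (‖f ⟨s, c⟩ - y‖ ≤ p ∧ q ≤ ‖f ⟨s, d⟩ - y‖) ∨ (‖f ⟨s, d⟩ - y‖ ≤ p ∧ q ≤ ‖f ⟨s, c⟩ - y‖)) :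
    ENNReal.ofReal (q - p) ≤
      ∫⁻ θ in {θ ∈ Icc c d | p < ‖f ⟨s, θ⟩ - y‖ ∧ ‖f ⟨s, θ⟩ - y‖ < q}, ‖w ⟨s, θ⟩‖ₑ := by
  obtain ⟨x1, hx1, x2, hx2, h12, hmem, hdiff⟩ := cross_any (u := fun θ => ‖f ⟨s, θ⟩ - y‖) hcd.le hpq
    ((hfc.sub continuousOn_const).norm) h
  have hii : ∀ θ ∈ Icc c d, IntervalIntegrable (fun θ => w ⟨s, θ⟩) volume c θ := by
    intro θ hθ
    rw [intervalIntegrable_iff_integrableOn_Icc_of_le hθ.1]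
    exact hIntg.mono_set (Icc_subset_Icc_right hθ.2)
  have e1 : f ⟨s, x2⟩ - f ⟨s, x1⟩ = ∫ θ in x1..x2, w ⟨s, θ⟩ := by
    rw [← intervalIntegral.integral_interval_sub_left (hii x2 hx2) (hii x1 hx1), ← hacl x1 hx1, ← hacl x2 hx2]
    ring
  have e2 : q - p ≤ ‖∫ θ in x1..x2, w ⟨s, θ⟩‖ := by
    rw [← e1]
    refine hdiff.trans ((abs_norm_sub_norm_le _ _).trans (le_of_eq ?_))
    congr 1; ring
  calc ENNReal.ofReal (q - p) ≤ ENNReal.ofReal ‖∫ θ in x1..x2, w ⟨s, θ⟩‖ := ENNReal.ofReal_le_ofReal e2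
    _ = ‖∫ θ in Ioo x1 x2, w ⟨s, θ⟩‖ₑ := by
        rw [ofReal_norm, intervalIntegral.integral_of_le h12, integral_Ioc_eq_integral_Ioo]
    _ ≤ ∫⁻ θ in Ioo x1 x2, ‖w ⟨s, θ⟩‖ₑ := enorm_integral_le_lintegral_enorm _
    _ ≤ _ := by
        refine lintegral_mono_set ?_
        intro θ hθ
        exact ⟨⟨by linarith [hθ.1, hx1.1], by linarith [hθ.2, hx2.2]⟩, hmem θ hθ⟩

lemma fub_lintegral {G : ℂ → ENNReal} (hG : AEMeasurable G) :
    ∫⁻ z, G z = ∫⁻ s : ℝ, ∫⁻ θ : ℝ, G ⟨s, θ⟩ := by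
  have h := (Complex.volume_preserving_equiv_real_prod.symm Complex.measurableEquivRealProd)
  have he := (Complex.measurableEquivRealProd.symm.measurableEmbedding)
  rw [← h.lintegral_comp_emb he]
  exact lintegral_prod _ (hG.comp_quasiMeasurePreserving h.quasiMeasurePreserving)

/-- the crossing set -/
def crossSet (f : ℂ → ℂ) (a1 b1 c d : ℝ) (y : ℂ) (p q : ℝ) : Set ℂ :=
  {z ∈ Icc a1 b1 ×ℂ Icc c d | p < ‖f z - y‖ ∧ ‖f z - y‖ < q}

lemma crossing_lower {a b a' b' : ℝ} {f g h : ℂ → ℂ} (hf : ContinuousOn f (Ioo a b ×ℂ Ioo a' b'))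
    (hw : HasDistribWirtingerDerivs (Ioo a b ×ℂ Ioo a' b') f g h)
    {a1 b1 c d : ℝ} (ha : a < a1) (hb : b1 < b) (hac : a' < c) (hcd : c < d) (hdb : d < b')
    {y : ℂ} {p q : ℝ} (hpq : p < q)
    (H : ∀ s ∈ Icc a1 b1, (‖f ⟨s, c⟩ - y‖ ≤ p ∧ q ≤ ‖f ⟨s, d⟩ - y‖) ∨ (‖f ⟨s, d⟩ - y‖ ≤ p ∧ q ≤ ‖f ⟨s, c⟩ - y‖)) :
    MeasurableSet (crossSet f a1 b1 c d y p q) ∧ crossSet f a1 b1 c d y p q ⊆ Ioo a b ×ℂ Ioo a' b' ∧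
    ENNReal.ofReal (q - p) * ENNReal.ofReal (b1 - a1) ≤
      ∫⁻ z in crossSet f a1 b1 c d y p q, ‖I * (g z - h z)‖ₑ := by
  set R := Ioo a b ×ℂ Ioo a' b' with hR
  have hRo : IsOpen R := isOpen_Ioo.reProdIm isOpen_Ioo
  set w : ℂ → ℂ := fun z => I * (g z - h z) with hwdef
  have hwl : LocallyIntegrableOn w R := by
    have := hw.1.sub hw.2.1
    intro x hx
    obtain ⟨u, hu, hi⟩ := this x hx
    exact ⟨u, hu, hi.const_mul I⟩
  have hsub : Icc a1 b1 ×ℂ Icc c d ⊆ R := by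
    intro z hz
    rw [Complex.mem_reProdIm] at hz
    rw [hR, Complex.mem_reProdIm]
    exact ⟨⟨by linarith [hz.1.1], by linarith [hz.1.2]⟩, ⟨by linarith [hz.2.1], by linarith [hz.2.2]⟩⟩
  have hBc : IsCompact (Icc a1 b1 ×ℂ Icc c d) := isCompact_Icc.reProdIm isCompact_Icc
  have hEm : MeasurableSet (crossSet f a1 b1 c d y p q) := by
    have h1 : IsOpen (R ∩ (fun z => ‖f z - y‖) ⁻¹' Ioo p q) :=
      ((hf.sub continuousOn_const).norm).isOpen_inter_preimage hRo isOpen_Ioo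
    have h2 : crossSet f a1 b1 c d y p q = (Icc a1 b1 ×ℂ Icc c d) ∩ (R ∩ (fun z => ‖f z - y‖) ⁻¹' Ioo p q) := by
      ext z
      constructor
      · intro hz; exact ⟨hz.1, hsub hz.1, hz.2⟩
      · intro hz; exact ⟨hz.1, hz.2.2⟩
    rw [h2]
    exact hBc.isClosed.measurableSet.inter h1.measurableSet
  have hEB : crossSet f a1 b1 c d y p q ⊆ Icc a1 b1 ×ℂ Icc c d := fun z hz => hz.1
  refine ⟨hEm, hEB.trans hsub, ?_⟩
  have hm : AEMeasurable (fun z => ‖w z‖ₑ) (volume.restrict (crossSet f a1 b1 c d y p q)) :=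
    ((hwl.integrableOn_compact_subset hsub hBc).mono_set hEB).1.enorm
  rw [← lintegral_indicator hEm, fub_lintegral ((aemeasurable_indicator_iff hEm).mpr hm)]
  have hvol : ENNReal.ofReal (q - p) * ENNReal.ofReal (b1 - a1) = ∫⁻ s in Icc a1 b1, ENNReal.ofReal (q - p) := by
    rw [lintegral_const, Measure.restrict_apply MeasurableSet.univ, univ_inter, Real.volume_Icc]
  rw [hvol, ← lintegral_indicator measurableSet_Icc]
  refine lintegral_mono_ae ?_
  filter_upwards [acl_box hf hw ha hb hac hcd hdb] with s hs
  by_cases hsI : s ∈ Icc a1 b1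
  · rw [indicator_of_mem hsI]
    obtain ⟨hi, hacl⟩ := hs hsI
    have hfc : ContinuousOn (fun θ : ℝ => f ⟨s, θ⟩) (Icc c d) := by
      refine hf.comp (f := fun θ : ℝ => (⟨s, θ⟩ : ℂ)) (cont_vline s).continuousOn ?_
      intro θ hθ
      apply hsub
      rw [Complex.mem_reProdIm]
      exact ⟨hsI, hθ⟩
    refine (crossing_line (w := w) hcd hfc hi hacl hpq (H s hsI)).trans (le_of_eq ?_)
    have hms : MeasurableSet {θ ∈ Icc c d | p < ‖f ⟨s, θ⟩ - y‖ ∧ ‖f ⟨s, θ⟩ - y‖ < q} := by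
      have h3 : {θ ∈ Icc c d | p < ‖f ⟨s, θ⟩ - y‖ ∧ ‖f ⟨s, θ⟩ - y‖ < q} = (fun θ : ℝ => (⟨s, θ⟩ : ℂ)) ⁻¹' crossSet f a1 b1 c d y p q := by
        ext θ
        simp only [crossSet, mem_ofPred_eq, mem_preimage, Complex.mem_reProdIm]
        tauto
      rw [h3]
      exact (cont_vline s).measurable hEm
    rw [← lintegral_indicator hms]
    congr 1; ext θ
    simp only [indicator, crossSet, mem_ofPred_eq, Complex.mem_reProdIm]
    by_cases h4 : θ ∈ Icc c d ∧ p < ‖f ⟨s, θ⟩ - y‖ ∧ ‖f ⟨s, θ⟩ - y‖ < q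
    · rw [if_pos h4, if_pos ⟨⟨hsI, h4.1⟩, h4.2⟩]
    · rw [if_neg h4, if_neg (fun h5 => h4 ⟨h5.1.2, h5.2⟩)]
  · rw [indicator_of_notMem hsI]; exact zero_le

lemma sq_lintegral_le {E : Set ℂ} {G : ℂ → ENNReal} (hG : AEMeasurable G (volume.restrict E)) :
    (∫⁻ z in E, G z) ^ 2 ≤ (∫⁻ z in E, G z ^ 2) * volume E := by
  have := ENNReal.lintegral_mul_le_Lp_mul_Lq (volume.restrict E) Real.HolderConjugate.two_two hG
    (aemeasurable_const (b := (1 : ENNReal)))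
  simp only [Pi.mul_apply, mul_one, ENNReal.one_rpow, lintegral_const, one_mul, Measure.restrict_apply MeasurableSet.univ, univ_inter] at this
  have h2 := pow_le_pow_left' this 2
  rw [mul_pow] at h2
  have h3 : ∀ x : ENNReal, (x ^ (1 / (2:ℝ))) ^ 2 = x := by
    intro x
    rw [← ENNReal.rpow_natCast, ← ENNReal.rpow_mul]; norm_num
  rw [h3, h3] at h2
  have h4 : ∀ z, G z ^ (2:ℝ) = G z ^ 2 := fun z => by
    rw [← ENNReal.rpow_natCast]; norm_num
  simp_rw [h4] at h2
  exact h2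

lemma crossing_area (k : ℝ) (hk0 : 0 ≤ k) (hk : k < 1) : ∃ C : ℝ, 0 ≤ C ∧
    ∀ (a b a' b' : ℝ) (f g h : ℂ → ℂ), ContinuousOn f (Ioo a b ×ℂ Ioo a' b') →
    InjOn f (Ioo a b ×ℂ Ioo a' b') →
    HasDistribWirtingerDerivs (Ioo a b ×ℂ Ioo a' b') f g h →
    (∀ᵐ z ∂(volume.restrict (Ioo a b ×ℂ Ioo a' b')), ‖h z‖ ≤ k * ‖g z‖) →
    ∀ a1 b1 c d : ℝ, a < a1 → a1 ≤ b1 → b1 < b → a' < c → c < d → d < b' →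
    ∀ (y : ℂ) (p : ℝ), 0 < p →
    (∀ s ∈ Icc a1 b1, (‖f ⟨s, c⟩ - y‖ ≤ p ∧ 2 * p ≤ ‖f ⟨s, d⟩ - y‖) ∨ (‖f ⟨s, d⟩ - y‖ ≤ p ∧ 2 * p ≤ ‖f ⟨s, c⟩ - y‖)) →
    ENNReal.ofReal ((b1 - a1) ^ 2) ≤ ENNReal.ofReal C * volume (crossSet f a1 b1 c d y p (2 * p)) := by
  obtain ⟨C, hC0, hC⟩ := area_lemma k hk0 hk
  refine ⟨4 * C * (π * 4), by positivity, ?_⟩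
  intro a b a' b' f g h hf hinj hw hae a1 b1 c d ha hab hb hac hcd hdb y p hp H
  obtain ⟨hEm, hER, hlow⟩ := crossing_lower hf hw ha hb hac hcd hdb (show p < 2 * p by linarith) H
  set E := crossSet f a1 b1 c d y p (2 * p) with hE
  have hRo : IsOpen (Ioo a b ×ℂ Ioo a' b') := isOpen_Ioo.reProdIm isOpen_Ioo
  have harea := hC _ f g h hRo hf hinj hw hae E hEm hER
  have him : volume (f '' E) ≤ ENNReal.ofReal (π * (2 * p) ^ 2) := by
    have : f '' E ⊆ closedBall y (2 * p) := by
      rintro _ ⟨z, hz, rfl⟩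
      rw [mem_closedBall, dist_eq_norm]
      exact hz.2.2.le
    refine (measure_mono this).trans (le_of_eq ?_)
    rw [Complex.volume_closedBall]
    rw [ENNReal.ofReal_mul Real.pi_pos.le, ENNReal.ofReal_pow (by positivity), mul_comm]
    congr 1
    exact (ENNReal.ofReal_coe_nnreal (p := NNReal.pi)).symm
  have hBc : IsCompact (Icc a1 b1 ×ℂ Icc c d) := isCompact_Icc.reProdIm isCompact_Icc
  have hsub : Icc a1 b1 ×ℂ Icc c d ⊆ Ioo a b ×ℂ Ioo a' b' := by
    intro z hz
    rw [Complex.mem_reProdIm] at hz ⊢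
    exact ⟨⟨by linarith [hz.1.1], by linarith [hz.1.2]⟩, ⟨by linarith [hz.2.1], by linarith [hz.2.2]⟩⟩
  have hEB : E ⊆ Icc a1 b1 ×ℂ Icc c d := fun z hz => hz.1
  have hgm : AEMeasurable (fun z => ‖g z‖ₑ) (volume.restrict E) :=
    ((hw.1.integrableOn_compact_subset hsub hBc).mono_set hEB).1.enorm
  have hwg : ∫⁻ z in E, ‖I * (g z - h z)‖ₑ ≤ 2 * ∫⁻ z in E, ‖g z‖ₑ := by
    rw [← lintegral_const_mul' _ _ (by norm_num)]
    refine lintegral_mono_ae ?_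
    filter_upwards [ae_restrict_of_ae_restrict_of_subset hER hae] with z hz
    rw [enorm_mul, show ‖I‖ₑ = 1 by rw [← ofReal_norm]; simp, one_mul]
    rw [← ofReal_norm, ← ofReal_norm, show (2 : ENNReal) = ENNReal.ofReal 2 by simp, ← ENNReal.ofReal_mul (by norm_num)]
    refine ENNReal.ofReal_le_ofReal ((norm_sub_le _ _).trans ?_)
    nlinarith [norm_nonneg (g z)]
  have hchain : (ENNReal.ofReal p * ENNReal.ofReal (b1 - a1)) ^ 2 ≤ 4 * (ENNReal.ofReal C * ENNReal.ofReal (π * (2 * p) ^ 2) * volume E) := by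
    have e0 : 2 * p - p = p := by ring
    rw [e0] at hlow
    calc (ENNReal.ofReal p * ENNReal.ofReal (b1 - a1)) ^ 2 ≤ (2 * ∫⁻ z in E, ‖g z‖ₑ) ^ 2 := pow_le_pow_left' (hlow.trans hwg) 2
      _ = 4 * (∫⁻ z in E, ‖g z‖ₑ) ^ 2 := by rw [mul_pow]; norm_num
      _ ≤ 4 * ((∫⁻ z in E, ‖g z‖ₑ ^ 2) * volume E) := by gcongr; exact sq_lintegral_le hgm
      _ ≤ _ := by gcongr; exact harea.trans (by gcongr)
  have e1 : (ENNReal.ofReal p * ENNReal.ofReal (b1 - a1)) ^ 2 = ENNReal.ofReal (p ^ 2) * ENNReal.ofReal ((b1 - a1) ^ 2) := by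
    rw [mul_pow, ENNReal.ofReal_pow hp.le, ENNReal.ofReal_pow (by linarith)]
  have e2 : 4 * (ENNReal.ofReal C * ENNReal.ofReal (π * (2 * p) ^ 2) * volume E) = ENNReal.ofReal (p ^ 2) * (ENNReal.ofReal (4 * C * (π * 4)) * volume E) := by
    rw [show (4 : ENNReal) = ENNReal.ofReal 4 by simp, ← mul_assoc, ← mul_assoc, ← ENNReal.ofReal_mul (by positivity), ← ENNReal.ofReal_mul (by positivity), ← mul_assoc (ENNReal.ofReal (p ^ 2)), ← ENNReal.ofReal_mul (by positivity)]
    congr 2; ring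
  rw [e1, e2] at hchain
  have hp2 : ENNReal.ofReal (p ^ 2) ≠ 0 := by
    rw [Ne, ENNReal.ofReal_eq_zero, not_le]; positivity
  exact (ENNReal.mul_le_mul_iff_right hp2 ENNReal.ofReal_ne_top).mp hchain

lemma box_volume (a1 b1 c d : ℝ) : volume (Icc a1 b1 ×ℂ Icc c d) = ENNReal.ofReal (b1 - a1) * ENNReal.ofReal (d - c) := by
  have h := Complex.volume_preserving_equiv_real_prod
  have : Icc a1 b1 ×ℂ Icc c d = Complex.measurableEquivRealProd ⁻¹' (Icc a1 b1 ×ˢ Icc c d) := by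
    ext z; rw [Complex.mem_reProdIm]; rfl
  rw [this, h.measure_preimage (measurableSet_Icc.prod measurableSet_Icc).nullMeasurableSet, Measure.volume_eq_prod, Measure.prod_prod, Real.volume_Icc, Real.volume_Icc]

lemma crossing_bound (k : ℝ) (hk0 : 0 ≤ k) (hk : k < 1) : ∃ K : ℝ, 0 < K ∧
    ∀ (a b a' b' : ℝ) (f g h : ℂ → ℂ), ContinuousOn f (Ioo a b ×ℂ Ioo a' b') →
    InjOn f (Ioo a b ×ℂ Ioo a' b') →
    HasDistribWirtingerDerivs (Ioo a b ×ℂ Ioo a' b') f g h →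
    (∀ᵐ z ∂(volume.restrict (Ioo a b ×ℂ Ioo a' b')), ‖h z‖ ≤ k * ‖g z‖) →
    ∀ a1 b1 c d : ℝ, a < a1 → 1 ≤ b1 - a1 → b1 < b → a' < c → c < d → d < b' → d - c ≤ π →
    ∀ (y : ℂ) (l L : ℝ), 0 < l →
    (∀ s ∈ Icc a1 b1, (‖f ⟨s, c⟩ - y‖ ≤ l ∧ L ≤ ‖f ⟨s, d⟩ - y‖) ∨ (‖f ⟨s, d⟩ - y‖ ≤ l ∧ L ≤ ‖f ⟨s, c⟩ - y‖)) →
    L ≤ K * l := by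
  obtain ⟨C, hC0, hC⟩ := crossing_area k hk0 hk
  obtain ⟨N, hN⟩ := exists_nat_gt (C * π)
  refine ⟨2 ^ N, by positivity, ?_⟩
  intro a b a' b' f g h hf hinj hw hae a1 b1 c d ha hab hb hac hcd hdb hdc y l L hl H
  by_contra hcon
  push Not at hcon
  have hstep : ∀ j ∈ Finset.range N, ENNReal.ofReal ((b1 - a1) ^ 2) ≤ ENNReal.ofReal C * volume (crossSet f a1 b1 c d y (2 ^ j * l) (2 * (2 ^ j * l))) := by
    intro j hj
    rw [Finset.mem_range] at hj
    have h1 : (1:ℝ) ≤ 2 ^ j := one_le_pow₀ (by norm_num)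
    have h2 : (2:ℝ) * 2 ^ j ≤ 2 ^ N := by
      rw [← pow_succ']
      exact pow_le_pow_right₀ (by norm_num) (by omega)
    have h3 : l ≤ 2 ^ j * l := by nlinarith
    have h4 : 2 * (2 ^ j * l) ≤ L := by nlinarith
    refine hC a b a' b' f g h hf hinj hw hae a1 b1 c d ha (by linarith) hb hac hcd hdb y _ (by positivity) ?_
    intro s hs
    rcases H s hs with h5 | h5
    · left; exact ⟨h5.1.trans h3, h4.trans h5.2⟩
    · right; exact ⟨h5.1.trans h3, h4.trans h5.2⟩
  have hsum := Finset.sum_le_sum hstep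
  rw [← Finset.mul_sum, Finset.sum_const, Finset.card_range] at hsum
  have hdisj : ∑ j ∈ Finset.range N, volume (crossSet f a1 b1 c d y (2 ^ j * l) (2 * (2 ^ j * l))) ≤ volume (Icc a1 b1 ×ℂ Icc c d) := by
    rw [← measure_biUnion_finset]
    · refine measure_mono ?_
      intro z hz
      simp only [mem_iUnion] at hz
      obtain ⟨j, _, hz⟩ := hz
      exact hz.1
    · have aux : ∀ i j : ℕ, i < j → Disjoint (crossSet f a1 b1 c d y (2 ^ i * l) (2 * (2 ^ i * l))) (crossSet f a1 b1 c d y (2 ^ j * l) (2 * (2 ^ j * l))) := by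
        intro i j hij
        rw [Set.disjoint_left]
        intro z hz1 hz2
        have h1 := hz1.2.2
        have h2 := hz2.2.1
        have h3 : (2:ℝ) * 2 ^ i ≤ 2 ^ j := by
          rw [← pow_succ']
          exact pow_le_pow_right₀ (by norm_num) (by omega)
        nlinarith
      intro i _ j _ hij
      rcases lt_or_gt_of_ne hij with h | h
      · exact aux i j h
      · exact (aux j i h).symm
    · intro j _
      have hm : MeasurableSet (crossSet f a1 b1 c d y (2 ^ j * l) (2 * (2 ^ j * l))) := by
        have hRo : IsOpen (Ioo a b ×ℂ Ioo a' b') := isOpen_Ioo.reProdIm isOpen_Ioo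
        have h1 : IsOpen ((Ioo a b ×ℂ Ioo a' b') ∩ (fun z => ‖f z - y‖) ⁻¹' Ioo (2 ^ j * l) (2 * (2 ^ j * l))) :=
          ((hf.sub continuousOn_const).norm).isOpen_inter_preimage hRo isOpen_Ioo
        have hBc : IsCompact (Icc a1 b1 ×ℂ Icc c d) := isCompact_Icc.reProdIm isCompact_Icc
        have h2 : crossSet f a1 b1 c d y (2 ^ j * l) (2 * (2 ^ j * l)) = (Icc a1 b1 ×ℂ Icc c d) ∩ ((Ioo a b ×ℂ Ioo a' b') ∩ (fun z => ‖f z - y‖) ⁻¹' Ioo (2 ^ j * l) (2 * (2 ^ j * l))) := by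
          ext z
          constructor
          · intro hz
            refine ⟨hz.1, ?_, hz.2⟩
            have hz := hz.1
            rw [Complex.mem_reProdIm] at hz ⊢
            exact ⟨⟨by linarith [hz.1.1], by linarith [hz.1.2]⟩, ⟨by linarith [hz.2.1], by linarith [hz.2.2]⟩⟩
          · intro hz; exact ⟨hz.1, hz.2.2⟩
        rw [h2]
        exact hBc.isClosed.measurableSet.inter h1.measurableSet
      exact hm
  have hfin := hsum.trans (by gcongr : _ ≤ ENNReal.ofReal C * volume (Icc a1 b1 ×ℂ Icc c d))
  rw [box_volume, nsmul_eq_mul, show (N : ENNReal) = ENNReal.ofReal N by simp, ← ENNReal.ofReal_mul (by positivity), ← ENNReal.ofReal_mul (by linarith), ← ENNReal.ofReal_mul hC0, ENNReal.ofReal_le_ofReal_iff (mul_nonneg hC0 (mul_nonneg (by linarith) (by linarith)))] at hfin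
  have hw0 : 0 < b1 - a1 := by linarith
  have h6 : N * (b1 - a1) ≤ C * (d - c) := by
    have : (N * (b1 - a1)) * (b1 - a1) ≤ (C * (d - c)) * (b1 - a1) := by nlinarith
    exact le_of_mul_le_mul_right this hw0
  have h7 : C * (d - c) ≤ C * π := mul_le_mul_of_nonneg_left hdc hC0
  have h8 : (N:ℝ) ≤ N * (b1 - a1) := by nlinarith [(Nat.cast_nonneg N : (0:ℝ) ≤ N)]
  linarith

lemma null_pullback {B N : Set ℂ} (hB : IsOpen B) {Ψ dΨ : ℂ → ℂ}
    (hΨ : ∀ z ∈ B, HasDerivAt Ψ (dΨ z) z) (hne : ∀ z ∈ B, dΨ z ≠ 0) (hinj : InjOn Ψ B)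
    (hN : volume N = 0) : volume (B ∩ Ψ ⁻¹' N) = 0 := by
  obtain ⟨-, hinv⟩ := holo_inverse hB hΨ hne hinj
  have h1 : B ∩ Ψ ⁻¹' N = (Function.invFunOn Ψ B) '' (Ψ '' (B ∩ Ψ ⁻¹' N)) := by
    rw [image_image]
    have : ∀ z ∈ B ∩ Ψ ⁻¹' N, Function.invFunOn Ψ B (Ψ z) = z := fun z hz =>
      hinj.leftInvOn_invFunOn hz.1
    rw [image_congr this]; simp
  rw [h1]
  refine addHaar_image_eq_zero_of_differentiableOn_of_addHaar_eq_zero volume ?_ ?_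
  · rintro _ ⟨z, hz, rfl⟩
    exact ((hinv z hz.1).differentiableAt.restrictScalars ℝ).differentiableWithinAt
  · refine measure_mono_null ?_ hN
    rintro _ ⟨z, hz, rfl⟩
    exact hz.2

/-- the logarithmic chart at the boundary point -/
noncomputable def bdChart (x0 : ℝ) (ζ : ℂ) : ℂ := Complex.exp (2 * π * I * (x0 + Complex.exp ζ))

lemma bdChart_hasDerivAt (x0 : ℝ) (ζ : ℂ) :
    HasDerivAt (bdChart x0) (bdChart x0 ζ * (2 * π * I * Complex.exp ζ)) ζ := by
  have h1 : HasDerivAt (fun ζ : ℂ => 2 * π * I * (x0 + Complex.exp ζ)) (2 * π * I * Complex.exp ζ) ζ :=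
    ((Complex.hasDerivAt_exp ζ).const_add _).const_mul _
  exact h1.cexp

lemma bdChart_ne (x0 : ℝ) (ζ : ℂ) : bdChart x0 ζ * (2 * π * I * Complex.exp ζ) ≠ 0 := by
  have : (π : ℂ) ≠ 0 := by exact_mod_cast Real.pi_ne_zero
  simp [bdChart, Complex.exp_ne_zero, Real.pi_ne_zero]

lemma bdChart_norm (x0 : ℝ) (ζ : ℂ) : ‖bdChart x0 ζ‖ = Real.exp (-(2 * π * (Complex.exp ζ).im)) := by
  rw [bdChart, Complex.norm_exp]
  congr 1
  simp

lemma bdChart_injOn (x0 a : ℝ) : InjOn (bdChart x0) (Ioo a (Real.log (1/2)) ×ℂ Ioo 0 π) := by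
  intro z hz w hw h
  rw [Complex.mem_reProdIm] at hz hw
  have hsmall : ∀ v : ℂ, v.re < Real.log (1/2) → |(Complex.exp v).re| < 1 / 2 := by
    intro v hv
    refine (Complex.abs_re_le_norm _).trans_lt ?_
    rw [Complex.norm_exp, ← Real.lt_log_iff_exp_lt (by norm_num)]
    exact hv
  have h1 := hsmall z hz.1.2
  have h2 := hsmall w hw.1.2
  rw [bdChart, bdChart, Complex.exp_eq_exp_iff_exists_int] at h
  obtain ⟨n, hn⟩ := h
  have hpi : (2 * π * I : ℂ) ≠ 0 := by simp [Real.pi_ne_zero]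
  have h3 : Complex.exp z = Complex.exp w + n := by
    have : 2 * π * I * (Complex.exp z) = 2 * π * I * (Complex.exp w + n) := by linear_combination hn
    exact mul_left_cancel₀ hpi this
  have h4 := congrArg Complex.re h3
  simp at h4
  rw [abs_lt] at h1 h2
  have h5 : (-1:ℝ) < n ∧ (n:ℝ) < 1 := ⟨by linarith, by linarith⟩
  have h6 : n = 0 := by
    have a1 : -1 < n := by exact_mod_cast h5.1
    have a2 : n < 1 := by exact_mod_cast h5.2
    omega
  rw [h6] at h3
  simp only [Int.cast_zero, add_zero] at h3
  exact Complex.exp_inj_of_neg_pi_lt_of_le_pi (by linarith [hz.2.1, Real.pi_pos]) hz.2.2.le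
    (by linarith [hw.2.1, Real.pi_pos]) hw.2.2.le h3

lemma main_bound (k : ℝ) (hk0 : 0 ≤ k) (hk : k < 1) : ∃ K : ℝ, 0 < K ∧
    ∀ (F g h : ℂ → ℂ) (ηt : ℝ → ℝ), ContinuousOn F (closedBall 0 1) → InjOn F (ball 0 1) →
    HasDistribWirtingerDerivs (ball 0 1) F g h →
    (∀ᵐ z ∂(volume.restrict (ball (0:ℂ) 1)), ‖h z‖ ≤ k * ‖g z‖) →
    (∀ x : ℝ, F (Complex.exp (2 * π * I * x)) = Complex.exp (2 * π * I * ηt x)) →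
    ∀ (x0 r : ℝ) (y : ℂ) (l L : ℝ), 0 < r → 3 * r < 1 / 2 → 0 < l → 
    (∀ u ∈ Icc r (3 * r),
      (‖Complex.exp (2 * π * I * ηt (x0 + u)) - y‖ ≤ l ∧ L ≤ ‖Complex.exp (2 * π * I * ηt (x0 - u)) - y‖) ∨
      (‖Complex.exp (2 * π * I * ηt (x0 - u)) - y‖ ≤ l ∧ L ≤ ‖Complex.exp (2 * π * I * ηt (x0 + u)) - y‖)) →
    L ≤ K * l := by
  obtain ⟨K, hK, H⟩ := crossing_bound k hk0 hk
  refine ⟨4 * K, by positivity, ?_⟩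
  intro F g h ηt hF hinj hw hae hbd x0 r y l L hr hr3 hl hyp
  by_cases hL : L ≤ 0
  · exact hL.trans (by positivity)
  push Not at hL
  set a1 := Real.log r with ha1
  set b1 := Real.log (3 * r) with hb1
  have hb1lt : b1 < Real.log (1/2) := Real.log_lt_log (by linarith) hr3
  have hlog3 : b1 - a1 = Real.log 3 := by
    rw [hb1, ha1, Real.log_mul (by norm_num) hr.ne']; ring
  have h13 : 1 ≤ b1 - a1 := by
    rw [hlog3, Real.le_log_iff_exp_le (by norm_num)]
    linarith [Real.exp_one_lt_d9]
  set a := a1 - 1 with ha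
  set b := Real.log (1/2) with hb
  set R := Ioo a b ×ℂ Ioo 0 π with hR
  have hRo : IsOpen R := isOpen_Ioo.reProdIm isOpen_Ioo
  have hmap : MapsTo (bdChart x0) R (ball 0 1) := by
    intro z hz
    rw [hR, Complex.mem_reProdIm] at hz
    rw [mem_ball_zero_iff, bdChart_norm, Real.exp_lt_one_iff, Complex.exp_im]
    have : 0 < Real.sin z.im := Real.sin_pos_of_pos_of_lt_pi hz.2.1 hz.2.2
    have := Real.exp_pos z.re
    have := Real.pi_pos
    have : 0 < 2 * π * (Real.exp z.re * Real.sin z.im) := by positivity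
    linarith
  have hmapc : MapsTo (bdChart x0) (Icc a1 b1 ×ℂ Icc 0 π) (closedBall 0 1) := by
    intro z hz
    rw [Complex.mem_reProdIm] at hz
    rw [mem_closedBall_zero_iff, bdChart_norm, Real.exp_le_one_iff, Complex.exp_im]
    have : 0 ≤ Real.sin z.im := Real.sin_nonneg_of_nonneg_of_le_pi hz.2.1 hz.2.2
    have := Real.exp_pos z.re
    have := Real.pi_pos
    have : 0 ≤ 2 * π * (Real.exp z.re * Real.sin z.im) := by positivity
    linarith
  have hΨinj := bdChart_injOn x0 a
  have hΨc : Continuous (bdChart x0) := continuous_iff_continuousAt.mpr fun z => (bdChart_hasDerivAt x0 z).continuousAt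
  have hw2 := conformal_transfer isOpen_ball hRo (fun z _ => bdChart_hasDerivAt x0 z) (fun z _ => bdChart_ne x0 z)
    hΨinj (by fun_prop) hmap hw
  have hae2 : ∀ᵐ z ∂(volume.restrict R), ‖h (bdChart x0 z) * conj (bdChart x0 z * (2 * π * I * Complex.exp z))‖
      ≤ k * ‖g (bdChart x0 z) * (bdChart x0 z * (2 * π * I * Complex.exp z))‖ := by
    rw [ae_restrict_iff' measurableSet_ball] at hae
    rw [ae_restrict_iff' hRo.measurableSet]
    have hnull := null_pullback hRo (fun z _ => bdChart_hasDerivAt x0 z) (fun z _ => bdChart_ne x0 z) hΨinj (ae_iff.mp hae)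
    rw [ae_iff]
    refine measure_mono_null ?_ hnull
    intro z hz
    simp only [mem_ofPred_eq, Classical.not_imp] at hz
    refine ⟨hz.1, ?_⟩
    simp only [mem_preimage, mem_ofPred_eq, Classical.not_imp]
    refine ⟨hmap hz.1, fun hcon => hz.2 ?_⟩
    rw [norm_mul, norm_mul (g _), RCLike.norm_conj, ← mul_assoc k]
    exact mul_le_mul_of_nonneg_right hcon (norm_nonneg (_ : ℂ))
  set Φ : ℂ → ℂ := fun z => F (bdChart x0 z) with hΦ
  have hΦc : ContinuousOn Φ R := (hF.mono ball_subset_closedBall).comp hΨc.continuousOn hmap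
  have hΦinj : InjOn Φ R := by
    intro z hz w hw' hzw
    exact hΨinj hz hw' (hinj (hmap hz) (hmap hw') hzw)
  have hΦcc : ContinuousOn Φ (Icc a1 b1 ×ℂ Icc 0 π) := hF.comp hΨc.continuousOn hmapc
  have hBc : IsCompact (Icc a1 b1 ×ℂ Icc 0 π) := isCompact_Icc.reProdIm isCompact_Icc
  have hu := hBc.uniformContinuousOn_of_continuous hΦcc
  rw [Metric.uniformContinuousOn_iff] at hu
  obtain ⟨δ, hδ, hu⟩ := hu (min l (L / 2)) (lt_min hl (by linarith))
  set c := min (δ / 2) 1 with hc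
  have hc0 : 0 < c := lt_min (by linarith) one_pos
  have hc1 : c ≤ 1 := min_le_right _ _
  have hcδ : c < δ := (min_le_left _ _).trans_lt (by linarith)
  have hpi3 := Real.pi_gt_three
  have hv0 : ∀ s : ℝ, Φ ⟨s, 0⟩ = Complex.exp (2 * π * I * ηt (x0 + Real.exp s)) := by
    intro s
    simp only [hΦ, bdChart]
    rw [← hbd]
    congr 3
    rw [show (⟨s, 0⟩ : ℂ) = (s : ℂ) from rfl]
    push_cast; ring
  have hvpi : ∀ s : ℝ, Φ ⟨s, π⟩ = Complex.exp (2 * π * I * ηt (x0 - Real.exp s)) := by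
    intro s
    simp only [hΦ, bdChart]
    rw [← hbd]
    congr 3
    rw [show (⟨s, π⟩ : ℂ) = (s : ℂ) + π * I from Complex.mk_eq_add_mul_I _ _, Complex.exp_add, Complex.exp_pi_mul_I]
    push_cast; ring
  have hd0 : ∀ s ∈ Icc a1 b1, ‖Φ ⟨s, c⟩ - Φ ⟨s, 0⟩‖ < min l (L / 2) := by
    intro s hs
    rw [← dist_eq_norm]
    refine hu _ ?_ _ ?_ ?_
    · rw [Complex.mem_reProdIm]; exact ⟨hs, hc0.le, by linarith⟩
    · rw [Complex.mem_reProdIm]; exact ⟨hs, le_rfl, by linarith⟩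
    · rw [Complex.dist_of_re_eq (by rfl), Real.dist_eq]
      show |c - 0| < δ
      rw [sub_zero, abs_of_pos hc0]; exact hcδ
  have hdpi : ∀ s ∈ Icc a1 b1, ‖Φ ⟨s, π - c⟩ - Φ ⟨s, π⟩‖ < min l (L / 2) := by
    intro s hs
    rw [← dist_eq_norm]
    refine hu _ ?_ _ ?_ ?_
    · rw [Complex.mem_reProdIm]; exact ⟨hs, by show 0 ≤ π - c; linarith, by show π - c ≤ π; linarith⟩
    · rw [Complex.mem_reProdIm]; exact ⟨hs, by show 0 ≤ π; linarith, le_rfl⟩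
    · rw [Complex.dist_of_re_eq (by rfl), Real.dist_eq]
      show |π - c - π| < δ
      rw [show π - c - π = -c by ring, abs_neg, abs_of_pos hc0]; exact hcδ
  have hml := min_le_left l (L / 2)
  have hmL := min_le_right l (L / 2)
  have hup : ∀ u v : ℂ, ‖u - v‖ < min l (L / 2) → ‖v - y‖ ≤ l → ‖u - y‖ ≤ 2 * l := by
    intro u v h1 h2
    have := norm_add_le (u - v) (v - y)
    rw [sub_add_sub_cancel] at this
    linarith
  have hlo : ∀ u v : ℂ, ‖u - v‖ < min l (L / 2) → L ≤ ‖v - y‖ → L / 2 ≤ ‖u - y‖ := by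
    intro u v h1 h2
    have := norm_add_le (v - u) (u - y)
    rw [sub_add_sub_cancel, norm_sub_rev v u] at this
    linarith
  have hfin := H a b 0 π Φ _ _ hΦc hΦinj hw2 hae2 a1 b1 c (π - c) (by linarith) h13 hb1lt hc0 (by linarith) (by linarith)
    (by linarith) y (2 * l) (L / 2) (by linarith) (by
      intro s hs
      have hsr : Real.exp s ∈ Icc r (3 * r) := by
        constructor
        · rw [← Real.log_le_iff_le_exp hr]; exact hs.1
        · rw [← Real.le_log_iff_exp_le (by linarith)]; exact hs.2
      have h0 := hd0 s hs
      have hp := hdpi s hs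
      rw [hv0] at h0
      rw [hvpi] at hp
      rcases hyp _ hsr with h5 | h5
      · left; exact ⟨hup _ _ h0 h5.1, hlo _ _ hp h5.2⟩
      · right; exact ⟨hup _ _ hp h5.1, hlo _ _ h0 h5.2⟩)
  linarith

lemma lift_cont {η : ℝ → ℝ} (h : IsCircleLift η) : Continuous η :=
  h.1.monotone.continuous_of_surjective h.2.1

lemma lift_add_int {η : ℝ → ℝ} (h : IsCircleLift η) (x : ℝ) (n : ℤ) : η (x + n) = η x + n := by
  induction n using Int.induction_on with
  | zero => simp
  | succ i ih =>
    push_cast at ih ⊢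
    rw [← add_assoc, h.2.2, ih]; ring
  | pred i ih =>
    push_cast at ih ⊢
    have := h.2.2 (x + (-(i:ℝ) - 1))
    rw [show x + (-(i:ℝ) - 1) + 1 = x + -(i:ℝ) by ring, ih] at this
    linarith

lemma lift_gap {η : ℝ → ℝ} (h : IsCircleLift η) : ∃ c0 : ℝ, 0 < c0 ∧ c0 ≤ 1 ∧ ∀ x, c0 ≤ η (x + 1 / 8) - η x := by
  have hc := lift_cont h
  obtain ⟨x0, hx0, hmin⟩ := (isCompact_Icc (a := (0:ℝ)) (b := 1)).exists_isMinOn ⟨0, by simp⟩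
    (f := fun x => η (x + 1 / 8) - η x) (by fun_prop)
  have hpos : 0 < η (x0 + 1 / 8) - η x0 := sub_pos.mpr (h.1 (by linarith))
  refine ⟨η (x0 + 1 / 8) - η x0, hpos, ?_, ?_⟩
  · have : η (x0 + 1 / 8) ≤ η (x0 + 1) := h.1.monotone (by linarith)
    rw [h.2.2] at this; linarith
  · intro x
    have h1 : Int.fract x ∈ Icc (0:ℝ) 1 := ⟨Int.fract_nonneg x, (Int.fract_lt_one x).le⟩
    have h2 := hmin h1
    simp only [mem_ofPred_eq] at h2
    have h3 := lift_add_int h (Int.fract x) ⌊x⌋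
    have h4 := lift_add_int h (Int.fract x + 1 / 8) ⌊x⌋
    rw [Int.fract_add_floor] at h3
    rw [show Int.fract x + 1 / 8 + (⌊x⌋ : ℝ) = x + 1 / 8 by rw [add_right_comm, Int.fract_add_floor]] at h4
    rw [h3, h4]; linarith

lemma norm_E_sub (a b : ℝ) : ‖Complex.exp (2 * π * I * a) - Complex.exp (2 * π * I * b)‖ = 2 * |Real.sin (π * (a - b))| := by
  have h1 : Complex.exp (2 * π * I * a) - Complex.exp (2 * π * I * b)
      = Complex.exp ((2 * π * b : ℝ) * I) * (Complex.exp (I * (2 * π * (a - b) : ℝ)) - 1) := by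
    rw [mul_sub, ← Complex.exp_add, mul_one]
    congr 1
    · congr 1; push_cast; ring
    · congr 1; push_cast; ring
  rw [h1, norm_mul, Complex.norm_exp_ofReal_mul_I, one_mul, Complex.norm_exp_I_mul_ofReal_sub_one, Real.norm_eq_abs, abs_mul]
  congr 2
  · norm_num
  · congr 1; ring

lemma norm_E_sub_le (a b : ℝ) : ‖Complex.exp (2 * π * I * a) - Complex.exp (2 * π * I * b)‖ ≤ 2 * π * |a - b| := by
  rw [norm_E_sub]
  have := Real.abs_sin_le_abs (x := π * (a - b))
  rw [abs_mul, abs_of_pos Real.pi_pos] at this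
  linarith

lemma norm_E_sub_ge {a b A c : ℝ} (hA0 : 0 < A) (hA1 : A ≤ 1) (hc0 : 0 < c) (hc1 : c ≤ 1) (h1 : A ≤ a - b) (h2 : a - b ≤ 1 - c) :
    4 * c * A ≤ ‖Complex.exp (2 * π * I * a) - Complex.exp (2 * π * I * b)‖ := by
  rw [norm_E_sub]
  set D := a - b with hD
  have hpi := Real.pi_pos
  have key : ∀ x, 0 ≤ x → x ≤ 1 / 2 → 2 * x ≤ Real.sin (π * x) := by
    intro x h0 h1
    have := Real.mul_le_sin (x := π * x) (by positivity) (by nlinarith)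
    rwa [show 2 / π * (π * x) = 2 * x by field_simp] at this
  have h3 := le_abs_self (Real.sin (π * D))
  by_cases hD2 : D ≤ 1 / 2
  · have := key D (by linarith) hD2
    nlinarith
  · push Not at hD2
    have := key (1 - D) (by linarith) (by linarith)
    rw [show π * (1 - D) = π - π * D by ring, Real.sin_pi_sub] at this
    nlinarith

theorem qs_of_ext (ηt : ℝ → ℝ) (hlift : IsCircleLift ηt) (F : ℂ → ℂ)
    (hF : ContinuousOn F (closure unitDisc)) (hbij : BijOn F unitDisc unitDisc)
    (hqc : QuasiconformalOn unitDisc F)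
    (hbd : ∀ x : ℝ, F (Complex.exp (2 * Real.pi * Complex.I * x)) =
        Complex.exp (2 * Real.pi * Complex.I * ηt x)) : ∃ M : ℝ, QSConst ηt M := by
  obtain ⟨k, hk0, hk, g, h, hw, hae⟩ := hqc
  obtain ⟨K, hK, H⟩ := main_bound k hk0 hk
  have hF' : ContinuousOn F (closedBall 0 1) := by
    rw [unitDisc, closure_ball (0:ℂ) one_ne_zero] at hF; exact hF
  have H := H F g h ηt hF' hbij.injOn hw hae hbd
  obtain ⟨c0, hc0, hc1, hgap⟩ := lift_gap hlift
  have hmono := hlift.1.monotone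
  have hper := hlift.2.2
  have hpi := Real.pi_pos
  have hsmall : ∀ u v, u ≤ v → v ≤ u + 7 / 8 → ηt v - ηt u ≤ 1 - c0 := by
    intro u v h1 h2
    have h3 := hmono h2
    have h4 := hgap (u + 7 / 8)
    rw [show u + 7 / 8 + 1 / 8 = u + 1 by ring, hper] at h4
    linarith
  set M := max (K * π / (2 * c0)) (1 / c0) with hM
  have hM0 : 0 < M := lt_of_lt_of_le (by positivity) (le_max_right _ _)
  have hM1 := le_max_left (K * π / (2 * c0)) (1 / c0)
  have hM2 := le_max_right (K * π / (2 * c0)) (1 / c0)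
  have key : ∀ x t : ℝ, 0 < t → t ≤ 1 / 2 → ηt (x + t) - ηt x ≤ M * (ηt x - ηt (x - t)) ∧
      ηt x - ηt (x - t) ≤ M * (ηt (x + t) - ηt x) := by
    intro x t ht ht2
    set A := ηt (x + t) - ηt x with hA
    set B := ηt x - ηt (x - t) with hB
    have hA0 : 0 < A := sub_pos.mpr (hlift.1 (by linarith))
    have hB0 : 0 < B := sub_pos.mpr (hlift.1 (by linarith))
    have hA1 : A ≤ 1 := by
      have := hmono (show x + t ≤ x + 1 by linarith)
      rw [hper] at this; linarith
    have hB1 : B ≤ 1 := by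
      have := hmono (show x - 1 ≤ x - t by linarith)
      have h2 := hper (x - 1)
      rw [sub_add_cancel] at h2; linarith
    by_cases ht8 : t ≤ 1 / 8
    · have trans : ∀ P Q : ℝ, 0 < Q → 4 * c0 * P ≤ K * (2 * π * Q) → P ≤ M * Q := by
        intro P Q hQ hPQ
        have : P ≤ (K * π / (2 * c0)) * Q := by
          rw [div_mul_eq_mul_div, le_div_iff₀ (by positivity)]
          linarith
        exact this.trans (mul_le_mul_of_nonneg_right hM1 hQ.le)
      constructor
      · refine trans A B hB0 ?_
        refine H (x + t / 2) (t / 2) (Complex.exp (2 * π * I * ηt x)) (2 * π * B) (4 * c0 * A) (by linarith) (by linarith) (by positivity) ?_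
        intro u hu
        right
        constructor
        · refine (norm_E_sub_le _ _).trans ?_
          have h1 := hmono (show x + t / 2 - u ≤ x by linarith [hu.1])
          have h2 := hmono (show x - t ≤ x + t / 2 - u by linarith [hu.2])
          rw [abs_sub_comm, abs_of_nonneg (by linarith)]
          exact mul_le_mul_of_nonneg_left (by linarith) (by positivity)
        · refine norm_E_sub_ge hA0 hA1 hc0 hc1 ?_ ?_
          · have h1 := hmono (show x + t ≤ x + t / 2 + u by linarith [hu.1])
            linarith
          · exact hsmall _ _ (by linarith [hu.1]) (by linarith [hu.2])
      · refine trans B A hA0 ?_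
        refine H (x - t / 2) (t / 2) (Complex.exp (2 * π * I * ηt x)) (2 * π * A) (4 * c0 * B) (by linarith) (by linarith) (by positivity) ?_
        intro u hu
        left
        constructor
        · refine (norm_E_sub_le _ _).trans ?_
          have h1 := hmono (show x ≤ x - t / 2 + u by linarith [hu.1])
          have h2 := hmono (show x - t / 2 + u ≤ x + t by linarith [hu.2])
          rw [abs_of_nonneg (by linarith)]
          exact mul_le_mul_of_nonneg_left (by linarith) (by positivity)
        · rw [norm_sub_rev]
          refine norm_E_sub_ge hB0 hB1 hc0 hc1 ?_ ?_
          · have h1 := hmono (show x - t / 2 - u ≤ x - t by linarith [hu.1])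
            linarith
          · exact hsmall _ _ (by linarith [hu.1]) (by linarith [hu.2])
    · push Not at ht8
      have hAc : c0 ≤ A := by
        have h1 := hmono (show x + 1 / 8 ≤ x + t by linarith)
        have := hgap x; linarith
      have hBc : c0 ≤ B := by
        have h1 := hmono (show x - t ≤ x - 1 / 8 by linarith)
        have := hgap (x - 1 / 8)
        rw [sub_add_cancel] at this; linarith
      have trans : ∀ P Q : ℝ, P ≤ 1 → c0 ≤ Q → P ≤ M * Q := by
        intro P Q hP hQ
        have : 1 / c0 * c0 = 1 := by field_simp
        have h2 : 1 / c0 * c0 ≤ M * Q := mul_le_mul hM2 hQ hc0.le hM0.le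
        linarith
      exact ⟨trans A B hA1 hBc, trans B A hB1 hAc⟩
  refine ⟨M, hM0, fun x t ht ht2 => ?_⟩
  obtain ⟨h1, h2⟩ := key x t ht ht2
  have hB0 : 0 < ηt x - ηt (x - t) := sub_pos.mpr (hlift.1 (by linarith))
  constructor
  · rw [div_le_div_iff₀ hM0 hB0]; linarith
  · rw [div_le_iff₀ hB0]; exact h1

/-- average of `η` over the segment from `x` to `x + y` -/
noncomputable def avg (η : ℝ → ℝ) (x y : ℝ) : ℝ := ∫ t in (0:ℝ)..1, η (x + t * y)

lemma avg_continuous {η : ℝ → ℝ} (hη : Continuous η) : Continuous (fun p : ℝ × ℝ => avg η p.1 p.2) := by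
  unfold avg
  refine intervalIntegral.continuous_parametric_intervalIntegral_of_continuous' ?_ 0 1
  fun_prop

lemma avg_zero (η : ℝ → ℝ) (x : ℝ) : avg η x 0 = η x := by simp [avg]

lemma avg_int {η : ℝ → ℝ} (hη : Continuous η) (x : ℝ) {y : ℝ} (hy : y ≠ 0) :
    avg η x y = ((∫ t in (0:ℝ)..(x + y), η t) - ∫ t in (0:ℝ)..x, η t) / y := by
  have h1 := intervalIntegral.integral_comp_add_mul (a := 0) (b := 1) η hy x
  simp only [mul_comm y] at h1
  rw [avg, h1]
  simp only [mul_one, zero_mul, one_mul, mul_zero, add_zero, smul_eq_mul]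
  rw [intervalIntegral.integral_interval_sub_left (hη.intervalIntegrable _ _) (hη.intervalIntegrable _ _)]
  field_simp

lemma avg_strict {η : ℝ → ℝ} (hη : Continuous η) (x : ℝ) {y : ℝ} (hy : y ≠ 0) :
    HasStrictFDerivAt (fun p : ℝ × ℝ => avg η p.1 p.2)
      (((η (x + y) - η x) / y) • ContinuousLinearMap.fst ℝ ℝ ℝ + ((η (x + y) - avg η x y) / y) • ContinuousLinearMap.snd ℝ ℝ ℝ) (x, y) := by
  set P : ℝ → ℝ := fun x => ∫ t in (0:ℝ)..x, η t with hP
  have hPd : ∀ x, HasStrictDerivAt P (η x) x := fun x =>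
    intervalIntegral.integral_hasStrictDerivAt_right (hη.intervalIntegrable _ _) (hη.stronglyMeasurableAtFilter _ _) hη.continuousAt
  have h1 : HasStrictFDerivAt (fun p : ℝ × ℝ => P (p.1 + p.2)) (η (x + y) • (ContinuousLinearMap.fst ℝ ℝ ℝ + ContinuousLinearMap.snd ℝ ℝ ℝ)) (x, y) :=
    HasStrictDerivAt.comp_hasStrictFDerivAt (x := (x, y)) (f := fun p : ℝ × ℝ => p.1 + p.2) (hPd (x + y)) (hasStrictFDerivAt_fst.fun_add hasStrictFDerivAt_snd)
  have h2 : HasStrictFDerivAt (fun p : ℝ × ℝ => P p.1) (η x • ContinuousLinearMap.fst ℝ ℝ ℝ) (x, y) :=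
    HasStrictDerivAt.comp_hasStrictFDerivAt (x := (x, y)) (f := Prod.fst) (hPd x) hasStrictFDerivAt_fst
  have h3 : HasStrictFDerivAt (fun p : ℝ × ℝ => (p.2)⁻¹) ((-(y ^ 2)⁻¹) • ContinuousLinearMap.snd ℝ ℝ ℝ) (x, y) :=
    HasStrictDerivAt.comp_hasStrictFDerivAt (x := (x, y)) (f := Prod.snd) (hasStrictDerivAt_inv hy) hasStrictFDerivAt_snd
  have h4 := (h1.sub h2).mul h3
  refine (h4.congr_of_eventuallyEq ?_).congr_fderiv ?_
  · have : ∀ᶠ p : ℝ × ℝ in 𝓝 (x, y), p.2 ≠ 0 := continuous_snd.continuousAt.eventually_ne hy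
    filter_upwards [this] with p hp
    rw [avg_int hη _ hp]
    simp only [Pi.mul_apply, Pi.sub_apply, hP, div_eq_mul_inv]
  · rw [avg_int hη x hy]
    ext <;> simp [hP] <;> field_simp
    ring

lemma avg_lt {η : ℝ → ℝ} (hη : Continuous η) (hm : StrictMono η) {x1 y1 x2 y2 : ℝ} (h1 : x1 ≤ x2)
    (h2 : x1 + y1 ≤ x2 + y2) (h3 : x1 < x2 ∨ x1 + y1 < x2 + y2) : avg η x1 y1 < avg η x2 y2 := by
  unfold avg
  refine intervalIntegral.integral_lt_integral_of_continuousOn_of_le_of_exists_lt one_pos (by fun_prop) (by fun_prop) ?_ ?_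
  · intro t ht
    apply hm.monotone
    nlinarith [mul_nonneg ht.1.le (sub_nonneg.mpr h2), mul_nonneg (sub_nonneg.mpr ht.2) (sub_nonneg.mpr h1)]
  · rcases h3 with h | h
    · exact ⟨0, by simp, hm (by linarith)⟩
    · exact ⟨1, by simp, hm (by linarith)⟩

lemma avg_add_one {η : ℝ → ℝ} (h : IsCircleLift η) (x y : ℝ) : avg η (x + 1) y = avg η x y + 1 := by
  have hη := lift_cont h
  unfold avg
  have : ∀ t, η (x + 1 + t * y) = η (x + t * y) + 1 := fun t => by
    rw [← h.2.2]; congr 1; ring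
  simp_rw [this]
  rw [intervalIntegral.integral_add (Continuous.intervalIntegrable (by fun_prop) _ _) (by simp)]
  simp

lemma avg_asymp {η : ℝ → ℝ} (h : IsCircleLift η) : ∃ m C : ℝ, 0 ≤ C ∧ ∀ x y : ℝ, y ≠ 0 →
    |avg η x y - x - y / 2 - m| ≤ C / |y| := by
  have hη := lift_cont h
  set P : ℝ → ℝ := fun x => ∫ t in (0:ℝ)..x, η t with hP
  have hPd : ∀ x, HasDerivAt P (η x) x := fun x =>
    intervalIntegral.integral_hasDerivAt_right (hη.intervalIntegrable _ _) (hη.stronglyMeasurableAtFilter _ _) hη.continuousAt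
  set m := P 1 - 1 / 2 with hm
  set Q : ℝ → ℝ := fun x => P x - x ^ 2 / 2 - m * x with hQ
  have hQd : ∀ x, HasDerivAt Q (η x - x - m) x := by
    intro x
    have h1 : HasDerivAt (fun x : ℝ => x ^ 2 / 2) x x := by
      have := (hasDerivAt_pow 2 x).div_const 2
      exact this.congr_deriv (by norm_num)
    have h2 : HasDerivAt (fun x : ℝ => m * x) m x := by
      simpa using (hasDerivAt_id x).const_mul m
    exact ((hPd x).sub h1).sub h2
  have hQc : Continuous Q := continuous_iff_continuousAt.mpr fun x => (hQd x).continuousAt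
  have hper : Function.Periodic Q 1 := by
    have hd : ∀ x, HasDerivAt (fun x => Q (x + 1) - Q x) 0 x := by
      intro x
      have h1 : HasDerivAt (fun x => Q (x + 1)) (η (x + 1) - (x + 1) - m) x := (hQd (x + 1)).comp_add_const x 1
      have := h1.sub (hQd x)
      exact this.congr_deriv (by rw [h.2.2]; ring)
    have hconst := is_const_of_deriv_eq_zero (fun x => (hd x).differentiableAt) (fun x => (hd x).deriv)
    intro x
    have := hconst x 0
    simp only [hQ, hm, hP] at this ⊢
    simp at this
    linarith
  obtain ⟨C, hC⟩ := (isCompact_Icc (a := (0:ℝ)) (b := 1)).exists_bound_of_continuousOn hQc.continuousOn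
  have hCx : ∀ x, |Q x| ≤ C := by
    intro x
    have h1 : Q (Int.fract x) = Q x := by
      have := hper.sub_zsmul_eq (x := x) ⌊x⌋
      rw [← this]; congr 1; simp
    rw [← h1]
    exact hC _ ⟨Int.fract_nonneg x, (Int.fract_lt_one x).le⟩
  refine ⟨m, 2 * C, by linarith [(abs_nonneg _).trans (hCx 0)], ?_⟩
  intro x y hy
  have : avg η x y - x - y / 2 - m = (Q (x + y) - Q x) / y := by
    rw [avg_int hη x hy]
    simp only [hQ, hP]
    field_simp
    ring
  rw [this, abs_div]
  gcongr
  have h1 := abs_sub (Q (x + y)) (Q x)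
  linarith [hCx (x + y), hCx x]

/-- Global quasisymmetry: both-sided comparability of adjacent increments. -/
def GQS (η : ℝ → ℝ) (N : ℝ) : Prop := 1 ≤ N ∧ ∀ x y : ℝ, 0 < y →
  η (x + y) - η x ≤ N * (η x - η (x - y)) ∧ η x - η (x - y) ≤ N * (η (x + y) - η x)

lemma lift_upper {η : ℝ → ℝ} (h : IsCircleLift η) (x y : ℝ) : η (x + y) - η x ≤ y + 1 := by
  have h1 : η (x + y) ≤ η (x + (⌈y⌉ : ℤ)) := h.1.monotone (by linarith [Int.le_ceil y])
  rw [lift_add_int h] at h1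
  linarith [Int.ceil_lt_add_one y]

lemma lift_lower {η : ℝ → ℝ} (h : IsCircleLift η) (x y : ℝ) : y - 1 ≤ η (x + y) - η x := by
  have h1 : η (x + (⌊y⌋ : ℤ)) ≤ η (x + y) := h.1.monotone (by linarith [Int.floor_le y])
  rw [lift_add_int h] at h1
  linarith [Int.lt_floor_add_one y]

lemma gqs_of_qs {η : ℝ → ℝ} (h : IsCircleLift η) {M : ℝ} (hq : QSConst η M) : GQS η (3 * (M + 1)) := by
  obtain ⟨hM, hq⟩ := hq
  have small : ∀ x y : ℝ, 0 < y → y ≤ 1 / 2 →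
      η (x + y) - η x ≤ M * (η x - η (x - y)) ∧ η x - η (x - y) ≤ M * (η (x + y) - η x) := by
    intro x y hy hy2
    obtain ⟨h1, h2⟩ := hq x y hy hy2
    have hB : 0 < η x - η (x - y) := sub_pos.mpr (h.1 (by linarith))
    rw [div_le_iff₀ hB] at h2
    rw [div_le_div_iff₀ hM hB] at h1
    exact ⟨h2, by linarith⟩
  refine ⟨by linarith, fun x y hy => ?_⟩
  have hB : 0 < η x - η (x - y) := sub_pos.mpr (h.1 (by linarith))
  have hA : 0 < η (x + y) - η x := sub_pos.mpr (h.1 (by linarith))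
  by_cases hy2 : y ≤ 1 / 2
  · obtain ⟨h1, h2⟩ := small x y hy hy2
    constructor <;> nlinarith
  push Not at hy2
  obtain ⟨h1, h2⟩ := small x (1 / 2) (by norm_num) le_rfl
  have h3 : η (x + 1 / 2) = η (x - 1 / 2) + 1 := by rw [← h.2.2]; congr 1; ring
  have h4 : η (x + 1 / 2) ≤ η (x + y) := h.1.monotone (by linarith)
  have h5 : η (x - y) ≤ η (x - 1 / 2) := h.1.monotone (by linarith)
  have hA1 : 1 ≤ (M + 1) * (η (x + y) - η x) := by nlinarith
  have hB1 : 1 ≤ (M + 1) * (η x - η (x - y)) := by nlinarith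
  have e : x - y + y = x := by ring
  by_cases hy3 : y ≤ 2
  · have h6 := lift_upper h x y
    have h7 := lift_upper h (x - y) y
    rw [e] at h7
    constructor <;> nlinarith
  · push Not at hy3
    have h6 := lift_upper h x y
    have h7 := lift_upper h (x - y) y
    have h8 := lift_lower h x y
    have h9 := lift_lower h (x - y) y
    rw [e] at h7 h9
    constructor <;> nlinarith

lemma avg_bd {η : ℝ → ℝ} (hη : Continuous η) (hm : StrictMono η) (x : ℝ) {y : ℝ} (hy : 0 < y) :
    avg η x y ≤ (η (x + y / 2) + η (x + y)) / 2 := by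
  unfold avg
  have hi : ∀ a b, IntervalIntegrable (fun t => η (x + t * y)) volume a b := fun a b =>
    Continuous.intervalIntegrable (by fun_prop) _ _
  rw [← intervalIntegral.integral_add_adjacent_intervals (hi 0 (1/2)) (hi (1/2) 1)]
  have h1 : (∫ t in (0:ℝ)..(1/2), η (x + t * y)) ≤ ∫ t in (0:ℝ)..(1/2), η (x + y / 2) :=
    intervalIntegral.integral_mono_on (by norm_num) (hi _ _) (by simp) fun t ht => hm.monotone (by nlinarith [ht.2])
  have h2 : (∫ t in (1/2:ℝ)..1, η (x + t * y)) ≤ ∫ t in (1/2:ℝ)..1, η (x + y) :=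
    intervalIntegral.integral_mono_on (by norm_num) (hi _ _) (by simp) fun t ht => hm.monotone (by nlinarith [ht.2])
  simp only [intervalIntegral.integral_const, smul_eq_mul] at h1 h2
  linarith

lemma avg_bd' {η : ℝ → ℝ} (hη : Continuous η) (hm : StrictMono η) (x : ℝ) {y : ℝ} (hy : 0 < y) :
    (η (x - y / 2) + η (x - y)) / 2 ≤ avg η x (-y) := by
  unfold avg
  have hi : ∀ a b, IntervalIntegrable (fun t => η (x + t * -y)) volume a b := fun a b =>
    Continuous.intervalIntegrable (by fun_prop) _ _
  rw [← intervalIntegral.integral_add_adjacent_intervals (hi 0 (1/2)) (hi (1/2) 1)]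
  have h1 : (∫ t in (0:ℝ)..(1/2), η (x - y / 2)) ≤ ∫ t in (0:ℝ)..(1/2), η (x + t * -y) :=
    intervalIntegral.integral_mono_on (by norm_num) (by simp) (hi _ _) fun t ht => hm.monotone (by nlinarith [ht.2])
  have h2 : (∫ t in (1/2:ℝ)..1, η (x - y)) ≤ ∫ t in (1/2:ℝ)..1, η (x + t * -y) :=
    intervalIntegral.integral_mono_on (by norm_num) (by simp) (hi _ _) fun t ht => hm.monotone (by nlinarith [ht.2])
  simp only [intervalIntegral.integral_const, smul_eq_mul] at h1 h2
  linarith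

lemma a_est {η : ℝ → ℝ} (h : IsCircleLift η) {N : ℝ} (hq : GQS η N) (x : ℝ) {y : ℝ} (hy : 0 < y) :
    η (x + y) - η x ≤ 2 * (1 + N) * (η (x + y) - avg η x y) ∧ η (x + y) - avg η x y ≤ η (x + y) - η x := by
  have h1 := avg_bd (lift_cont h) h.1 x hy
  have h2 := (hq.2 (x + y / 2) (y / 2) (by linarith)).2
  have e1 : x + y / 2 - y / 2 = x := by ring
  have e2 : x + y / 2 + y / 2 = x + y := by ring
  rw [e1, e2] at h2
  have h3 := avg_lt (lift_cont h) h.1 (x1 := x) (x2 := x) (y1 := 0) (y2 := y) le_rfl (by linarith) (Or.inr (by linarith))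
  rw [avg_zero] at h3
  have := hq.1
  constructor
  · nlinarith
  · linarith

lemma b_est {η : ℝ → ℝ} (h : IsCircleLift η) {N : ℝ} (hq : GQS η N) (x : ℝ) {y : ℝ} (hy : 0 < y) :
    η x - η (x - y) ≤ 2 * (1 + N) * (avg η x (-y) - η (x - y)) ∧ avg η x (-y) - η (x - y) ≤ η x - η (x - y) := by
  have h1 := avg_bd' (lift_cont h) h.1 x hy
  have h2 := (hq.2 (x - y / 2) (y / 2) (by linarith)).1
  have e1 : x - y / 2 - y / 2 = x - y := by ring
  have e2 : x - y / 2 + y / 2 = x := by ring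
  rw [e1, e2] at h2
  have h3 := avg_lt (lift_cont h) h.1 (x1 := x) (x2 := x) (y1 := -y) (y2 := 0) le_rfl (by linarith) (Or.inr (by linarith))
  rw [avg_zero] at h3
  have := hq.1
  constructor
  · nlinarith
  · linarith

/-- The Beurling–Ahlfors map. -/
noncomputable def BA (η : ℝ → ℝ) (z : ℂ) : ℂ :=
  ⟨(avg η z.re z.im + avg η z.re (-z.im)) / 2, avg η z.re z.im - avg η z.re (-z.im)⟩

lemma BA_eq (η : ℝ → ℝ) (z : ℂ) : BA η z = (avg η z.re z.im : ℂ) * (1 / 2 + I) + (avg η z.re (-z.im) : ℂ) * (1 / 2 - I) := by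
  apply Complex.ext <;> simp [BA] <;> ring

lemma BA_continuous {η : ℝ → ℝ} (hη : Continuous η) : Continuous (BA η) := by
  have h1 : Continuous (fun z : ℂ => avg η z.re z.im) :=
    (avg_continuous hη).comp (continuous_re.prodMk continuous_im)
  have h2 : Continuous (fun z : ℂ => avg η z.re (-z.im)) :=
    (avg_continuous hη).comp (continuous_re.prodMk continuous_im.neg)
  have : BA η = fun z => (avg η z.re z.im : ℂ) * (1 / 2 + I) + (avg η z.re (-z.im) : ℂ) * (1 / 2 - I) :=
    funext (BA_eq η)
  rw [this]
  fun_prop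

lemma BA_add_one {η : ℝ → ℝ} (h : IsCircleLift η) (z : ℂ) : BA η (z + 1) = BA η z + 1 := by
  apply Complex.ext <;> simp [BA, avg_add_one h]
  ring

lemma BA_add_int {η : ℝ → ℝ} (h : IsCircleLift η) (z : ℂ) (n : ℤ) : BA η (z + n) = BA η z + n := by
  induction n using Int.induction_on with
  | zero => simp
  | succ i ih =>
    have := BA_add_one h (z + (i:ℤ))
    push_cast at *
    rw [← add_assoc, this, ih]; ring
  | pred i ih =>
    have := BA_add_one h (z + ((-i - 1 : ℤ):ℂ))
    have e : z + ((-i - 1 : ℤ):ℂ) + 1 = z + (-(i:ℤ) : ℤ) := by push_cast; ring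
    rw [e, ih] at this
    push_cast at *
    linear_combination -this

lemma BA_real (η : ℝ → ℝ) (x : ℝ) : BA η x = η x := by
  apply Complex.ext <;> simp [BA, avg_zero]

lemma BA_im_zero (η : ℝ → ℝ) {z : ℂ} (hz : z.im = 0) : (BA η z).im = 0 := by
  simp [BA, hz]

lemma BA_im_pos {η : ℝ → ℝ} (h : IsCircleLift η) {z : ℂ} (hz : 0 < z.im) : 0 < (BA η z).im := by
  have := avg_lt (lift_cont h) h.1 (x1 := z.re) (x2 := z.re) (y1 := -z.im) (y2 := z.im) le_rfl (by linarith) (Or.inr (by linarith))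
  simp [BA, this]

lemma BA_asymp {η : ℝ → ℝ} (h : IsCircleLift η) : ∃ m C : ℝ, 0 ≤ C ∧ ∀ z : ℂ, 0 < z.im →
    ‖BA η z - z - m‖ ≤ C / z.im := by
  obtain ⟨m, C, hC, H⟩ := avg_asymp h
  refine ⟨m, 4 * C, by linarith, fun z hz => ?_⟩
  have h1 := H z.re z.im hz.ne'
  have h2 := H z.re (-z.im) (by linarith)
  rw [abs_neg] at h2
  rw [abs_of_pos hz] at h1 h2
  have e : BA η z - z - m = ((avg η z.re z.im - z.re - z.im / 2 - m : ℝ) : ℂ) * (1 / 2 + I)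
      + ((avg η z.re (-z.im) - z.re - (-z.im) / 2 - m : ℝ) : ℂ) * (1 / 2 - I) := by
    apply Complex.ext <;> simp [BA] <;> ring
  rw [e]
  have n1 : ‖(1 / 2 + I : ℂ)‖ ≤ 2 := (norm_add_le _ _).trans (by norm_num)
  have n2 : ‖(1 / 2 - I : ℂ)‖ ≤ 2 := (norm_sub_le _ _).trans (by norm_num)
  refine (norm_add_le _ _).trans ?_
  rw [norm_mul, norm_mul, Complex.norm_real, Complex.norm_real, Real.norm_eq_abs, Real.norm_eq_abs]
  have p1 := mul_le_mul h1 n1 (norm_nonneg _) (by positivity)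
  have p2 := mul_le_mul h2 n2 (norm_nonneg _) (by positivity)
  calc _ ≤ C / z.im * 2 + C / z.im * 2 := add_le_add p1 p2
    _ = _ := by ring

lemma BA_inj {η : ℝ → ℝ} (h : IsCircleLift η) {z w : ℂ} (hz : 0 ≤ z.im) (hw : 0 ≤ w.im) (he : BA η z = BA η w) : z = w := by
  have h1 := congrArg Complex.re he
  have h2 := congrArg Complex.im he
  simp only [BA] at h1 h2
  have ha : avg η z.re z.im = avg η w.re w.im := by linarith
  have hb : avg η z.re (-z.im) = avg η w.re (-w.im) := by linarith
  have key : ∀ z w : ℂ, 0 ≤ z.im → 0 ≤ w.im → avg η z.re z.im = avg η w.re w.im →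
      avg η z.re (-z.im) = avg η w.re (-w.im) → ¬ z.re < w.re := by
    intro z w hz hw ha hb hlt
    have h3 : w.re + w.im < z.re + z.im := by
      by_contra hc
      push Not at hc
      exact (avg_lt (lift_cont h) h.1 hlt.le hc (Or.inl hlt)).ne ha
    exact (avg_lt (lift_cont h) h.1 hlt.le (by linarith) (Or.inl hlt)).ne hb
  have hre : z.re = w.re := le_antisymm (not_lt.mp (key w z hw hz ha.symm hb.symm)) (not_lt.mp (key z w hz hw ha hb))
  refine Complex.ext hre ?_
  rcases lt_trichotomy z.im w.im with hl | hl | hl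
  · exact absurd ha (avg_lt (lift_cont h) h.1 hre.le (by linarith) (Or.inr (by linarith))).ne
  · exact hl
  · exact absurd ha.symm (avg_lt (lift_cont h) h.1 hre.ge (by linarith) (Or.inr (by linarith))).ne

lemma BA_strict {η : ℝ → ℝ} (hη : Continuous η) {z : ℂ} (hz : 0 < z.im) : ∃ L : ℂ →L[ℝ] ℂ,
    HasStrictFDerivAt (BA η) L z ∧
    L 1 = ((η (z.re + z.im) - η z.re) / z.im : ℝ) * (1 / 2 + I) + ((η z.re - η (z.re - z.im)) / z.im : ℝ) * (1 / 2 - I) ∧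
    L I = ((η (z.re + z.im) - avg η z.re z.im) / z.im : ℝ) * (1 / 2 + I)
      - ((avg η z.re (-z.im) - η (z.re - z.im)) / z.im : ℝ) * (1 / 2 - I) := by
  have p1 : HasStrictFDerivAt (fun z : ℂ => (z.re, z.im)) (reCLM.prod imCLM) z :=
    HasStrictFDerivAt.prodMk reCLM.hasStrictFDerivAt imCLM.hasStrictFDerivAt
  have p2 : HasStrictFDerivAt (fun z : ℂ => (z.re, -z.im)) (reCLM.prod (-imCLM)) z :=
    HasStrictFDerivAt.prodMk reCLM.hasStrictFDerivAt (imCLM.hasStrictFDerivAt.fun_neg)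
  have a1 := HasStrictFDerivAt.comp z (f := fun z : ℂ => (z.re, z.im)) (avg_strict hη z.re hz.ne') p1
  have a2 := HasStrictFDerivAt.comp z (f := fun z : ℂ => (z.re, -z.im)) (avg_strict hη z.re (y := -z.im) (by linarith)) p2
  have b1 := (ofRealCLM.hasStrictFDerivAt (x := avg η z.re z.im)).comp z a1
  have b2 := (ofRealCLM.hasStrictFDerivAt (x := avg η z.re (-z.im))).comp z a2
  have c := (b1.mul_const (1 / 2 + I)).add (b2.mul_const (1 / 2 - I))
  refine ⟨_, c.congr_of_eventuallyEq (Filter.Eventually.of_forall fun w => ?_), ?_, ?_⟩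
  · rw [BA_eq]; simp
  · simp [← sub_eq_add_neg]
    rw [div_neg, ← neg_div]; ring
  · simp [← sub_eq_add_neg]
    rw [div_neg, ← neg_div]; ring

lemma dil_alg {N K p q r s : ℝ} (hN : 1 ≤ N) (hK : 1 ≤ K) (hp : 0 < p) (hq : 0 < q)
    (h1 : p ≤ N * q) (h2 : q ≤ N * p) (h3 : p ≤ K * r) (h4 : q ≤ K * s) (h5 : r ≤ p) (h6 : s ≤ q) :
    ((p + q) / 2) ^ 2 + (p - q) ^ 2 + ((r - s) / 2) ^ 2 + (r + s) ^ 2 ≤ (4 * N * K) * (p * s + q * r) := by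
  have hr : 0 < r := by by_contra hc; nlinarith
  have hs : 0 < s := by by_contra hc; nlinarith
  have e1 : ((p + q) / 2) ^ 2 + (p - q) ^ 2 + ((r - s) / 2) ^ 2 + (r + s) ^ 2 ≤ 4 * (p ^ 2 + q ^ 2) := by
    have : r ^ 2 ≤ p ^ 2 := by nlinarith
    have : s ^ 2 ≤ q ^ 2 := by nlinarith
    nlinarith [sq_nonneg (r - s), mul_pos hp hq]
  have e2 : p ^ 2 + q ^ 2 ≤ N * (2 * (p * q)) := by
    nlinarith [mul_le_mul_of_nonneg_left h1 hp.le, mul_le_mul_of_nonneg_left h2 hq.le]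
  have e3 : 2 * (p * q) ≤ K * (p * s + q * r) := by
    nlinarith [mul_le_mul_of_nonneg_left h3 hq.le, mul_le_mul_of_nonneg_left h4 hp.le]
  have e4 : N * (2 * (p * q)) ≤ N * (K * (p * s + q * r)) := by gcongr
  linarith

lemma BA_qc {η : ℝ → ℝ} (h : IsCircleLift η) {N : ℝ} (hq : GQS η N) : ∃ k : ℝ, 0 ≤ k ∧ k < 1 ∧ ∀ z : ℂ, 0 < z.im →
    ∃ L : ℂ →L[ℝ] ℂ, HasStrictFDerivAt (BA η) L z ∧
      ‖(L 1 + I * L I) / 2‖ ≤ k * ‖(L 1 - I * L I) / 2‖ ∧ (L 1 - I * L I) / 2 ≠ 0 ∧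
      ‖L 1‖ ≤ 4 * (1 + 1 / z.im) ∧ ‖L I‖ ≤ 4 * (1 + 1 / z.im) := by
  have hN := hq.1
  set K := 2 * (1 + N) with hK
  set D := 4 * N * K with hD
  have hD16 : 16 ≤ D := by nlinarith
  refine ⟨√((D - 2) / (D + 2)), Real.sqrt_nonneg _, ?_, ?_⟩
  · rw [Real.sqrt_lt' one_pos, div_lt_iff₀ (by linarith)]; linarith
  intro z hz
  obtain ⟨L, hL, hL1, hLI⟩ := BA_strict (lift_cont h) hz
  refine ⟨L, hL, ?_⟩
  set x := z.re
  set y := z.im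
  have hA : 0 < η (x + y) - η x := sub_pos.mpr (h.1 (by linarith))
  have hB : 0 < η x - η (x - y) := sub_pos.mpr (h.1 (by linarith))
  obtain ⟨q1, q2⟩ := hq.2 x y hz
  obtain ⟨a1, a2⟩ := a_est h hq x hz
  obtain ⟨b1, b2⟩ := b_est h hq x hz
  have uA := lift_upper h x y
  have uB := lift_upper h (x - y) y
  rw [show x - y + y = x by ring] at uB
  set A := η (x + y) - η x
  set B := η x - η (x - y)
  set a := η (x + y) - avg η x y
  set b := avg η x (-y) - η (x - y)
  have ha : 0 < a := by by_contra hc; nlinarith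
  have hb : 0 < b := by by_contra hc; nlinarith
  have hp : 0 < A / y := by positivity
  have hqq : 0 < B / y := by positivity
  have hr : 0 < a / y := by positivity
  have hs : 0 < b / y := by positivity
  have hy := hz
  have dil := dil_alg hN (K := K) (by linarith) hp hqq
    (by rw [← mul_div_assoc]; gcongr) (by rw [← mul_div_assoc]; gcongr) (r := a / y) (s := b / y)
    (by rw [← mul_div_assoc]; gcongr) (by rw [← mul_div_assoc]; gcongr) (by gcongr) (by gcongr)
  have up : A / y ≤ 1 + 1 / y := by
    rw [div_le_iff₀ hz]; field_simp; linarith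
  have uq : B / y ≤ 1 + 1 / y := by
    rw [div_le_iff₀ hz]; field_simp; linarith
  have ur : a / y ≤ A / y := by gcongr
  have us : b / y ≤ B / y := by gcongr
  rw [← hD] at dil
  set p := A / y
  set q := B / y
  set r := a / y
  set s := b / y
  clear_value p q r s D
  have hJ : 0 < p * s + q * r := by positivity
  have n1 : ‖(1 / 2 + I : ℂ)‖ ≤ 2 := (norm_add_le _ _).trans (by norm_num)
  have n2 : ‖(1 / 2 - I : ℂ)‖ ≤ 2 := (norm_sub_le _ _).trans (by norm_num)
  have gn : ‖(L 1 - I * L I) / 2‖ ^ 2 = (((p + q) / 2) ^ 2 + (p - q) ^ 2 + ((r - s) / 2) ^ 2 + (r + s) ^ 2 + 2 * (p * s + q * r)) / 4 := by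
    rw [hL1, hLI, ← Complex.normSq_eq_norm_sq, Complex.normSq_apply]
    simp
    ring
  have hn : ‖(L 1 + I * L I) / 2‖ ^ 2 = (((p + q) / 2) ^ 2 + (p - q) ^ 2 + ((r - s) / 2) ^ 2 + (r + s) ^ 2 - 2 * (p * s + q * r)) / 4 := by
    rw [hL1, hLI, ← Complex.normSq_eq_norm_sq, Complex.normSq_apply]
    simp
    ring
  refine ⟨?_, ?_, ?_, ?_⟩
  · refine abs_le_of_sq_le_sq' ?_ (by positivity) |>.2
    rw [mul_pow, Real.sq_sqrt (div_nonneg (by linarith) (by linarith)), gn, hn, div_mul_eq_mul_div (D - 2), le_div_iff₀ (by linarith)]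
    nlinarith
  · intro h0
    rw [h0, norm_zero] at gn
    nlinarith [sq_nonneg ((p+q)/2), sq_nonneg (p - q), sq_nonneg ((r-s)/2), sq_nonneg (r+s)]
  · rw [hL1]
    refine (norm_add_le _ _).trans ?_
    rw [norm_mul, norm_mul, Complex.norm_real, Complex.norm_real, Real.norm_of_nonneg hp.le, Real.norm_of_nonneg hqq.le]
    linarith [mul_le_mul_of_nonneg_left n1 hp.le, mul_le_mul_of_nonneg_left n2 hqq.le]
  · rw [hLI]
    refine (norm_sub_le _ _).trans ?_
    rw [norm_mul, norm_mul, Complex.norm_real, Complex.norm_real, Real.norm_of_nonneg hr.le, Real.norm_of_nonneg hs.le]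
    linarith [mul_le_mul_of_nonneg_left n1 hr.le, mul_le_mul_of_nonneg_left n2 hs.le]

lemma surj_of_dil {L : ℂ →L[ℝ] ℂ} {k : ℝ} (hk : k < 1) (h1 : ‖(L 1 + I * L I) / 2‖ ≤ k * ‖(L 1 - I * L I) / 2‖)
    (h2 : (L 1 - I * L I) / 2 ≠ 0) : L.range = ⊤ := by
  have hinj : Function.Injective (L : ℂ →ₗ[ℝ] ℂ) := by
    rw [← LinearMap.ker_eq_bot, LinearMap.ker_eq_bot']
    intro v hv
    by_contra hv0
    have h3 := realLin_eq L v
    have hv' : L v = 0 := hv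
    rw [hv'] at h3
    have h4 : (L 1 - I * L I) / 2 * v = - ((L 1 + I * L I) / 2 * conj v) := by linear_combination -h3
    have h5 := congrArg norm h4
    rw [norm_neg, norm_mul, norm_mul, Complex.norm_conj] at h5
    have h6 := mul_right_cancel₀ (norm_ne_zero_iff.mpr hv0) h5
    have h7 : 0 < ‖(L 1 - I * L I) / 2‖ := norm_pos_iff.mpr h2
    nlinarith
  exact LinearMap.range_eq_top.mpr (LinearMap.injective_iff_surjective.mp hinj)

/-- the universal covering of the punctured disc -/
noncomputable def eC (ζ : ℂ) : ℂ := Complex.exp (2 * π * I * ζ)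

/-- a branch of the inverse of `eC` -/
noncomputable def Lam (z : ℂ) : ℂ := Complex.log z / (2 * π * I)

/-- The extension to the disc. -/
noncomputable def FF (η : ℝ → ℝ) (z : ℂ) : ℂ := if z = 0 then 0 else eC (BA η (Lam z))

lemma tpi_ne : (2 * π * I : ℂ) ≠ 0 := by simp [Real.pi_ne_zero]

lemma eC_ne (ζ : ℂ) : eC ζ ≠ 0 := Complex.exp_ne_zero _

lemma eC_Lam {z : ℂ} (hz : z ≠ 0) : eC (Lam z) = z := by
  unfold eC Lam
  rw [mul_div_cancel₀ _ tpi_ne, Complex.exp_log hz]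

lemma eC_add (a b : ℂ) : eC (a + b) = eC a * eC b := by
  unfold eC
  rw [mul_add, Complex.exp_add]

lemma eC_int (n : ℤ) : eC n = 1 := by
  unfold eC
  rw [Complex.exp_eq_one_iff]
  exact ⟨n, by ring⟩

lemma eC_eq {a b : ℂ} (h : eC a = eC b) : ∃ n : ℤ, a = b + n := by
  obtain ⟨n, hn⟩ := Complex.exp_eq_exp_iff_exists_int.mp h
  refine ⟨n, mul_left_cancel₀ tpi_ne ?_⟩
  rw [hn]; ring

lemma norm_eC (ζ : ℂ) : ‖eC ζ‖ = Real.exp (-(2 * π * ζ.im)) := by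
  unfold eC
  rw [Complex.norm_exp]
  simp

lemma eC_continuous : Continuous eC := by unfold eC; fun_prop

lemma FF_eC {η : ℝ → ℝ} (h : IsCircleLift η) (ζ : ℂ) : FF η (eC ζ) = eC (BA η ζ) := by
  unfold FF
  rw [if_neg (eC_ne ζ)]
  obtain ⟨n, hn⟩ := eC_eq (eC_Lam (eC_ne ζ))
  rw [hn, BA_add_int h, eC_add, eC_int, mul_one]

lemma FF_ne {η : ℝ → ℝ} {z : ℂ} (hz : z ≠ 0) : FF η z ≠ 0 := by
  unfold FF
  rw [if_neg hz]; exact eC_ne _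

lemma FF_zero (η : ℝ → ℝ) : FF η 0 = 0 := by simp [FF]

lemma Lam_im {z : ℂ} (hz : z ≠ 0) : Real.exp (-(2 * π * (Lam z).im)) = ‖z‖ := by
  rw [← norm_eC, eC_Lam hz]

lemma Lam_im' {z : ℂ} (hz : z ≠ 0) : (Lam z).im = - Real.log ‖z‖ / (2 * π) := by
  rw [← Lam_im hz, Real.log_exp]
  field_simp

lemma Lam_im_nonneg {z : ℂ} (hz : z ≠ 0) (h1 : ‖z‖ ≤ 1) : 0 ≤ (Lam z).im := by
  rw [Lam_im' hz]
  have := Real.log_nonpos (norm_nonneg z) h1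
  exact div_nonneg (by linarith) (by positivity)

lemma Lam_im_pos {z : ℂ} (hz : z ≠ 0) (h1 : ‖z‖ < 1) : 0 < (Lam z).im := by
  rw [Lam_im' hz]
  have := Real.log_neg (norm_pos_iff.mpr hz) h1
  exact div_pos (by linarith) (by positivity)

lemma Lam_im_zero {z : ℂ} (h1 : ‖z‖ = 1) : (Lam z).im = 0 := by
  rw [Lam_im' (by rintro rfl; simp at h1), h1]; simp

lemma FF_norm_lt {η : ℝ → ℝ} (h : IsCircleLift η) {z : ℂ} (h1 : ‖z‖ < 1) : ‖FF η z‖ < 1 := by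
  by_cases hz : z = 0
  · simp [hz, FF_zero]
  · unfold FF
    rw [if_neg hz, norm_eC, Real.exp_lt_one_iff]
    have := BA_im_pos h (Lam_im_pos hz h1)
    have : 0 < 2 * π * (BA η (Lam z)).im := by positivity
    linarith

lemma FF_norm_eq {η : ℝ → ℝ} {z : ℂ} (h1 : ‖z‖ = 1) : ‖FF η z‖ = 1 := by
  unfold FF
  rw [if_neg (by rintro rfl; simp at h1), norm_eC, BA_im_zero η (Lam_im_zero h1)]; simp

lemma FF_inj {η : ℝ → ℝ} (h : IsCircleLift η) : InjOn (FF η) (closedBall 0 1) := by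
  intro z hz w hw he
  rw [mem_closedBall_zero_iff] at hz hw
  by_cases hz0 : z = 0
  · by_contra hne
    rw [hz0, FF_zero] at he
    exact FF_ne (fun h' => hne (hz0.trans h'.symm)) he.symm
  by_cases hw0 : w = 0
  · rw [hw0, FF_zero] at he
    exact absurd he (FF_ne hz0)
  have he' := he
  unfold FF at he'
  rw [if_neg hz0, if_neg hw0] at he'
  obtain ⟨n, hn⟩ := eC_eq he'
  rw [← BA_add_int h] at hn
  have hq := BA_inj h (Lam_im_nonneg hz0 hz) (by simpa using Lam_im_nonneg hw0 hw) hn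
  rw [← eC_Lam hz0, hq, eC_add, eC_int, mul_one, eC_Lam hw0]

/-- local branch of the inverse of `eC` near `z₀` -/
noncomputable def br (z₀ z : ℂ) : ℂ := Complex.log (z / z₀) / (2 * π * I) + Lam z₀

lemma br_self {z₀ : ℂ} (h : z₀ ≠ 0) : br z₀ z₀ = Lam z₀ := by
  unfold br; rw [div_self h]; simp

lemma eC_br {z₀ z : ℂ} (h0 : z₀ ≠ 0) (h : z ≠ 0) : eC (br z₀ z) = z := by
  unfold br
  rw [eC_add, eC_Lam h0]
  have : eC (Complex.log (z / z₀) / (2 * π * I)) = z / z₀ := eC_Lam (div_ne_zero h h0)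
  rw [this, div_mul_cancel₀ _ h0]

lemma br_deriv {z₀ : ℂ} (h0 : z₀ ≠ 0) : HasStrictDerivAt (br z₀) (1 / (2 * π * I * z₀)) z₀ := by
  have h1 : HasStrictDerivAt (fun z : ℂ => z / z₀) (1 / z₀) z₀ := (hasStrictDerivAt_id z₀).div_const z₀
  have h2 := h1.clog (by rw [div_self h0]; exact one_mem_slitPlane)
  have h3 := (h2.div_const (2 * π * I)).add_const (Lam z₀)
  refine h3.congr_deriv ?_
  have := tpi_ne
  field_simp

lemma FF_br {η : ℝ → ℝ} (h : IsCircleLift η) {z₀ : ℂ} (h0 : z₀ ≠ 0) :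
    FF η =ᶠ[𝓝 z₀] fun z => eC (BA η (br z₀ z)) := by
  filter_upwards [isOpen_ne.mem_nhds h0] with z hz
  conv_lhs => rw [← eC_br h0 hz]
  exact FF_eC h _

lemma eC_deriv (ζ : ℂ) : HasStrictDerivAt eC (2 * π * I * eC ζ) ζ := by
  have h1 : HasStrictDerivAt (fun ζ : ℂ => 2 * π * I * ζ) (2 * π * I * 1) ζ := (hasStrictDerivAt_id ζ).const_mul _
  refine h1.cexp.congr_deriv ?_
  unfold eC; ring

lemma FF_strict {η : ℝ → ℝ} (h : IsCircleLift η) {z₀ : ℂ} (h0 : z₀ ≠ 0) {L : ℂ →L[ℝ] ℂ}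
    (hL : HasStrictFDerivAt (BA η) L (Lam z₀)) : ∃ L' : ℂ →L[ℝ] ℂ, HasStrictFDerivAt (FF η) L' z₀ ∧
      ∀ v, L' v = (2 * π * I * FF η z₀) * L (1 / (2 * π * I * z₀) * v) := by
  have d1 := (br_deriv h0).complexToReal_fderiv
  rw [← br_self h0] at hL
  have d2 := hL.comp z₀ d1
  have d3 := (eC_deriv (BA η (br z₀ z₀))).complexToReal_fderiv
  have d4 := HasStrictFDerivAt.comp z₀ (f := BA η ∘ br z₀) d3 d2
  refine ⟨_, d4.congr_of_eventuallyEq ?_, ?_⟩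
  · filter_upwards [FF_br h h0] with z hz
    rw [hz]; rfl
  · intro v
    rw [(FF_br h h0).eq_of_nhds]
    simp

lemma FF_ratio {η : ℝ → ℝ} {z : ℂ} (hz : z ≠ 0) : FF η z = z * eC (BA η (Lam z) - Lam z) := by
  conv_rhs => rw [show z * eC (BA η (Lam z) - Lam z) = eC (Lam z) * eC (BA η (Lam z) - Lam z) by rw [eC_Lam hz]]
  rw [← eC_add, FF, if_neg hz]
  congr 1; ring

lemma Lam_tendsto : Filter.Tendsto (fun z : ℂ => (Lam z).im) (𝓝[≠] 0) Filter.atTop := by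
  have h1 : Filter.Tendsto (fun z : ℂ => Real.log ‖z‖) (𝓝[≠] 0) Filter.atBot :=
    Real.tendsto_log_nhdsNE_zero.comp (by
      refine tendsto_nhdsWithin_iff.mpr ⟨?_, ?_⟩
      · exact (continuous_norm.tendsto' (0:ℂ) 0 (by simp)).mono_left nhdsWithin_le_nhds
      · filter_upwards [self_mem_nhdsWithin] with z hz
        simpa using hz)
  have h2 : Filter.Tendsto (fun z : ℂ => - Real.log ‖z‖ / (2 * π)) (𝓝[≠] 0) Filter.atTop :=
    (Filter.tendsto_neg_atBot_atTop.comp h1).atTop_div_const (by positivity)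
  refine h2.congr' ?_
  filter_upwards [self_mem_nhdsWithin] with z hz
  rw [Lam_im' hz]

lemma FF_deriv_zero {η : ℝ → ℝ} (h : IsCircleLift η) : ∃ c : ℂ, HasDerivAt (FF η) c 0 := by
  obtain ⟨m, C, hC, H⟩ := BA_asymp h
  refine ⟨eC m, ?_⟩
  rw [hasDerivAt_iff_tendsto_slope]
  have h1 : Filter.Tendsto (fun z : ℂ => BA η (Lam z) - Lam z) (𝓝[≠] 0) (𝓝 (m:ℂ)) := by
    rw [tendsto_iff_norm_sub_tendsto_zero]
    have h2 : Filter.Tendsto (fun z : ℂ => C / (Lam z).im) (𝓝[≠] 0) (𝓝 0) := Lam_tendsto.const_div_atTop C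
    refine squeeze_zero' (Filter.Eventually.of_forall fun _ => norm_nonneg _) ?_ h2
    filter_upwards [Lam_tendsto.eventually_gt_atTop 0] with z hz
    exact H _ hz
  refine ((eC_continuous.tendsto _).comp h1).congr' ?_
  filter_upwards [self_mem_nhdsWithin] with z hz
  have hz' : z ≠ 0 := hz
  simp only [slope, Function.comp, FF_zero, vsub_eq_sub, sub_zero, smul_eq_mul]
  rw [FF_ratio hz', inv_mul_cancel_left₀ hz']

lemma FF_continuous {η : ℝ → ℝ} (h : IsCircleLift η) : Continuous (FF η) := by
  rw [continuous_iff_continuousAt]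
  intro z
  by_cases hz : z = 0
  · obtain ⟨c, hc⟩ := FF_deriv_zero h
    rw [hz]; exact hc.continuousAt
  · have h1 : ContinuousAt (br z) z := (br_deriv hz).hasStrictFDerivAt.continuousAt
    have h2 : ContinuousAt (fun w => eC (BA η (br z w))) z :=
      (eC_continuous.comp (BA_continuous (lift_cont h))).continuousAt.comp h1
    exact h2.congr (FF_br h hz).symm

lemma punct_preconn : IsPreconnected (ball (0:ℂ) 1 \ {0}) := by
  have h1 : ball (0:ℂ) 1 \ {0} = eC '' {ζ : ℂ | 0 < ζ.im} := by
    ext z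
    constructor
    · rintro ⟨h1, h2⟩
      have h2' : z ≠ 0 := h2
      exact ⟨Lam z, Lam_im_pos h2' (by simpa using h1), eC_Lam h2'⟩
    · rintro ⟨ζ, hζ, rfl⟩
      have hζ' : 0 < ζ.im := hζ
      refine ⟨?_, eC_ne ζ⟩
      rw [mem_ball_zero_iff, norm_eC, Real.exp_lt_one_iff]
      have : 0 < 2 * π * ζ.im := by positivity
      linarith
  rw [h1]
  exact (convex_halfSpace_im_gt 0).isPreconnected.image _ eC_continuous.continuousOn

lemma FF_open {η : ℝ → ℝ} (h : IsCircleLift η) {N : ℝ} (hq : GQS η N) : IsOpen (FF η '' (ball (0:ℂ) 1 \ {0})) := by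
  obtain ⟨k, hk0, hk1, H⟩ := BA_qc h hq
  rw [isOpen_iff_mem_nhds]
  rintro _ ⟨z, ⟨hz1, hz2⟩, rfl⟩
  have hz0 : z ≠ 0 := hz2
  have him := Lam_im_pos hz0 (by simpa using hz1)
  obtain ⟨L, hL, d1, d2, -, -⟩ := H _ him
  obtain ⟨L', hL', hv⟩ := FF_strict h hz0 hL
  have hs := surj_of_dil hk1 d1 d2
  have hs' : L'.range = ⊤ := by
    rw [LinearMap.range_eq_top]
    intro w
    have hs2 : Function.Surjective L := LinearMap.range_eq_top.mp hs
    obtain ⟨u, hu⟩ := hs2 (w / (2 * π * I * FF η z))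
    refine ⟨(2 * π * I * z) * u, ?_⟩
    have a1 : (2 * π * I * z : ℂ) ≠ 0 := mul_ne_zero tpi_ne hz0
    have a2 : (2 * π * I * FF η z : ℂ) ≠ 0 := mul_ne_zero tpi_ne (FF_ne hz0)
    change L' _ = w
    rw [hv, ← mul_assoc, one_div, inv_mul_cancel₀ a1, one_mul, hu, mul_div_cancel₀ _ a2]
  rw [← hL'.map_nhds_eq_of_surj hs']
  exact Filter.image_mem_map ((isOpen_ball.sdiff isClosed_singleton).mem_nhds ⟨hz1, hz2⟩)

lemma FF_surj {η : ℝ → ℝ} (h : IsCircleLift η) {N : ℝ} (hq : GQS η N) : SurjOn (FF η) (ball 0 1) (ball 0 1) := by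
  have hopen := FF_open h hq
  have key : ball (0:ℂ) 1 \ {0} ⊆ FF η '' (ball (0:ℂ) 1 \ {0}) := by
    refine punct_preconn.subset_of_closure_inter_subset hopen ?_ ?_
    · have hh : (1/2 : ℂ) ∈ ball (0:ℂ) 1 \ {0} := by
        refine ⟨by rw [mem_ball_zero_iff]; norm_num, by norm_num⟩
      refine ⟨FF η (1/2), ⟨?_, FF_ne (by norm_num)⟩, mem_image_of_mem _ hh⟩
      rw [mem_ball_zero_iff]
      exact FF_norm_lt h (by norm_num)
    · rintro w ⟨hw1, hw2, hw3⟩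
      have hc : IsClosed (FF η '' closedBall 0 1) :=
        ((isCompact_closedBall (0:ℂ) 1).image (FF_continuous h)).isClosed
      have hsub : FF η '' (ball (0:ℂ) 1 \ {0}) ⊆ FF η '' closedBall 0 1 :=
        image_mono (sdiff_subset.trans ball_subset_closedBall)
      obtain ⟨z, hz, rfl⟩ := closure_minimal hsub hc hw1
      refine ⟨z, ⟨?_, ?_⟩, rfl⟩
      · rw [mem_ball_zero_iff] at hw2 ⊢
        rw [mem_closedBall_zero_iff] at hz
        refine lt_of_le_of_ne hz fun h1 => ?_
        rw [FF_norm_eq h1] at hw2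
        exact lt_irrefl _ hw2
      · rintro rfl
        exact hw3 (FF_zero η)
  intro w hw
  by_cases hw0 : w = 0
  · exact ⟨0, by simp, by rw [hw0, FF_zero]⟩
  · exact image_mono sdiff_subset (key ⟨hw, hw0⟩)

lemma FF_bij {η : ℝ → ℝ} (h : IsCircleLift η) {N : ℝ} (hq : GQS η N) : BijOn (FF η) (ball 0 1) (ball 0 1) := by
  refine ⟨?_, (FF_inj h).mono ball_subset_closedBall, FF_surj h hq⟩
  intro z hz
  rw [mem_ball_zero_iff] at hz ⊢
  exact FF_norm_lt h hz

lemma FF_circle {η : ℝ → ℝ} (h : IsCircleLift η) (x : ℝ) : FF η (eC x) = eC (η x) := by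
  rw [FF_eC h, BA_real]

lemma FF_bij_closed {η : ℝ → ℝ} (h : IsCircleLift η) {N : ℝ} (hq : GQS η N) :
    BijOn (FF η) (closedBall 0 1) (closedBall 0 1) := by
  refine ⟨?_, FF_inj h, ?_⟩
  · intro z hz
    rw [mem_closedBall_zero_iff] at hz ⊢
    rcases hz.lt_or_eq with h1 | h1
    · exact (FF_norm_lt h h1).le
    · exact (FF_norm_eq h1).le
  · intro w hw
    rw [mem_closedBall_zero_iff] at hw
    rcases hw.lt_or_eq with h1 | h1
    · exact image_mono ball_subset_closedBall (FF_surj h hq (by simpa using h1))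
    · have hw0 : w ≠ 0 := by rintro rfl; simp at h1
      obtain ⟨x, hx⟩ := h.2.1 (Lam w).re
      refine ⟨eC x, ?_, ?_⟩
      · rw [mem_closedBall_zero_iff, norm_eC]; simp
      · rw [FF_circle h, hx]
        have : (((Lam w).re : ℝ) : ℂ) = Lam w := by
          apply Complex.ext
          · simp
          · simp [Lam_im_zero h1]
        rw [this, eC_Lam hw0]

lemma FF_bound {η : ℝ → ℝ} (h : IsCircleLift η) {N : ℝ} (hq : GQS η N) {ρ : ℝ} (hρ0 : 0 < ρ) (hρ : ρ < 1) (v : ℂ) : ∃ K : ℝ,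
    ∀ z ∈ ball (0:ℂ) ρ, ‖fderiv ℝ (FF η) z v‖ ≤ K := by
  obtain ⟨k, hk0, hk1, H⟩ := BA_qc h hq
  obtain ⟨m, C, hC, Ha⟩ := BA_asymp h
  set y0 := - Real.log ρ / (2 * π) with hy0
  have hy0p : 0 < y0 := div_pos (by linarith [Real.log_neg hρ0 hρ]) (by positivity)
  refine ⟨max ‖fderiv ℝ (FF η) 0 v‖ (Real.exp (2 * π * (C / y0)) * (8 * (1 + 1 / y0) * ‖v‖)), ?_⟩
  intro z hz
  rw [mem_ball_zero_iff] at hz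
  by_cases hz0 : z = 0
  · rw [hz0]; exact le_max_left _ _
  refine le_trans ?_ (le_max_right _ _)
  have hy : y0 ≤ (Lam z).im := by
    rw [Lam_im' hz0, hy0]
    have := Real.log_le_log (norm_pos_iff.mpr hz0) hz.le
    gcongr
  have him : 0 < (Lam z).im := hy0p.trans_le hy
  obtain ⟨L, hL, -, -, l1, l2⟩ := H _ him
  obtain ⟨L', hL', hv⟩ := FF_strict h hz0 hL
  rw [hL'.hasFDerivAt.fderiv, hv]
  have hLb : ∀ w, ‖L w‖ ≤ 8 * (1 + 1 / y0) * ‖w‖ := by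
    intro w
    have e : L w = (w.re : ℂ) * L 1 + (w.im : ℂ) * L I := by
      conv_lhs => rw [show w = w.re • (1:ℂ) + w.im • I by simp]
      rw [map_add, map_smul, map_smul]; simp
    rw [e]
    refine (norm_add_le _ _).trans ?_
    rw [norm_mul, norm_mul, Complex.norm_real, Complex.norm_real]
    have hi : 1 / (Lam z).im ≤ 1 / y0 := by gcongr
    have b1 : ‖L 1‖ ≤ 4 * (1 + 1 / y0) := by linarith
    have b2 : ‖L I‖ ≤ 4 * (1 + 1 / y0) := by linarith
    have c1 := mul_le_mul (abs_re_le_norm w) b1 (norm_nonneg _) (norm_nonneg _)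
    have c2 := mul_le_mul (abs_im_le_norm w) b2 (norm_nonneg _) (norm_nonneg _)
    rw [Real.norm_eq_abs, Real.norm_eq_abs]
    linarith
  have hr : ‖FF η z‖ ≤ Real.exp (2 * π * (C / y0)) * ‖z‖ := by
    rw [FF_ratio hz0, norm_mul, mul_comm]
    gcongr
    rw [norm_eC, Real.exp_le_exp]
    have h1 := Ha _ him
    have h2 := (abs_im_le_norm (BA η (Lam z) - Lam z - m)).trans h1
    have h3 : C / (Lam z).im ≤ C / y0 := by gcongr
    have h4 := (neg_le_of_abs_le (h2.trans h3))
    simp only [sub_im, ofReal_im, sub_zero] at h4 ⊢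
    have hpi := Real.pi_pos
    nlinarith
  have hz' : 0 < ‖z‖ := norm_pos_iff.mpr hz0
  have n2 : 0 < ‖(2 * π * I : ℂ)‖ := norm_pos_iff.mpr tpi_ne
  calc ‖2 * π * I * FF η z * L (1 / (2 * π * I * z) * v)‖
      ≤ ‖(2 * π * I : ℂ)‖ * ‖FF η z‖ * (8 * (1 + 1 / y0) * ‖1 / (2 * π * I * z) * v‖) := by
        rw [norm_mul, norm_mul (2 * π * I : ℂ)]
        gcongr
        exact hLb _
    _ = ‖FF η z‖ / ‖z‖ * (8 * (1 + 1 / y0) * ‖v‖) := by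
        rw [norm_mul _ v, norm_div, norm_mul (2 * π * I : ℂ) z, norm_one]
        field_simp
    _ ≤ _ := by
        gcongr
        rw [div_le_iff₀ hz']
        exact hr

lemma FF_locInt {η : ℝ → ℝ} (h : IsCircleLift η) {N : ℝ} (hq : GQS η N) (v : ℂ) :
    LocallyIntegrableOn (fun z => fderiv ℝ (FF η) z v) (ball (0:ℂ) 1) := by
  intro x hx
  rw [mem_ball_zero_iff] at hx
  have hx0 := norm_nonneg x
  obtain ⟨K, hK⟩ := FF_bound h hq (ρ := (1 + ‖x‖) / 2) (by linarith) (by linarith) v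
  refine ⟨ball 0 ((1 + ‖x‖) / 2), mem_nhdsWithin_of_mem_nhds (isOpen_ball.mem_nhds (by rw [mem_ball_zero_iff]; linarith)), ?_⟩
  refine Measure.integrableOn_of_bounded (M := K) measure_ball_lt_top.ne (measurable_fderiv_apply_const ℝ (FF η) v).aestronglyMeasurable ?_
  exact (ae_restrict_iff' measurableSet_ball).mpr (Filter.Eventually.of_forall hK)

lemma FF_qc {η : ℝ → ℝ} (h : IsCircleLift η) {N : ℝ} (hq : GQS η N) : QuasiconformalOn unitDisc (FF η) := by
  obtain ⟨k, hk0, hk1, H⟩ := BA_qc h hq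
  have Hd : ∀ z ∈ ball (0:ℂ) 1, z ≠ 0 → ∃ L L' : ℂ →L[ℝ] ℂ, HasFDerivAt (FF η) L' z ∧
      (∀ v, L' v = (2 * π * I * FF η z) * L (1 / (2 * π * I * z) * v)) ∧
      ‖(L 1 + I * L I) / 2‖ ≤ k * ‖(L 1 - I * L I) / 2‖ := by
    intro z hz hz0
    obtain ⟨L, hL, d1, -, -, -⟩ := H _ (Lam_im_pos hz0 (by simpa using hz))
    obtain ⟨L', hL', hv⟩ := FF_strict h hz0 hL
    exact ⟨L, L', hL'.hasFDerivAt, hv, d1⟩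
  refine ⟨k, hk0, hk1, wirtingerZ (FF η), wirtingerZBar (FF η), ?_, ?_⟩
  · refine classical_weak isOpen_ball ?_ (FF_locInt h hq 1) (FF_locInt h hq I)
    intro z hz
    by_cases hz0 : z = 0
    · obtain ⟨c, hc⟩ := FF_deriv_zero h
      rw [hz0]
      exact hc.complexToReal_fderiv.differentiableAt
    · obtain ⟨L, L', hL', -⟩ := Hd z hz hz0
      exact hL'.differentiableAt
  · have hne : ∀ᵐ z ∂(volume : Measure ℂ), z ≠ 0 := by
      rw [ae_iff]; simp
    unfold unitDisc
    filter_upwards [ae_restrict_mem measurableSet_ball, ae_restrict_of_ae hne] with z hz hz0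
    obtain ⟨L, L', hL', hv, hd⟩ := Hd z hz hz0
    rw [wirtingerZ_of_hasFDerivAt hL', wirtingerZBar_of_hasFDerivAt hL']
    set c1 := 2 * π * I * FF η z
    set c2 := 1 / (2 * π * I * z)
    clear_value c1 c2
    have e1 : (L' 1 - I * L' I) / 2 = c1 * c2 * ((L 1 - I * L I) / 2) := by
      rw [hv, hv, realLin_eq L (c2 * 1), realLin_eq L (c2 * I)]
      simp only [map_mul, map_one, conj_I]
      linear_combination (c1 * ((L 1 + I * L I) / 2 * conj c2 - (L 1 - I * L I) / 2 * c2)) / 2 * I_sq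
    have e2 : (L' 1 + I * L' I) / 2 = c1 * conj c2 * ((L 1 + I * L I) / 2) := by
      rw [hv, hv, realLin_eq L (c2 * 1), realLin_eq L (c2 * I)]
      simp only [map_mul, map_one, conj_I]
      linear_combination (c1 * ((L 1 - I * L I) / 2 * c2 - (L 1 + I * L I) / 2 * conj c2)) / 2 * I_sq
    rw [e1, e2, norm_mul (c1 * c2), norm_mul c1 c2, norm_mul (c1 * conj c2), norm_mul c1 (conj c2), Complex.norm_conj]
    calc _ ≤ ‖c1‖ * ‖c2‖ * (k * ‖(L 1 - I * L I) / 2‖) := by gcongr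
      _ = _ := by ring

/-- **Beurling–Ahlfors extension theorem.**  An orientation-preserving homeomorphism `η`
of the circle (given by its lift `η̃`) is quasisymmetric if and only if it extends to a
homeomorphism `F` of the closed unit disc onto itself whose restriction to the open disc
is a quasiconformal homeomorphism of `𝔻` onto `𝔻`, and which on the unit circle coincides
with `η`, i.e. `F (e^{2πix}) = e^{2πi η̃(x)}` for all real `x`.  (A continuous bijection of
the compact set `closure 𝔻` onto itself is automatically a homeomorphism.) -/
theorem beurling_ahlfors_extension (ηt : ℝ → ℝ) (hlift : IsCircleLift ηt) :
    (∃ M : ℝ, QSConst ηt M) ↔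
    ∃ F : ℂ → ℂ,
      ContinuousOn F (closure unitDisc) ∧
      Set.BijOn F (closure unitDisc) (closure unitDisc) ∧
      Set.BijOn F unitDisc unitDisc ∧
      QuasiconformalOn unitDisc F ∧
      ∀ x : ℝ, F (Complex.exp (2 * Real.pi * Complex.I * x)) =
        Complex.exp (2 * Real.pi * Complex.I * ηt x) := by
  constructor
  · rintro ⟨M, hM⟩
    have hq := gqs_of_qs hlift hM
    have hcl : closure unitDisc = closedBall 0 1 := closure_ball _ one_ne_zero
    refine ⟨FF ηt, (FF_continuous hlift).continuousOn, ?_, FF_bij hlift hq, FF_qc hlift hq, FF_circle hlift⟩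
    rw [hcl]
    exact FF_bij_closed hlift hq
  · rintro ⟨F, hF, -, hbij, hqc, hbd⟩
    exact qs_of_ext ηt hlift F hF hbij hqc hbd
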